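/- Let (R, m) be a commutative Noetherian local ring and let C be a semidualizing R-module. If there exists a non-zero Cohen-Macaulay R-module M whose C-projective dimension cpd_R(M) is finite, then R is a Cohen-Macaulay ring. -/

import Mathlib

/-!
Definitions needed to state results of "On flat and Gorenstein flat dimensions of
local cohomology modules" by M.R. Zargar and H. Zakeri.
-/

open CategoryTheory IsLocalRing

universe u

namespace Paper

variable (R : Type u) [CommRing R]

/-! ## Resolution/coresolution dimensions with respect to a class of modules -/

/-- `ResDimLE R P n M` : `M` admits a resolution `0 → Xₙ → ⋯ → X₀ → M → 0`
with each `Xᵢ` in the class `P`. -/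
def ResDimLE (P : ModuleCat.{u} R → Prop) : ℕ → ModuleCat.{u} R → Prop
  | 0, M => P M
  | n + 1, M => ResDimLE P n M ∨
      ∃ (X : ModuleCat.{u} R) (f : X →ₗ[R] M), P X ∧ Function.Surjective f ∧
        ResDimLE P n (ModuleCat.of R (LinearMap.ker f))

/-- `CoresDimLE R P n M` : `M` admits a coresolution `0 → M → X₀ → ⋯ → Xₙ → 0`
with each `Xᵢ` in the class `P`. -/
def CoresDimLE (P : ModuleCat.{u} R → Prop) : ℕ → ModuleCat.{u} R → Prop
  | 0, M => P M
  | n + 1, M => CoresDimLE P n M ∨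
      ∃ (X : ModuleCat.{u} R) (f : M →ₗ[R] X), P X ∧ Function.Injective f ∧
        CoresDimLE P n (ModuleCat.of R (X ⧸ LinearMap.range f))

/-- The resolution dimension of `M` with respect to the class `P`, as an
extended natural number (`⊤` if there is no finite resolution). -/
noncomputable def ResDim (P : ModuleCat.{u} R → Prop) (M : ModuleCat.{u} R) : ℕ∞ :=
  sInf {n : ℕ∞ | ∃ k : ℕ, (k : ℕ∞) = n ∧ ResDimLE R P k M}

/-- The coresolution dimension of `M` with respect to the class `P`. -/
noncomputable def CoresDim (P : ModuleCat.{u} R → Prop) (M : ModuleCat.{u} R) : ℕ∞ :=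
  sInf {n : ℕ∞ | ∃ k : ℕ, (k : ℕ∞) = n ∧ CoresDimLE R P k M}

/-- Flat dimension `fd_R M`. -/
noncomputable def flatDim (M : Type u) [AddCommGroup M] [Module R M] : ℕ∞ :=
  ResDim R (fun N => Module.Flat R N) (ModuleCat.of R M)

/-- Projective dimension `pd_R M`. -/
noncomputable def projDim (M : Type u) [AddCommGroup M] [Module R M] : ℕ∞ :=
  ResDim R (fun N => Module.Projective R N) (ModuleCat.of R M)

/-- Injective dimension `id_R M`. -/
noncomputable def injDim (M : Type u) [AddCommGroup M] [Module R M] : ℕ∞ :=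
  CoresDim R (fun N => Module.Injective R N) (ModuleCat.of R M)

/-! ## Local cohomology -/

/-- The local cohomology module `H^i_𝔞(M)`, as an object of `ModuleCat R`. -/
noncomputable def lcoh (𝔞 : Ideal R) (i : ℕ) (M : Type u) [AddCommGroup M] [Module R M] :
    ModuleCat.{u} R :=
  (localCohomology 𝔞 i).obj (ModuleCat.of R M)

/-- `M` is relative Cohen-Macaulay with respect to `𝔞` with `ht_M 𝔞 = n`, i.e. the
`n`-th local cohomology of `M` with respect to `𝔞` is the only non-vanishing one. -/
def IsRelCM (𝔞 : Ideal R) (n : ℕ) (M : Type u) [AddCommGroup M] [Module R M] : Prop :=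
  (∀ i : ℕ, i ≠ n → Subsingleton (lcoh R 𝔞 i M)) ∧ ¬ Subsingleton (lcoh R 𝔞 n M)

/-! ## Depth, dimension, Cohen-Macaulay -/

/-- The depth of a module over a local ring: the supremum of the lengths of
`M`-regular sequences contained in the maximal ideal. -/
noncomputable def depth [IsLocalRing R] (M : Type u) [AddCommGroup M] [Module R M] : ℕ∞ :=
  sSup {n : ℕ∞ | ∃ rs : List R, (rs.length : ℕ∞) = n ∧ (∀ x ∈ rs, x ∈ maximalIdeal R) ∧
    RingTheory.Sequence.IsRegular M rs}

/-- The (Krull) dimension of a module: the Krull dimension of `R` modulo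
the annihilator of `M` (`⊥` for the zero module). -/
noncomputable def moduleDim (M : Type u) [AddCommGroup M] [Module R M] : WithBot ℕ∞ :=
  ringKrullDim (R ⧸ Module.annihilator R M)

/-- A finitely generated module over a local ring is Cohen-Macaulay
if its depth equals its dimension. -/
def IsCohenMacaulayModule [IsLocalRing R] (M : Type u) [AddCommGroup M] [Module R M] : Prop :=
  (depth R M : WithBot ℕ∞) = moduleDim R M

/-- A local ring is Cohen-Macaulay if it is so as a module over itself. -/
def IsCohenMacaulayRing [IsLocalRing R] : Prop := IsCohenMacaulayModule R R

/-- A local ring is Gorenstein if it has finite injective dimension over itself. -/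
def IsGorensteinRing : Prop := injDim R R ≠ ⊤

/-! ## Ext, Tor, semidualizing modules -/

/-- `Ext^i_R(A, B)`. -/
noncomputable def ext (i : ℕ) (A B : Type u) [AddCommGroup A] [Module R A]
    [AddCommGroup B] [Module R B] : ModuleCat.{u} R :=
  ((Ext R (ModuleCat.{u} R) i).obj (Opposite.op (ModuleCat.of R A))).obj (ModuleCat.of R B)

/-- `Tor^R_p(A, B)` indexed by `p : ℤ`, with the convention that it vanishes in
negative degrees. -/
noncomputable def tor (p : ℤ) (A B : Type u) [AddCommGroup A] [Module R A]
    [AddCommGroup B] [Module R B] : ModuleCat.{u} R :=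
  if 0 ≤ p then ((Tor (ModuleCat.{u} R) p.toNat).obj (ModuleCat.of R A)).obj (ModuleCat.of R B)
  else ModuleCat.of R PUnit

/-- A finitely generated module `C` is semidualizing if the natural map
`R → Hom_R(C, C)` is bijective and `Ext^i_R(C, C) = 0` for all `i ≥ 1`. -/
def IsSemidualizing (C : Type u) [AddCommGroup C] [Module R C] : Prop :=
  Module.Finite R C ∧
  Function.Bijective (fun r : R => (r • LinearMap.id : C →ₗ[R] C)) ∧
  ∀ i : ℕ, 1 ≤ i → Subsingleton (ext R i C C)

/-! ## Gorenstein homological classes -/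

/-- `N` is Gorenstein injective: it is the kernel of the `0`-th differential of some
exact complex `Y` of injective modules which stays exact under `Hom(I, -)` for every
injective module `I`. (The complex is written cohomologically.) -/
def IsGorensteinInjective (N : Type u) [AddCommGroup N] [Module R N] : Prop :=
  ∃ (Y : ℤ → ModuleCat.{u} R) (d : ∀ i : ℤ, Y i →ₗ[R] Y (i + 1)),
    (∀ i, Module.Injective R (Y i)) ∧
    (∀ i, Function.Exact (d i) (d (i + 1))) ∧
    (∀ (I : ModuleCat.{u} R), Module.Injective R I →
      ∀ (i : ℤ) (g : I →ₗ[R] Y (i + 1)), (d (i + 1)).comp g = 0 →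
        ∃ h : I →ₗ[R] Y i, (d i).comp h = g) ∧
    ∃ ι : N →ₗ[R] Y 0, Function.Injective ι ∧ Function.Exact ι (d 0)

/-- `N` is Gorenstein projective: it is the cokernel of a differential of some
exact complex `X` of projective modules which stays exact under `Hom(-, P)` for
every projective module `P`. -/
def IsGorensteinProjective (N : Type u) [AddCommGroup N] [Module R N] : Prop :=
  ∃ (X : ℤ → ModuleCat.{u} R) (d : ∀ i : ℤ, X i →ₗ[R] X (i + 1)),
    (∀ i, Module.Projective R (X i)) ∧
    (∀ i, Function.Exact (d i) (d (i + 1))) ∧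
    (∀ (P : ModuleCat.{u} R), Module.Projective R P →
      ∀ (i : ℤ) (g : X (i + 1) →ₗ[R] P), g.comp (d i) = 0 →
        ∃ h : X (i + 1 + 1) →ₗ[R] P, h.comp (d (i + 1)) = g) ∧
    ∃ π : X 0 →ₗ[R] N, Function.Surjective π ∧ Function.Exact (d (-1)) π

/-- `N` is Gorenstein flat: it is the cokernel of a differential of some exact
complex `Z` of flat modules which stays exact under `- ⊗ I` for every injective
module `I`. -/
def IsGorensteinFlat (N : Type u) [AddCommGroup N] [Module R N] : Prop :=
  ∃ (Z : ℤ → ModuleCat.{u} R) (d : ∀ i : ℤ, Z i →ₗ[R] Z (i + 1)),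
    (∀ i, Module.Flat R (Z i)) ∧
    (∀ i, Function.Exact (d i) (d (i + 1))) ∧
    (∀ (I : ModuleCat.{u} R), Module.Injective R I →
      ∀ i : ℤ, Function.Exact (LinearMap.rTensor (R := R) I (d i))
        (LinearMap.rTensor (R := R) I (d (i + 1)))) ∧
    ∃ π : Z 0 →ₗ[R] N, Function.Surjective π ∧ Function.Exact (d (-1)) π

/-- Gorenstein injective dimension `Gid_R M`. -/
noncomputable def GinjDim (M : Type u) [AddCommGroup M] [Module R M] : ℕ∞ :=
  CoresDim R (fun N => IsGorensteinInjective R N) (ModuleCat.of R M)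

/-- Gorenstein projective dimension `Gpd_R M`. -/
noncomputable def GprojDim (M : Type u) [AddCommGroup M] [Module R M] : ℕ∞ :=
  ResDim R (fun N => IsGorensteinProjective R N) (ModuleCat.of R M)

/-- Gorenstein flat dimension `Gfd_R M`. -/
noncomputable def GflatDim (M : Type u) [AddCommGroup M] [Module R M] : ℕ∞ :=
  ResDim R (fun N => IsGorensteinFlat R N) (ModuleCat.of R M)

/-! ## `C`-injective, `C`-projective, `C`-flat modules and the `G_C`-classes -/

/-- `N` is `C`-injective if `N ≅ Hom_R(C, I)` for some injective module `I`. -/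
def IsCInjective (C : Type u) [AddCommGroup C] [Module R C]
    (N : Type u) [AddCommGroup N] [Module R N] : Prop :=
  ∃ I : ModuleCat.{u} R, Module.Injective R I ∧ Nonempty (N ≃ₗ[R] (C →ₗ[R] I))

/-- `N` is `C`-projective if `N ≅ C ⊗_R P` for some projective module `P`. -/
def IsCProjective (C : Type u) [AddCommGroup C] [Module R C]
    (N : Type u) [AddCommGroup N] [Module R N] : Prop :=
  ∃ P : ModuleCat.{u} R, Module.Projective R P ∧ Nonempty (N ≃ₗ[R] TensorProduct R C P)

/-- `N` is `C`-flat if `N ≅ C ⊗_R F` for some flat module `F`. -/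
def IsCFlat (C : Type u) [AddCommGroup C] [Module R C]
    (N : Type u) [AddCommGroup N] [Module R N] : Prop :=
  ∃ F : ModuleCat.{u} R, Module.Flat R F ∧ Nonempty (N ≃ₗ[R] TensorProduct R C F)

/-- `C`-injective dimension `cid_R M`. -/
noncomputable def cInjDim (C : Type u) [AddCommGroup C] [Module R C]
    (M : Type u) [AddCommGroup M] [Module R M] : ℕ∞ :=
  CoresDim R (fun N => IsCInjective R C N) (ModuleCat.of R M)

/-- `C`-projective dimension `cpd_R M`. -/
noncomputable def cProjDim (C : Type u) [AddCommGroup C] [Module R C]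
    (M : Type u) [AddCommGroup M] [Module R M] : ℕ∞ :=
  ResDim R (fun N => IsCProjective R C N) (ModuleCat.of R M)

/-- `N` is `G_C`-injective: `N` is the kernel of the `0`-th differential of an exact
complex `Y` (a complete `I_C I`-coresolution) with `Y i` injective in degrees belonging
to the coresolution part and `C`-injective elsewhere, such that `Hom(I', Y)` is exact
for every `C`-injective module `I'`. -/
def IsGCInjective (C : Type u) [AddCommGroup C] [Module R C]
    (N : Type u) [AddCommGroup N] [Module R N] : Prop :=
  ∃ (Y : ℤ → ModuleCat.{u} R) (d : ∀ i : ℤ, Y i →ₗ[R] Y (i + 1)),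
    (∀ i : ℤ, 0 ≤ i → Module.Injective R (Y i)) ∧
    (∀ i : ℤ, i < 0 → IsCInjective R C (Y i)) ∧
    (∀ i, Function.Exact (d i) (d (i + 1))) ∧
    (∀ (I : ModuleCat.{u} R), IsCInjective R C I →
      ∀ (i : ℤ) (g : I →ₗ[R] Y (i + 1)), (d (i + 1)).comp g = 0 →
        ∃ h : I →ₗ[R] Y i, (d i).comp h = g) ∧
    ∃ ι : N →ₗ[R] Y 0, Function.Injective ι ∧ Function.Exact ι (d 0)

/-- `N` is `G_C`-projective: the cokernel of the degree `0` differential of a complete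
`P_C P`-resolution. -/
def IsGCProjective (C : Type u) [AddCommGroup C] [Module R C]
    (N : Type u) [AddCommGroup N] [Module R N] : Prop :=
  ∃ (X : ℤ → ModuleCat.{u} R) (d : ∀ i : ℤ, X i →ₗ[R] X (i + 1)),
    (∀ i : ℤ, i ≤ 0 → Module.Projective R (X i)) ∧
    (∀ i : ℤ, 0 < i → IsCProjective R C (X i)) ∧
    (∀ i, Function.Exact (d i) (d (i + 1))) ∧
    (∀ (Q : ModuleCat.{u} R), IsCProjective R C Q →
      ∀ (i : ℤ) (g : X (i + 1) →ₗ[R] Q), g.comp (d i) = 0 →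
        ∃ h : X (i + 1 + 1) →ₗ[R] Q, h.comp (d (i + 1)) = g) ∧
    ∃ π : X 0 →ₗ[R] N, Function.Surjective π ∧ Function.Exact (d (-1)) π

/-- `N` is `G_C`-flat: the cokernel of the degree `0` differential of a complete
`F_C F`-resolution. -/
def IsGCFlat (C : Type u) [AddCommGroup C] [Module R C]
    (N : Type u) [AddCommGroup N] [Module R N] : Prop :=
  ∃ (Z : ℤ → ModuleCat.{u} R) (d : ∀ i : ℤ, Z i →ₗ[R] Z (i + 1)),
    (∀ i : ℤ, i ≤ 0 → Module.Flat R (Z i)) ∧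
    (∀ i : ℤ, 0 < i → IsCFlat R C (Z i)) ∧
    (∀ i, Function.Exact (d i) (d (i + 1))) ∧
    (∀ (J : ModuleCat.{u} R), IsCInjective R C J →
      ∀ i : ℤ, Function.Exact (LinearMap.rTensor (R := R) J (d i))
        (LinearMap.rTensor (R := R) J (d (i + 1)))) ∧
    ∃ π : Z 0 →ₗ[R] N, Function.Surjective π ∧ Function.Exact (d (-1)) π

/-- `G_C`-injective dimension `Gid_C M`. -/
noncomputable def GCinjDim (C : Type u) [AddCommGroup C] [Module R C]
    (M : Type u) [AddCommGroup M] [Module R M] : ℕ∞ :=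
  CoresDim R (fun N => IsGCInjective R C N) (ModuleCat.of R M)

/-- `G_C`-projective dimension `G_C-pd_R M`. -/
noncomputable def GCprojDim (C : Type u) [AddCommGroup C] [Module R C]
    (M : Type u) [AddCommGroup M] [Module R M] : ℕ∞ :=
  ResDim R (fun N => IsGCProjective R C N) (ModuleCat.of R M)

/-- `G_C`-flat dimension `G_C-fd_R M`. -/
noncomputable def GCflatDim (C : Type u) [AddCommGroup C] [Module R C]
    (M : Type u) [AddCommGroup M] [Module R M] : ℕ∞ :=
  ResDim R (fun N => IsGCFlat R C N) (ModuleCat.of R M)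

end Paper


set_option linter.unusedSectionVars false
set_option linter.unusedVariables false
set_option linter.style.haveILetI false
set_option linter.unusedSimpArgs false

section
namespace NIT

/-! ### Lengths of subquotients -/

section Slen
variable {A : Type*} [CommRing A] {M M' : Type*} [AddCommGroup M] [Module A M]
  [AddCommGroup M'] [Module A M']

/-- The length of `Q / (P ∩ Q)`. -/
noncomputable def slen (P Q : Submodule A M) : ℕ∞ := Module.length A (Q ⧸ P.submoduleOf Q)

lemma slen_map (f : M →ₗ[A] M') (P Q : Submodule A M) (P' Q' : Submodule A M')
    (h1 : ∀ x ∈ Q, f x ∈ Q') (h2 : ∀ y ∈ Q', ∃ x ∈ Q, y - f x ∈ P')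
    (h3 : ∀ x ∈ Q, f x ∈ P' ↔ x ∈ P) : slen P Q = slen P' Q' := by
  unfold slen
  let g : Q →ₗ[A] (Q' ⧸ P'.submoduleOf Q') :=
    (P'.submoduleOf Q').mkQ ∘ₗ (f.restrict h1)
  have hs : Function.Surjective g := by
    intro y
    obtain ⟨⟨y, hy⟩, rfl⟩ := Submodule.mkQ_surjective _ y
    obtain ⟨x, hx, hxy⟩ := h2 y hy
    refine ⟨⟨x, hx⟩, ?_⟩
    simp only [g, LinearMap.comp_apply]
    symm
    rw [← sub_eq_zero, ← map_sub, Submodule.mkQ_apply, Submodule.Quotient.mk_eq_zero]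
    exact hxy
  have hk : LinearMap.ker g = P.submoduleOf Q := by
    ext ⟨x, hx⟩
    simp only [g, LinearMap.mem_ker, LinearMap.comp_apply, Submodule.mkQ_apply,
      Submodule.Quotient.mk_eq_zero]
    exact h3 x hx
  exact ((Submodule.quotEquivOfEq _ _ hk.symm).trans (g.quotKerEquivOfSurjective hs)).length_eq

lemma slen_add (P Q S : Submodule A M) (h1 : P ≤ Q) (h2 : Q ≤ S) :
    slen P S = slen P Q + slen Q S := by
  unfold slen
  have hf : P.submoduleOf Q ≤ (P.submoduleOf S).comap (Submodule.inclusion h2) :=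
    fun x hx => hx
  have hg : P.submoduleOf S ≤ (Q.submoduleOf S).comap LinearMap.id := fun x hx => h1 hx
  let f : (Q ⧸ P.submoduleOf Q) →ₗ[A] (S ⧸ P.submoduleOf S) := Submodule.mapQ _ _ _ hf
  let g : (S ⧸ P.submoduleOf S) →ₗ[A] (S ⧸ Q.submoduleOf S) := Submodule.mapQ _ _ _ hg
  refine Module.length_eq_add_of_exact f g ?_ ?_ ?_
  · rw [← LinearMap.ker_eq_bot, LinearMap.ker_eq_bot']
    intro x hx
    obtain ⟨x, rfl⟩ := Submodule.mkQ_surjective _ x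
    exact (Submodule.Quotient.mk_eq_zero _).2 (by
      have := (Submodule.Quotient.mk_eq_zero (P.submoduleOf S)
        (x := Submodule.inclusion h2 x)).1 hx
      exact this)
  · intro x
    obtain ⟨x, rfl⟩ := Submodule.mkQ_surjective _ x
    exact ⟨Submodule.Quotient.mk x, rfl⟩
  · intro x
    obtain ⟨⟨x, hx⟩, rfl⟩ := Submodule.mkQ_surjective _ x
    constructor
    · intro h
      have h' : x ∈ Q := (Submodule.Quotient.mk_eq_zero (Q.submoduleOf S)
        (x := (⟨x, hx⟩ : S))).1 h
      exact ⟨Submodule.Quotient.mk ⟨x, h'⟩, rfl⟩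
    · rintro ⟨y, hy⟩
      obtain ⟨⟨y, hyQ⟩, rfl⟩ := Submodule.mkQ_surjective _ y
      have h3 : y - x ∈ P := (Submodule.Quotient.eq (P.submoduleOf S)
        (x := (⟨y, h2 hyQ⟩ : S)) (y := (⟨x, hx⟩ : S))).1 hy
      have h4 : x ∈ Q := by
        have : x = y - (y - x) := by abel
        rw [this]
        exact sub_mem hyQ (h1 h3)
      exact (Submodule.Quotient.mk_eq_zero (Q.submoduleOf S) (x := (⟨x, hx⟩ : S))).2 h4

lemma slen_le_length (P Q : Submodule A M) : slen P Q ≤ Module.length A M :=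
  (Module.length_le_of_surjective _ (Submodule.mkQ_surjective _)).trans
    (Module.length_le_of_injective Q.subtype Q.injective_subtype)

lemma slen_eq_zero (P Q : Submodule A M) (h : Q ≤ P) : slen P Q = 0 := by
  unfold slen
  rw [Module.length_eq_zero_iff, Submodule.Quotient.subsingleton_iff, Submodule.submoduleOf_eq_top]
  exact h

lemma le_of_slen_eq_zero (P Q : Submodule A M) (h : slen P Q = 0) : Q ≤ P := by
  unfold slen at h
  rwa [Module.length_eq_zero_iff, Submodule.Quotient.subsingleton_iff,
    Submodule.submoduleOf_eq_top] at h

end Slen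

/-! ### Complexes -/

section Cx

variable {A : Type*} [CommRing A]
  {X : ℕ → Type*} [∀ j, AddCommGroup (X j)] [∀ j, Module A (X j)]
  {X₁ : ℕ → Type*} [∀ j, AddCommGroup (X₁ j)] [∀ j, Module A (X₁ j)]
  {X₂ : ℕ → Type*} [∀ j, AddCommGroup (X₂ j)] [∀ j, Module A (X₂ j)]
  {X₃ : ℕ → Type*} [∀ j, AddCommGroup (X₃ j)] [∀ j, Module A (X₃ j)]

/-- cycles -/
def cyc (d : ∀ j, X (j + 1) →ₗ[A] X j) : ∀ j, Submodule A (X j)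
  | 0 => ⊤
  | j + 1 => LinearMap.ker (d j)

/-- boundaries -/
abbrev bdr (d : ∀ j, X (j + 1) →ₗ[A] X j) (j : ℕ) : Submodule A (X j) := LinearMap.range (d j)

/-- length of homology -/
noncomputable def hl (d : ∀ j, X (j + 1) →ₗ[A] X j) (j : ℕ) : ℕ∞ := slen (bdr d j) (cyc d j)

lemma bdr_le_cyc (d : ∀ j, X (j + 1) →ₗ[A] X j) (dd : ∀ j x, d j (d (j + 1) x) = 0) (j : ℕ) :
    bdr d j ≤ cyc d j := by
  rintro _ ⟨x, rfl⟩
  cases j with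
  | zero => trivial
  | succ j => exact dd j x

lemma hl_le_length (d : ∀ j, X (j + 1) →ₗ[A] X j) (j : ℕ) : hl d j ≤ Module.length A (X j) :=
  slen_le_length _ _

lemma cyc_map {d₁ : ∀ j, X₁ (j + 1) →ₗ[A] X₁ j} {d₂ : ∀ j, X₂ (j + 1) →ₗ[A] X₂ j}
    (f : ∀ j, X₁ j →ₗ[A] X₂ j) (hf : ∀ j x, f j (d₁ j x) = d₂ j (f (j + 1) x)) (j : ℕ)
    {x : X₁ j} (hx : x ∈ cyc d₁ j) : f j x ∈ cyc d₂ j := by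
  cases j with
  | zero => trivial
  | succ j =>
    change d₂ j _ = 0
    rw [← hf, show d₁ j x = 0 from hx, map_zero]

/-- The long exact sequence, in terms of lengths. -/
theorem les {d₁ : ∀ j, X₁ (j + 1) →ₗ[A] X₁ j} {d₂ : ∀ j, X₂ (j + 1) →ₗ[A] X₂ j}
    {d₃ : ∀ j, X₃ (j + 1) →ₗ[A] X₃ j}
    (dd₂ : ∀ j x, d₂ j (d₂ (j + 1) x) = 0)
    (f : ∀ j, X₁ j →ₗ[A] X₂ j) (hf : ∀ j x, f j (d₁ j x) = d₂ j (f (j + 1) x))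
    (g : ∀ j, X₂ j →ₗ[A] X₃ j) (hg : ∀ j x, g j (d₂ j x) = d₃ j (g (j + 1) x))
    (inj : ∀ j, Function.Injective (f j)) (ex : ∀ j, Function.Exact (f j) (g j))
    (surj : ∀ j, Function.Surjective (g j)) :
    ∃ r a b : ℕ → ℕ∞, (∀ j, hl d₁ j = r j + a j) ∧ (∀ j, hl d₂ j = a j + b j) ∧
      hl d₃ 0 = b 0 ∧ (∀ j, hl d₃ (j + 1) = b (j + 1) + r j) ∧
      (∀ j, (∀ x ∈ cyc d₁ j, f j x ∈ bdr d₂ j) → a j = 0) := by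
  have ex0 : ∀ j x, g j (f j x) = 0 := fun j x => (ex j (f j x)).2 ⟨x, rfl⟩
  refine ⟨fun j => slen (bdr d₁ j) ((bdr d₂ j).comap (f j)),
    fun j => slen ((bdr d₂ j).comap (f j)) (cyc d₁ j),
    fun j => slen (bdr d₃ j) ((cyc d₂ j).map (g j)), ?_, ?_, ?_, ?_, ?_⟩
  · intro j
    apply slen_add
    · rintro _ ⟨x, rfl⟩
      exact ⟨f (j + 1) x, (hf j x).symm⟩
    · rintro x hx
      have := bdr_le_cyc d₂ dd₂ j hx
      cases j with
      | zero => trivial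
      | succ j =>
        change d₁ j x = 0
        apply inj
        rw [hf, map_zero]
        exact this
  · intro j
    rw [hl, slen_add _ ((cyc d₁ j).map (f j) ⊔ bdr d₂ j) _ le_sup_right]
    · congr 1
      · symm
        apply slen_map (f j)
        · intro x hx
          exact Submodule.mem_sup_left ⟨x, hx, rfl⟩
        · intro y hy
          obtain ⟨_, ⟨x, hx, rfl⟩, z, hz, rfl⟩ := Submodule.mem_sup.1 hy
          exact ⟨x, hx, by simpa using hz⟩
        · intro x hx
          rfl
      · apply slen_map (g j)
        · intro x hx
          exact ⟨x, hx, rfl⟩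
        · rintro _ ⟨x, hx, rfl⟩
          exact ⟨x, hx, by simp⟩
        · intro x hx
          constructor
          · rintro ⟨y, hy⟩
            obtain ⟨z, rfl⟩ := surj _ y
            rw [← hg, ← sub_eq_zero, ← map_sub] at hy
            obtain ⟨w, hw⟩ := (ex j _).1 hy
            have : x = f j (-w) + d₂ j z := by rw [map_neg, hw]; abel
            rw [this]
            refine Submodule.add_mem_sup ⟨-w, ?_, rfl⟩ ⟨z, rfl⟩
            cases j with
            | zero => trivial
            | succ j =>
              change d₁ j (-w) = 0
              apply inj
              rw [hf, map_zero, map_neg, hw, neg_sub, map_sub, dd₂, sub_zero]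
              exact hx
          · intro hx
            obtain ⟨_, ⟨y, hy, rfl⟩, _, ⟨z, rfl⟩, rfl⟩ := Submodule.mem_sup.1 hx
            rw [map_add, ex0, zero_add, hg]
            exact ⟨_, rfl⟩
    · apply sup_le _ (bdr_le_cyc d₂ dd₂ j)
      rintro _ ⟨x, hx, rfl⟩
      exact cyc_map f hf j hx
  · have : (cyc d₂ 0).map (g 0) = cyc d₃ 0 := by
      change Submodule.map _ ⊤ = ⊤
      rw [Submodule.map_top]
      exact LinearMap.range_eq_top.2 (surj 0)
    simp only [this]
    rfl
  · intro j
    rw [hl, slen_add _ ((cyc d₂ (j + 1)).map (g (j + 1)))]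
    · congr 1
      trans slen (cyc d₂ (j + 1) ⊔ LinearMap.range (f (j + 1)))
        (((cyc d₃ (j + 1)).comap (g (j + 1))))
      · symm
        apply slen_map (g (j + 1))
        · intro x hx
          exact hx
        · intro y hy
          obtain ⟨x, rfl⟩ := surj _ y
          exact ⟨x, hy, by simp⟩
        · intro x hx
          constructor
          · rintro ⟨z, hz, hzx⟩
            rw [eq_comm, ← sub_eq_zero, ← map_sub] at hzx
            obtain ⟨w, hw⟩ := (ex _ _).1 hzx
            have : x = z + f _ w := by rw [hw]; abel
            rw [this]
            exact Submodule.add_mem_sup hz ⟨w, rfl⟩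
          · intro hx
            obtain ⟨y, hy, _, ⟨z, rfl⟩, rfl⟩ := Submodule.mem_sup.1 hx
            rw [map_add, ex0, add_zero]
            exact ⟨y, hy, rfl⟩
      · trans slen ((bdr d₁ j).map (f j)) (bdr d₂ j ⊓ LinearMap.range (f j))
        · apply slen_map (d₂ j)
          · intro x hx
            refine ⟨⟨x, rfl⟩, ?_⟩
            apply (ex j _).1
            rw [hg]
            exact hx
          · rintro _ ⟨⟨x, rfl⟩, h⟩
            refine ⟨x, ?_, by simp⟩
            change d₃ j _ = 0
            rw [← hg]
            exact (ex j _).2 h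
          · intro x hx
            constructor
            · rintro ⟨_, ⟨y, rfl⟩, h⟩
              rw [hf, eq_comm, ← sub_eq_zero, ← map_sub] at h
              have : x = (x - f (j + 1) y) + f (j + 1) y := by abel
              rw [this]
              exact Submodule.add_mem_sup h ⟨y, rfl⟩
            · intro hx
              obtain ⟨y, hy, _, ⟨z, rfl⟩, rfl⟩ := Submodule.mem_sup.1 hx
              rw [map_add, show d₂ j y = 0 from hy, zero_add, ← hf]
              exact ⟨_, ⟨z, rfl⟩, rfl⟩
        · symm
          apply slen_map (f j)
          · intro x hx
            exact ⟨hx, x, rfl⟩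
          · rintro _ ⟨h, x, rfl⟩
            exact ⟨x, h, by simp⟩
          · intro x hx
            constructor
            · rintro ⟨y, hy, h⟩
              rwa [← inj _ h]
            · intro h
              exact ⟨x, h, rfl⟩
    · rintro _ ⟨x, rfl⟩
      obtain ⟨y, rfl⟩ := surj _ x
      rw [← hg]
      exact ⟨_, dd₂ _ _, rfl⟩
    · rintro _ ⟨x, hx, rfl⟩
      exact cyc_map g hg _ hx
  · intro j hj
    exact slen_eq_zero _ _ hj

/-- homology lengths are invariant under isomorphism -/
lemma hl_congr {d₁ : ∀ j, X₁ (j + 1) →ₗ[A] X₁ j} {d₂ : ∀ j, X₂ (j + 1) →ₗ[A] X₂ j}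
    (f : ∀ j, X₁ j ≃ₗ[A] X₂ j) (hf : ∀ j x, f j (d₁ j x) = d₂ j (f (j + 1) x)) (j : ℕ) :
    hl d₁ j = hl d₂ j := by
  apply slen_map (f j).toLinearMap
  · intro x hx
    exact cyc_map (fun j => (f j).toLinearMap) hf j hx
  · intro y hy
    refine ⟨(f j).symm y, ?_, by simp⟩
    refine cyc_map (fun j => (f j).symm.toLinearMap) (d₁ := d₂) (d₂ := d₁) ?_ j hy
    intro j x
    apply (f j).injective
    rw [hf]
    simp
  · intro x hx
    constructor
    · rintro ⟨y, hy⟩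
      refine ⟨(f (j + 1)).symm y, ?_⟩
      apply (f j).injective
      rw [hf]
      simpa using hy
    · rintro ⟨y, rfl⟩
      exact ⟨f (j + 1) y, (hf j y).symm⟩

end Cx

end NIT

end

section
namespace NIT

section Mact
variable {A : Type*} [CommRing A] {N N₁ N₂ N₃ : Type*} [AddCommGroup N] [Module A N]
  [AddCommGroup N₁] [Module A N₁] [AddCommGroup N₂] [Module A N₂] [AddCommGroup N₃] [Module A N₃]
  {ι κ μ : Type*} [Fintype ι] [Fintype κ] [Fintype μ]

/-- A matrix over `A` acting on column vectors with entries in a module. -/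
def mact (N : Type*) [AddCommGroup N] [Module A N] (D : Matrix ι κ A) : (κ → N) →ₗ[A] (ι → N) where
  toFun v a := ∑ b, D a b • v b
  map_add' v w := by
    ext a; simp [smul_add, Finset.sum_add_distrib]
  map_smul' r v := by
    ext a; simp [Finset.smul_sum, smul_comm r]

lemma mact_apply (D : Matrix ι κ A) (v : κ → N) (a : ι) : mact N D v a = ∑ b, D a b • v b := rfl

lemma mact_mul (D : Matrix ι κ A) (E : Matrix κ μ A) (v : μ → N) :
    mact N (D * E) v = mact N D (mact N E v) := by
  ext a
  simp only [mact_apply, Matrix.mul_apply, Finset.sum_smul, Finset.smul_sum, mul_smul]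
  exact Finset.sum_comm

lemma mact_add (D E : Matrix ι κ A) (v : κ → N) : mact N (D + E) v = mact N D v + mact N E v := by
  ext a
  simp only [mact_apply, Matrix.add_apply, add_smul, Finset.sum_add_distrib, Pi.add_apply]

lemma mact_sub (D E : Matrix ι κ A) (v : κ → N) : mact N (D - E) v = mact N D v - mact N E v := by
  ext a
  simp only [mact_apply, Matrix.sub_apply, sub_smul, Finset.sum_sub_distrib, Pi.sub_apply]

lemma mact_zero (v : κ → N) : mact N (0 : Matrix ι κ A) v = 0 := by
  ext a; simp [mact_apply]

lemma mact_smul (r : A) (D : Matrix ι κ A) (v : κ → N) : mact N (r • D) v = r • mact N D v := by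
  ext a
  simp only [mact_apply, Matrix.smul_apply, smul_eq_mul, mul_smul, Pi.smul_apply, Finset.smul_sum]

lemma mact_sum {β : Type*} (s : Finset β) (D : β → Matrix ι κ A) (v : κ → N) :
    mact N (∑ b ∈ s, D b) v = ∑ b ∈ s, mact N (D b) v := by
  classical
  induction s using Finset.induction_on with
  | empty => simp [mact_zero]
  | insert a s ha ih => rw [Finset.sum_insert ha, Finset.sum_insert ha, mact_add, ih]

lemma mact_one [DecidableEq ι] (v : ι → N) : mact N (1 : Matrix ι ι A) v = v := by
  ext a; simp [mact_apply, Matrix.one_apply]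

lemma mact_compLeft (D : Matrix ι κ A) (f : N₁ →ₗ[A] N₂) (v : κ → N₁) :
    f.compLeft ι (mact N₁ D v) = mact N₂ D (f.compLeft κ v) := by
  ext a; simp [mact_apply]

end Mact

section MLes
variable {A : Type*} [CommRing A] {N N₁ N₂ N₃ : Type*} [AddCommGroup N] [Module A N]
  [AddCommGroup N₁] [Module A N₁] [AddCommGroup N₂] [Module A N₂] [AddCommGroup N₃] [Module A N₃]
  {ι : ℕ → Type*} [∀ j, Fintype (ι j)]

/-- the complex with coefficients in `N` -/
abbrev mcx (D : ∀ j, Matrix (ι j) (ι (j + 1)) A) (N : Type*) [AddCommGroup N]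
    [Module A N] (j : ℕ) : (fun j => ι j → N) (j + 1) →ₗ[A] (fun j => ι j → N) j := mact N (D j)

/-- homology length of a matrix complex with coefficients in `N` -/
noncomputable abbrev mhl (D : ∀ j, Matrix (ι j) (ι (j + 1)) A) (N : Type*) [AddCommGroup N]
    [Module A N] (j : ℕ) : ℕ∞ := hl (X := fun j => ι j → N) (mcx D N) j

lemma mdd {D : ∀ j, Matrix (ι j) (ι (j + 1)) A} (DD : ∀ j, D j * D (j + 1) = 0) (j : ℕ)
    (v : ι (j + 1 + 1) → N) : mact N (D j) (mact N (D (j + 1)) v) = 0 := by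
  rw [← mact_mul, DD, mact_zero]

theorem mles {D : ∀ j, Matrix (ι j) (ι (j + 1)) A} (DD : ∀ j, D j * D (j + 1) = 0)
    (f : N₁ →ₗ[A] N₂) (g : N₂ →ₗ[A] N₃) (inj : Function.Injective f) (ex : Function.Exact f g)
    (surj : Function.Surjective g) :
    ∃ r a b : ℕ → ℕ∞, (∀ j, mhl D N₁ j = r j + a j) ∧ (∀ j, mhl D N₂ j = a j + b j) ∧
      mhl D N₃ 0 = b 0 ∧ (∀ j, mhl D N₃ (j + 1) = b (j + 1) + r j) ∧
      (∀ j, (∀ x ∈ cyc (X := fun j => ι j → N₁) (mcx D N₁) j,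
        f.compLeft (ι j) x ∈ bdr (X := fun j => ι j → N₂) (mcx D N₂) j) → a j = 0) := by
  refine les (X₁ := fun j => ι j → N₁) (X₂ := fun j => ι j → N₂) (X₃ := fun j => ι j → N₃)
    (d₁ := mcx D N₁) (d₂ := mcx D N₂) (d₃ := mcx D N₃) (fun j x => mdd DD j x) (fun j => f.compLeft (ι j)) (fun j x => mact_compLeft _ _ _)
    (fun j => g.compLeft (ι j)) (fun j x => mact_compLeft _ _ _) ?_ ?_ ?_
  · intro j v w h
    ext a
    exact inj (congrFun h a)
  · intro j v
    constructor
    · intro h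
      have : ∀ a, ∃ y, f y = v a := fun a => (ex _).1 (congrFun h a)
      choose y hy using this
      exact ⟨y, funext hy⟩
    · rintro ⟨y, rfl⟩
      ext a
      exact (ex _).2 ⟨y a, rfl⟩
  · intro j v
    choose y hy using fun a => surj (v a)
    exact ⟨y, funext hy⟩

lemma mhl_le_add {D : ∀ j, Matrix (ι j) (ι (j + 1)) A} (DD : ∀ j, D j * D (j + 1) = 0)
    (f : N₁ →ₗ[A] N₂) (g : N₂ →ₗ[A] N₃) (inj : Function.Injective f) (ex : Function.Exact f g)
    (surj : Function.Surjective g) (j : ℕ) : mhl D N₂ j ≤ mhl D N₁ j + mhl D N₃ j := by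
  obtain ⟨r, a, b, h1, h2, h3, h4, -⟩ := mles DD f g inj ex surj
  rw [h1, h2]
  refine add_le_add le_add_self ?_
  cases j with
  | zero => exact h3.ge
  | succ j => rw [h4]; exact le_self_add

lemma mhl_congr (D : ∀ j, Matrix (ι j) (ι (j + 1)) A) (f : N₁ ≃ₗ[A] N₂) (j : ℕ) :
    mhl D N₁ j = mhl D N₂ j := by
  refine hl_congr (X₁ := fun j => ι j → N₁) (X₂ := fun j => ι j → N₂) (fun j => LinearEquiv.piCongrRight fun _ : ι j => f) ?_ j
  intro j x
  ext a
  simp [mact_apply]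

/-- scalar matrices -/
noncomputable def scal (κ : Type*) (x : A) : Matrix κ κ A :=
  @Matrix.diagonal _ _ (Classical.decEq _) _ (fun _ => x)

lemma scal_eq (κ : Type*) [DecidableEq κ] (x : A) : scal κ x = Matrix.diagonal (fun _ => x) := by
  unfold scal
  congr!

lemma scal_eq_smul (κ : Type*) [DecidableEq κ] (x : A) :
    scal κ x = x • (1 : Matrix κ κ A) := by
  rw [scal_eq, Matrix.smul_one_eq_diagonal]

lemma mact_scal {κ : Type*} [Fintype κ] (x : A) (v : κ → N) :
    mact N (scal κ x) v = x • v := by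
  classical
  rw [scal_eq_smul, mact_smul, mact_one]

lemma scal_map {B κ : Type*} [CommRing B] (f : A →+* B) (x : A) :
    (scal κ x).map f = scal κ (f x) := by
  classical
  rw [scal_eq, scal_eq, Matrix.diagonal_map (map_zero f)]

/-- A null homotopy of multiplication by `x`. -/
def Kills (D : ∀ j, Matrix (ι j) (ι (j + 1)) A) (x : A) : Prop :=
  ∃ s : ∀ j, Matrix (ι (j + 1)) (ι j) A,
    D 0 * s 0 = scal _ x ∧ ∀ j, s j * D j + D (j + 1) * s (j + 1) = scal _ x

lemma Kills.map {B : Type*} [CommRing B] (f : A →+* B) {D : ∀ j, Matrix (ι j) (ι (j + 1)) A} {x : A}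
    (h : Kills D x) : Kills (fun j => (D j).map f) (f x) := by
  obtain ⟨s, h0, hs⟩ := h
  refine ⟨fun j => (s j).map f, ?_, ?_⟩
  · rw [← Matrix.map_mul, h0, scal_map]
  · intro j
    rw [← Matrix.map_mul, ← Matrix.map_mul, ← Matrix.map_add f (map_add f), hs, scal_map]

lemma Kills.smul_mem {D : ∀ j, Matrix (ι j) (ι (j + 1)) A} {x : A} (h : Kills D x) (j : ℕ)
    (v : ι j → N) (hv : v ∈ cyc (X := fun j => ι j → N) (mcx D N) j) :
    x • v ∈ bdr (X := fun j => ι j → N) (mcx D N) j := by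
  obtain ⟨s, h0, hs⟩ := h
  cases j with
  | zero =>
    refine ⟨mact N (s 0) v, ?_⟩
    change mact N (D 0) _ = _
    rw [← mact_mul, h0, mact_scal]
  | succ j =>
    refine ⟨mact N (s (j + 1)) v, ?_⟩
    have h1 := mact_scal x v
    rw [← hs j, mact_add, mact_mul,
      mact_mul, show mact N (D j) v = 0 from hv, map_zero, zero_add] at h1
    exact h1

end MLes
end NIT

end

section
namespace NIT


section Asym
variable {A : Type u} [CommRing A]
  {ι : ℕ → Type*} [∀ j, Fintype (ι j)]

lemma mhl_pow_le {D : ∀ j, Matrix (ι j) (ι (j + 1)) A} (DD : ∀ j, D j * D (j + 1) = 0)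
    (N : Type u) [AddCommGroup N] [Module A N] (x : A)
    (hx : Function.Injective (fun y : N => x • y)) (i k : ℕ) :
    mhl D (N ⧸ LinearMap.range (LinearMap.lsmul A N (x ^ k))) i ≤
      k * mhl D (N ⧸ LinearMap.range (LinearMap.lsmul A N x)) i := by
  induction k with
  | zero =>
    simp only [Nat.cast_zero, zero_mul, nonpos_iff_eq_zero]
    apply slen_eq_zero
    have hs : Subsingleton (N ⧸ LinearMap.range (LinearMap.lsmul A N (x ^ 0))) := by
      rw [Submodule.Quotient.subsingleton_iff, LinearMap.range_eq_top]
      intro y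
      exact ⟨y, by simp⟩
    intro v _
    have : v = 0 := Subsingleton.elim _ _
    rw [this]
    exact zero_mem _
  | succ k ih =>
    have hf : LinearMap.range (LinearMap.lsmul A N (x ^ k)) ≤
        (LinearMap.range (LinearMap.lsmul A N (x ^ (k + 1)))).comap (LinearMap.lsmul A N x) := by
      rintro _ ⟨y, rfl⟩
      exact ⟨y, by simp only [LinearMap.lsmul_apply, pow_succ', mul_smul]⟩
    have hg : LinearMap.range (LinearMap.lsmul A N (x ^ (k + 1))) ≤
        (LinearMap.range (LinearMap.lsmul A N x)).comap LinearMap.id := by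
      rintro _ ⟨y, rfl⟩
      exact ⟨x ^ k • y, by simp only [LinearMap.lsmul_apply, pow_succ', mul_smul, LinearMap.id_apply]⟩
    have := mhl_le_add DD (Submodule.mapQ _ _ _ hf) (Submodule.mapQ _ _ _ hg) ?_ ?_ ?_ i
    · refine this.trans ?_
      rw [Nat.cast_add, add_mul, Nat.cast_one, one_mul]
      exact add_le_add_left ih _
    · rw [← LinearMap.ker_eq_bot, LinearMap.ker_eq_bot']
      intro v hv
      obtain ⟨v, rfl⟩ := Submodule.mkQ_surjective _ v
      have hv' : x • v ∈ LinearMap.range (LinearMap.lsmul A N (x ^ (k + 1))) :=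
        (Submodule.Quotient.mk_eq_zero _).1 hv
      obtain ⟨w, hw⟩ := hv'
      refine (Submodule.Quotient.mk_eq_zero _).2 ⟨w, hx ?_⟩
      simp only [LinearMap.lsmul_apply, pow_succ', mul_smul] at hw ⊢
      exact hw
    · intro v
      obtain ⟨v, rfl⟩ := Submodule.mkQ_surjective _ v
      constructor
      · intro hv
        have hv' : v ∈ LinearMap.range (LinearMap.lsmul A N x) :=
          (Submodule.Quotient.mk_eq_zero _).1 hv
        obtain ⟨w, rfl⟩ := hv'
        exact ⟨Submodule.Quotient.mk w, rfl⟩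
      · rintro ⟨w, hw⟩
        obtain ⟨w, rfl⟩ := Submodule.mkQ_surjective _ w
        rw [← hw]
        exact (Submodule.Quotient.mk_eq_zero _).2 ⟨w, rfl⟩
    · intro v
      obtain ⟨v, rfl⟩ := Submodule.mkQ_surjective _ v
      exact ⟨Submodule.Quotient.mk v, rfl⟩

variable [IsNoetherianRing A] {E : Type*} (q : E → ℕ) (hq : ∀ e, 1 ≤ q e)
  (D : E → ∀ j, Matrix (ι j) (ι (j + 1)) A) (DD : ∀ e j, D e j * D e (j + 1) = 0)
  (n : ℕ)

/-- the claim of the asymptotic lemma, for one module -/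
def Bdd (d i : ℕ) (N : Type u) [AddCommGroup N] [Module A N] : Prop :=
  ∃ C : ℕ, ∀ e, mhl (D e) N i * (if n < i + d then q e else 1 : ℕ) ≤ (C * q e ^ d : ℕ)

include DD in
lemma Bdd.ext {d i : ℕ} {N₁ N₂ N₃ : Type u} [AddCommGroup N₁] [Module A N₁]
    [AddCommGroup N₂] [Module A N₂] [AddCommGroup N₃] [Module A N₃]
    (f : N₁ →ₗ[A] N₂) (g : N₂ →ₗ[A] N₃) (inj : Function.Injective f) (ex : Function.Exact f g)
    (surj : Function.Surjective g) (h1 : Bdd q D n d i N₁) (h3 : Bdd q D n d i N₃) :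
    Bdd q D n d i N₂ := by
  obtain ⟨C₁, h1⟩ := h1
  obtain ⟨C₃, h3⟩ := h3
  refine ⟨C₁ + C₃, fun e => ?_⟩
  rw [add_mul, Nat.cast_add]
  refine le_trans ?_ (add_le_add (h1 e) (h3 e))
  rw [← add_mul]
  gcongr
  exact mhl_le_add (DD e) f g inj ex surj i

include hq in
lemma Bdd.mono {d i : ℕ} {N : Type u} [AddCommGroup N] [Module A N]
    (h : Bdd q D n d i N) : Bdd q D n (d + 1) i N := by
  obtain ⟨C, h⟩ := h
  refine ⟨C, fun e => ?_⟩
  rw [pow_succ, ← mul_assoc, Nat.cast_mul (C * q e ^ d)]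
  refine mul_le_mul' (le_trans ?_ (h e)) ?_
  · conv_lhs => rw [← mul_one (mhl _ _ _)]
    gcongr
    have := hq e
    split_ifs <;> simp [this]
  · have := hq e
    split_ifs <;> simp [this]

include DD in
lemma Bdd.of_pow {d i : ℕ} (I : Ideal A) (x : A)
    (H : ∀ (N : Type u) [AddCommGroup N] [Module A N], Module.Finite A N →
      (∀ a ∈ I, ∀ y : N, a • y = 0) → (∀ y : N, x • y = 0) → Bdd q D n d i N) (M : ℕ) :
    ∀ (N : Type u) [AddCommGroup N] [Module A N], Module.Finite A N →
      (∀ a ∈ I, ∀ y : N, a • y = 0) → (∀ y : N, x ^ M • y = 0) → Bdd q D n d i N := by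
  induction M with
  | zero =>
    intro N _ _ _ hI h
    refine H N ‹_› hI fun y => ?_
    have := h y
    rw [pow_zero, one_smul] at this
    rw [this, smul_zero]
  | succ M ih =>
    intro N _ _ _ hI h
    refine Bdd.ext q D DD n (LinearMap.range (LinearMap.lsmul A N x)).subtype
      (LinearMap.range (LinearMap.lsmul A N x)).mkQ (Submodule.injective_subtype _) ?_
      (Submodule.mkQ_surjective _) ?_ ?_
    · rw [LinearMap.exact_iff]
      simp
    · refine ih _ inferInstance ?_ ?_
      · rintro a ha ⟨y, hy⟩
        ext
        exact hI a ha y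
      · rintro ⟨_, ⟨y, rfl⟩⟩
        ext
        have := h y
        rwa [pow_succ, mul_smul] at this
    · refine H _ inferInstance ?_ ?_
      · intro a ha y
        obtain ⟨y, rfl⟩ := Submodule.mkQ_surjective _ y
        rw [← map_smul, hI a ha, map_zero]
      · intro y
        obtain ⟨y, rfl⟩ := Submodule.mkQ_surjective _ y
        exact (Submodule.Quotient.mk_eq_zero _).2 ⟨y, rfl⟩

include hq DD in
/-- The asymptotic lemma. -/
theorem asym (hvan : ∀ e i, n < i → ∀ (N : Type u) [AddCommGroup N] [Module A N],
      mhl (D e) N i = 0) (xs : List A) :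
    (∀ x ∈ xs, ∃ t : ℕ, ∀ e, Kills (D e) (x ^ (t * q e))) →
    ∀ I : Ideal A, IsFiniteLength A (A ⧸ (I ⊔ Ideal.ofList xs)) →
    ∀ (i : ℕ) (N : Type u) [AddCommGroup N] [Module A N], Module.Finite A N →
      (∀ a ∈ I, ∀ y : N, a • y = 0) → Bdd q D n xs.length i N := by
  induction xs with
  | nil =>
    intro _ I hI i N _ _ _ hN
    have hfl : IsFiniteLength A N := by
      obtain ⟨k, f, hf⟩ := Module.Finite.exists_fin' A N
      have h0 : ∀ a ∈ I ⊔ Ideal.ofList ([] : List A), ∀ y : N, a • y = 0 := by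
        simpa using hN
      let g : ∀ i : Fin k, (A ⧸ (I ⊔ Ideal.ofList ([] : List A))) →ₗ[A] N := fun i =>
        Submodule.liftQ _ (LinearMap.toSpanSingleton A N (f (Pi.single i 1)))
          (fun a ha => h0 a ha _)
      rw [← Module.length_ne_top_iff] at hI ⊢
      have hs : Function.Surjective (LinearMap.lsum A (fun _ => A ⧸ (I ⊔ Ideal.ofList ([] : List A))) A g) := by
        intro y
        obtain ⟨v, rfl⟩ := hf y
        refine ⟨fun i => Ideal.Quotient.mk _ (v i), ?_⟩
        conv_rhs => rw [← LinearMap.sum_single_apply (fun _ => A) v, map_sum]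
        rw [LinearMap.lsum_apply, LinearMap.sum_apply]
        refine Finset.sum_congr rfl fun i _ => ?_
        have : (Pi.single i (v i) : Fin k → A) = v i • Pi.single i 1 := by
          rw [← Pi.single_smul]
          simp
        rw [this, map_smul]
        rfl
      refine ne_top_of_le_ne_top ?_ (Module.length_le_of_surjective _ hs)
      rw [Module.length_pi]
      exact WithTop.mul_ne_top (by rw [ENat.card_eq_coe_fintype_card]; exact ENat.natCast_ne_top _) hI
    rw [← Module.length_ne_top_iff] at hfl
    obtain ⟨l, hl'⟩ := ENat.ne_top_iff_exists.1 hfl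
    refine ⟨Fintype.card (ι i) * l, fun e => ?_⟩
    split_ifs with h
    · rw [hvan e i (by simpa using h)]
      simp
    · refine le_trans (le_of_eq (mul_one _)) (le_trans (hl_le_length _ _) ?_)
      rw [Module.length_pi, ← hl']
      simp
  | cons x xs ih =>
    intro hx I hI i N _ _ _ hN
    obtain ⟨t, ht⟩ := hx x (by simp)
    have hofl : I ⊔ Ideal.ofList (x :: xs) = (I ⊔ Ideal.span {x}) ⊔ Ideal.ofList xs := by
      rw [Ideal.ofList_cons, sup_assoc]
    rw [hofl] at hI
    have hkey : ∀ i (N : Type u) [AddCommGroup N] [Module A N], Module.Finite A N →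
        (∀ a ∈ I, ∀ y : N, a • y = 0) → (∀ y : N, x • y = 0) → Bdd q D n xs.length i N := by
      intro i N _ _ _ h1 h2
      refine ih (fun y hy => hx y (by simp [hy])) _ hI i N ‹_› ?_
      intro a ha y
      obtain ⟨b, hb, c, hc, rfl⟩ := Submodule.mem_sup.1 ha
      obtain ⟨c, rfl⟩ := Ideal.mem_span_singleton'.1 hc
      rw [add_smul, h1 b hb, mul_smul, h2, smul_zero, add_zero]
    -- the torsion
    let f : N →ₗ[A] N := LinearMap.lsmul A N x
    have hfpow : ∀ k y, (f ^ k) y = x ^ k • y := by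
      intro k
      induction k with
      | zero => simp
      | succ k ih => intro y; rw [pow_succ', Module.End.mul_apply, ih, pow_succ', mul_smul]; rfl
    have : IsNoetherian A N := isNoetherian_of_isNoetherianRing_of_finite A N
    obtain ⟨M, hM⟩ := monotone_stabilizes_iff_noetherian.2 this
      ⟨fun k => LinearMap.ker (f ^ k), fun a b hab => by
        intro y hy
        obtain ⟨c, rfl⟩ := Nat.exists_eq_add_of_le hab
        rw [LinearMap.mem_ker] at hy ⊢
        rw [add_comm, pow_add, Module.End.mul_apply, hy, map_zero]⟩
    let N' := LinearMap.ker (f ^ M)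
    refine Bdd.ext q D DD n N'.subtype N'.mkQ (Submodule.injective_subtype _) ?_
      (Submodule.mkQ_surjective _) ?_ ?_
    · rw [LinearMap.exact_iff]
      simp
    · refine Bdd.mono q hq D n ?_
      refine Bdd.of_pow q D DD n I x (hkey i) M N' inferInstance ?_ ?_
      · rintro a ha ⟨y, hy⟩
        ext
        exact hN a ha y
      · rintro ⟨y, hy⟩
        ext
        exact (hfpow M y).symm.trans hy
    · have hreg : Function.Injective (fun y : N ⧸ N' => x • y) := by
        have : Function.Injective (LinearMap.lsmul A (N ⧸ N') x) := by
          rw [← LinearMap.ker_eq_bot, LinearMap.ker_eq_bot']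
          intro y hy
          obtain ⟨y, rfl⟩ := Submodule.mkQ_surjective _ y
          have h1 : x • y ∈ N' := (Submodule.Quotient.mk_eq_zero _).1 hy
          refine (Submodule.Quotient.mk_eq_zero _).2 ?_
          have h2 := hM (M + 1) (by omega)
          change LinearMap.ker (f ^ M) = LinearMap.ker (f ^ (M + 1)) at h2
          change y ∈ LinearMap.ker (f ^ M)
          rw [h2, LinearMap.mem_ker, pow_succ]
          exact h1
        exact this
      have hreg' : ∀ k, Function.Injective (LinearMap.lsmul A (N ⧸ N') (x ^ k)) := by
        intro k
        induction k with
        | zero => intro a b h; simpa using h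
        | succ k ih =>
          intro a b h
          refine ih (hreg ?_)
          simp only [LinearMap.lsmul_apply, pow_succ', mul_smul] at h
          exact h
      have h0 : Bdd q D n xs.length (i + 1)
          ((N ⧸ N') ⧸ LinearMap.range (LinearMap.lsmul A (N ⧸ N') x)) := by
        refine hkey (i + 1) _ inferInstance ?_ ?_
        · intro a ha y
          obtain ⟨y, rfl⟩ := Submodule.mkQ_surjective _ y
          obtain ⟨y, rfl⟩ := Submodule.mkQ_surjective _ y
          rw [← map_smul, ← map_smul, hN a ha, map_zero, map_zero]
        · intro y
          obtain ⟨y, rfl⟩ := Submodule.mkQ_surjective _ y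
          exact (Submodule.Quotient.mk_eq_zero _).2 ⟨y, rfl⟩
      obtain ⟨C, hC⟩ := h0
      refine ⟨t * C, fun e => ?_⟩
      have h1 : mhl (D e) (N ⧸ N') i ≤ mhl (D e)
          ((N ⧸ N') ⧸ LinearMap.range (LinearMap.lsmul A (N ⧸ N') (x ^ (t * q e)))) (i + 1) := by
        obtain ⟨r, a, b, h1, h2, h3, h4, h5⟩ := mles (DD e)
          (LinearMap.lsmul A (N ⧸ N') (x ^ (t * q e)))
          (LinearMap.range (LinearMap.lsmul A (N ⧸ N') (x ^ (t * q e)))).mkQ (hreg' _)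
          (by rw [LinearMap.exact_iff]; simp) (Submodule.mkQ_surjective _)
        rw [h1, h4, h5 i, add_zero]
        · exact le_add_self
        · intro v hv
          exact (ht e).smul_mem i v hv
      have h2 := mhl_pow_le (DD e) (N ⧸ N') x hreg (i + 1) (t * q e)
      have h3 := hC e
      have h4 : (if n < i + (x :: xs).length then q e else 1) =
        if n < i + 1 + xs.length then q e else 1 := by
        rw [List.length_cons, add_right_comm, add_assoc]
      rw [h4]
      calc _ ≤ (((t * q e : ℕ) : ℕ∞) * mhl (D e) ((N ⧸ N') ⧸ LinearMap.range
              (LinearMap.lsmul A (N ⧸ N') x)) (i + 1)) *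
              (if n < i + 1 + xs.length then q e else 1 : ℕ) := by
            gcongr
            exact h1.trans h2
        _ ≤ ((t * q e : ℕ) : ℕ∞) * (C * q e ^ xs.length : ℕ) := by
            rw [mul_assoc]
            gcongr
        _ = _ := by
            rw [← Nat.cast_mul]
            congr 1
            rw [List.length_cons]
            ring

end Asym
end NIT

end

section
namespace NIT
open IsLocalRing

section
variable {A : Type*} [CommRing A] {M M' : Type*} [AddCommGroup M] [Module A M]
  [AddCommGroup M'] [Module A M']

lemma slen_le_map (f : M →ₗ[A] M') (P Q : Submodule A M) (P' Q' : Submodule A M')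
    (h1 : ∀ x ∈ Q, f x ∈ Q') (h3 : ∀ x ∈ Q, f x ∈ P' → x ∈ P) : slen P Q ≤ slen P' Q' := by
  unfold slen
  let g : Q →ₗ[A] (Q' ⧸ P'.submoduleOf Q') :=
    (P'.submoduleOf Q').mkQ ∘ₗ (f.restrict h1)
  have hk : LinearMap.ker g ≤ P.submoduleOf Q := by
    rintro ⟨x, hx⟩ h
    exact h3 x hx ((Submodule.Quotient.mk_eq_zero (P'.submoduleOf Q')
      (x := (⟨f x, h1 x hx⟩ : Q'))).1 h)
  have h4 : Module.length A (Q ⧸ P.submoduleOf Q) ≤ Module.length A (Q ⧸ LinearMap.ker g) :=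
    Module.length_le_of_surjective (Submodule.factor hk) (Submodule.factor_surjective hk)
  refine h4.trans ?_
  rw [g.quotKerEquivRange.length_eq]
  exact Module.length_le_of_injective _ (Submodule.injective_subtype _)

lemma slen_anti {P P' : Submodule A M} (Q : Submodule A M) (h : P ≤ P') :
    slen P' Q ≤ slen P Q :=
  slen_le_map LinearMap.id _ _ _ _ (fun x hx => hx) (fun x _ hx => h hx)

lemma slen_top (P : Submodule A M) : slen P ⊤ = Module.length A (M ⧸ P) := by
  unfold slen
  have h : P.submoduleOf ⊤ ≤ P.comap (Submodule.subtype ⊤) := fun x hx => hx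
  refine (LinearEquiv.ofBijective (Submodule.mapQ _ _ _ h) ⟨?_, ?_⟩).length_eq
  · rw [← LinearMap.ker_eq_bot, LinearMap.ker_eq_bot']
    intro x hx
    obtain ⟨x, rfl⟩ := Submodule.mkQ_surjective _ x
    exact (Submodule.Quotient.mk_eq_zero _).2 ((Submodule.Quotient.mk_eq_zero (p := P)).1 hx)
  · intro x
    obtain ⟨x, rfl⟩ := Submodule.mkQ_surjective _ x
    exact ⟨Submodule.Quotient.mk ⟨x, trivial⟩, rfl⟩

end

section
variable {A : Type*} [CommRing A]

lemma wb_le_of_forall {r : WithBot ℕ∞} {D : ℕ} (h : ∀ n : ℕ, (n : WithBot ℕ∞) ≤ r → n ≤ D) :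
    r ≤ D := by
  induction r with
  | bot => exact bot_le
  | coe r =>
    induction r using ENat.recTopCoe with
    | top =>
      have := h (D + 1) (by exact_mod_cast le_top)
      omega
    | coe r => exact_mod_cast h r (by exact_mod_cast le_rfl)

lemma exists_prime_dim (I : Ideal A) (n : ℕ) (h : (n : WithBot ℕ∞) ≤ ringKrullDim (A ⧸ I)) :
    ∃ P : Ideal A, P.IsPrime ∧ I ≤ P ∧ (n : WithBot ℕ∞) ≤ ringKrullDim (A ⧸ P) := by
  rw [ringKrullDim_quotient, Order.le_krullDim_iff] at h
  obtain ⟨l, rfl⟩ := h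
  refine ⟨l.head.1.asIdeal, l.head.1.isPrime, l.head.2, ?_⟩
  rw [ringKrullDim_quotient, Order.le_krullDim_iff]
  refine ⟨⟨l.length, fun i => ⟨(l i).1, ?_⟩, fun i => l.step i⟩, rfl⟩
  have : l.head ≤ l i := l.head_le i
  exact this

variable [IsNoetherianRing A] [IsLocalRing A]

lemma dim_quot_le (I : Ideal A) (hI : I ≠ ⊤) (x : A) (hx : x ∈ maximalIdeal A) (n : ℕ)
    (h : ((n + 1 : ℕ) : WithBot ℕ∞) ≤ ringKrullDim (A ⧸ I)) :
    (n : WithBot ℕ∞) ≤ ringKrullDim (A ⧸ (I ⊔ Ideal.span {x})) := by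
  have : Nontrivial (A ⧸ I) := Ideal.Quotient.nontrivial_iff.2 hI
  have : IsLocalRing (A ⧸ I) := IsLocalRing.of_surjective' _ Ideal.Quotient.mk_surjective
  have h1 := ringKrullDim_le_ringKrullDim_quotient_add_card ({Ideal.Quotient.mk I x} : Finset (A ⧸ I))
    (by
      rw [Finset.coe_singleton, Set.singleton_subset_iff, IsLocalRing.ringJacobson_eq_maximalIdeal]
      have : IsLocalHom (Ideal.Quotient.mk I) := IsLocalHom.of_surjective _ Ideal.Quotient.mk_surjective
      exact map_nonunit (Ideal.Quotient.mk I) x hx)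
  have h2 : ringKrullDim ((A ⧸ I) ⧸ Ideal.span (({Ideal.Quotient.mk I x} : Finset (A ⧸ I)) : Set (A ⧸ I)))
      = ringKrullDim (A ⧸ (I ⊔ Ideal.span {x})) := by
    have : Ideal.span (({Ideal.Quotient.mk I x} : Finset (A ⧸ I)) : Set (A ⧸ I)) =
      Ideal.map (Ideal.Quotient.mk I) (Ideal.span {x}) := by simp [Ideal.map_span]
    rw [this]
    exact ringKrullDim_eq_of_ringEquiv (DoubleQuot.quotQuotEquivQuotSup _ _)
  rw [h2] at h1
  have h3 := h.trans h1
  simp only [Finset.card_singleton, Nat.cast_add, Nat.cast_one] at h3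
  generalize ringKrullDim (A ⧸ (I ⊔ Ideal.span {x})) = r at h3 ⊢
  induction r with
  | bot => 
    rw [WithBot.bot_add, le_bot_iff] at h3
    exact absurd h3 (by exact_mod_cast WithBot.coe_ne_bot)
  | coe r =>
    have h4 : ((n : ℕ∞) + 1 : ℕ∞) ≤ r + 1 := by exact_mod_cast h3
    have h5 : (n : ℕ∞) ≤ r := (ENat.add_le_add_iff_right (by simp)).1 h4
    exact_mod_cast h5

lemma artinRees (P : Ideal A) [P.IsPrime] (x : A) (hx : x ∉ P) (J : Ideal A) :
    ∃ c : ℕ, ∀ n ≥ c, ∀ y, x * y ∈ P ⊔ J ^ n → y ∈ P ⊔ J ^ (n - c) := by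
  obtain ⟨c, hc⟩ := J.exists_pow_inf_eq_pow_smul (M := A ⧸ P)
    (Submodule.span A {Ideal.Quotient.mk P x})
  refine ⟨c, fun n hn y hy => ?_⟩
  have h1 : Ideal.Quotient.mk P (x * y) ∈ J ^ n • (⊤ : Submodule A (A ⧸ P)) ⊓
      Submodule.span A {Ideal.Quotient.mk P x} := by
    constructor
    · obtain ⟨a, ha, b, hb, hab⟩ := Submodule.mem_sup.1 hy
      rw [← hab, map_add, Ideal.Quotient.eq_zero_iff_mem.2 ha, zero_add]
      have : Ideal.Quotient.mk P b = b • (1 : A ⧸ P) := by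
        rw [Algebra.smul_def, mul_one]; rfl
      rw [this]
      exact Submodule.smul_mem_smul hb trivial
    · rw [mul_comm, map_mul]
      exact Submodule.smul_mem _ y (Submodule.mem_span_singleton_self _)
  rw [hc n hn] at h1
  have h2 := Submodule.smul_mono le_rfl inf_le_right h1
  rw [Submodule.mem_smul_span_singleton] at h2
  obtain ⟨z, hz, h⟩ := h2
  have h3 : x * (y - z) ∈ P := by
    rw [← Ideal.Quotient.eq_zero_iff_mem, mul_sub, map_sub, sub_eq_zero, ← h, mul_comm, map_mul]
    rfl
  have h4 := (Ideal.IsPrime.mem_or_mem ‹_› h3).resolve_left hx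
  have : y = (y - z) + z := by ring
  rw [this]
  exact Submodule.add_mem_sup h4 hz

lemma dim_le_aux (D : ℕ) : ∀ (I : Ideal A) (C : ℕ),
    (∀ k : ℕ, 1 ≤ k → slen (I ⊔ maximalIdeal A ^ k) ⊤ ≤ (C * k ^ D : ℕ)) → 
    ∀ n : ℕ, (n : WithBot ℕ∞) ≤ ringKrullDim (A ⧸ I) → n ≤ D := by
  induction D with
  | zero =>
    intro I C h n hn
    simp only [pow_zero, mul_one] at h
    have h1 : ∃ k, 1 ≤ k ∧ I ⊔ maximalIdeal A ^ k ≤ I ⊔ maximalIdeal A ^ (k + 1) := by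
      by_contra! hcon
      have : ∀ k : ℕ, (k : ℕ∞) ≤ slen (I ⊔ maximalIdeal A ^ (k + 1)) ⊤ := by
        intro k
        induction k with
        | zero => simp
        | succ k ih =>
          rw [slen_add _ (I ⊔ maximalIdeal A ^ (k + 1)) _
            (sup_le_sup_left (Ideal.pow_le_pow_right (by omega)) _) le_top]
          rw [Nat.cast_add, add_comm, Nat.cast_one]
          refine add_le_add ?_ ih
          rw [Order.one_le_iff_ne_zero]
          intro h0
          exact hcon (k + 1) (by omega) (le_of_slen_eq_zero _ _ h0)
      have h2 := (this (C + 1)).trans (h (C + 1 + 1) (by omega))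
      have : C + 1 ≤ C := by exact_mod_cast h2
      omega
    obtain ⟨k, hk, hk'⟩ := h1
    have h2 : maximalIdeal A ^ k ≤ I := by
      have h3 : I ⊔ maximalIdeal A ^ k ≤ I ⊔ maximalIdeal A • (maximalIdeal A ^ k) := by
        rwa [smul_eq_mul, ← pow_succ']
      exact Submodule.le_of_le_smul_of_le_jacobson_bot (IsNoetherian.noetherian _) 
        (IsLocalRing.maximalIdeal_le_jacobson _) (le_sup_right.trans h3)
    obtain ⟨P, hP, hIP, hP2⟩ := exists_prime_dim I n hn
    have h4 : P = maximalIdeal A := 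
      le_antisymm (IsLocalRing.le_maximalIdeal hP.ne_top) (hP.le_of_pow_le (h2.trans hIP))
    subst h4
    have : ringKrullDim (A ⧸ maximalIdeal A) = 0 :=
      ringKrullDim_eq_zero_of_isField ((Ideal.Quotient.maximal_ideal_iff_isField_quotient _).1 inferInstance)
    rw [this] at hP2
    exact_mod_cast hP2
  | succ D ih =>
    intro I C h n hn
    obtain ⟨P, hP, hIP, hP2⟩ := exists_prime_dim I n hn
    by_cases hPm : maximalIdeal A ≤ P
    · have h4 : P = maximalIdeal A := le_antisymm (IsLocalRing.le_maximalIdeal hP.ne_top) hPm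
      subst h4
      have : ringKrullDim (A ⧸ maximalIdeal A) = 0 :=
        ringKrullDim_eq_zero_of_isField ((Ideal.Quotient.maximal_ideal_iff_isField_quotient _).1 inferInstance)
      rw [this] at hP2
      have : n ≤ 0 := by exact_mod_cast hP2
      omega
    obtain ⟨x, hxm, hxP⟩ := SetLike.not_le_iff_exists.1 hPm
    cases n with
    | zero => omega
    | succ n =>
    have hf : ∀ k : ℕ, 1 ≤ k → slen (P ⊔ maximalIdeal A ^ k) ⊤ ≤ (C * k ^ (D + 1) : ℕ) :=
      fun k hk => (slen_anti _ (sup_le_sup_right hIP _)).trans (h k hk)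
    obtain ⟨c, hc⟩ := artinRees P x hxP (maximalIdeal A)
    have hcc : ∀ n ≥ c + 1, ∀ y, x * y ∈ P ⊔ maximalIdeal A ^ n → 
        y ∈ P ⊔ maximalIdeal A ^ (n - (c + 1)) := fun n hn y hy =>
      (sup_le_sup_left (Ideal.pow_le_pow_right (show n - (c + 1) ≤ n - c by omega)) P :
        P ⊔ maximalIdeal A ^ (n - c) ≤ P ⊔ maximalIdeal A ^ (n - (c + 1)))
        (hc n (by omega) y hy)
    clear hc
    generalize hc' : c + 1 = c' at hcc
    have hc1 : 1 ≤ c' := by omega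
    set g : ℕ → ℕ∞ := fun k => slen (P ⊔ Ideal.span {x} ⊔ maximalIdeal A ^ k) ⊤ with hg
    set f : ℕ → ℕ∞ := fun k => slen (P ⊔ maximalIdeal A ^ k) ⊤ with hfdef
    have hgf : ∀ n ≥ c', g n + f (n - c') ≤ f n := by
      intro n hn
      simp only [hg, hfdef]
      have : P ⊔ maximalIdeal A ^ n ≤ P ⊔ Ideal.span {x} ⊔ maximalIdeal A ^ n := 
        sup_le_sup_right le_sup_left _
      rw [slen_add _ _ _ this le_top, add_comm]
      gcongr
      refine slen_le_map (LinearMap.lsmul A A x) _ _ _ _ ?_ ?_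
      · intro y _
        refine Submodule.mem_sup_left (Submodule.mem_sup_right ?_)
        exact Ideal.mul_mem_right _ _ (Ideal.mem_span_singleton_self x)
      · intro y _ hy
        exact hcc n hn y hy
    have gmono : Monotone g := fun a b hab => 
      slen_anti _ (sup_le_sup_left (Ideal.pow_le_pow_right hab) _)
    have hsum : ∀ J s : ℕ, (s : ℕ∞) * g (J * c') ≤ f ((J + s) * c') := by
      intro J s
      induction s with
      | zero => simp
      | succ s ih =>
        refine le_trans ?_ (hgf ((J + (s + 1)) * c') (by nlinarith))
        rw [Nat.cast_add, Nat.cast_one, add_mul, one_mul, add_comm]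
        refine add_le_add (gmono (by gcongr; omega)) ?_
        have : (J + (s + 1)) * c' - c' = (J + s) * c' := by
          rw [← add_assoc, add_mul (J + s), one_mul, Nat.add_sub_cancel]
        rw [this]
        exact ih
    have hbound : ∀ k : ℕ, 1 ≤ k → g k ≤ (C * (2 * c') ^ (D + 1) * k ^ D : ℕ) := by
      intro k hk
      have h1 := hsum k k
      have h2 := h1.trans (hf ((k + k) * c') (by nlinarith))
      have h3 : C * ((k + k) * c') ^ (D + 1) = k * (C * (2 * c') ^ (D + 1) * k ^ D) := by ring
      rw [h3, Nat.cast_mul] at h2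
      have h4 : g k ≤ g (k * c') := gmono (by nlinarith)
      refine h4.trans ?_
      exact (ENat.mul_le_mul_left_iff (by simp; omega) (by simp)).1 h2
    have := ih (P ⊔ Ideal.span {x}) _ hbound n (dim_quot_le P hP.ne_top x hxm n hP2)
    omega

/-- Growth of `A / m ^ q` bounds the dimension. -/
theorem dim_le_of_growth (p : ℕ) (hp : 2 ≤ p) (C D : ℕ)
    (h : ∀ e : ℕ, Module.length A (A ⧸ maximalIdeal A ^ (p ^ e)) ≤ (C * (p ^ e) ^ D : ℕ)) :
    ringKrullDim A ≤ D := by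
  have key := dim_le_aux D (⊥ : Ideal A) (C * p ^ D) (by
    intro k hk
    rw [bot_sup_eq]
    have h1 : k ≤ p ^ (Nat.log p k + 1) := (Nat.lt_pow_succ_log_self (by omega) k).le
    refine (slen_anti _ (Ideal.pow_le_pow_right h1)).trans ?_
    rw [slen_top]
    refine (h _).trans ?_
    rw [pow_succ', mul_pow, ← mul_assoc]
    have := Nat.pow_log_le_self p (x := k) (by omega)
    exact_mod_cast Nat.mul_le_mul_left _ (Nat.pow_le_pow_left this D))
  have e := ringKrullDim_eq_of_ringEquiv (RingEquiv.quotientBot A)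
  rw [e] at key
  exact wb_le_of_forall key

end
end NIT

end

section
namespace NIT
open IsLocalRing


section
variable {A : Type u} [CommRing A] [IsNoetherianRing A] [IsLocalRing A]

lemma exists_dim_eq : ∃ d : ℕ, ringKrullDim A = d := by
  have h := ringKrullDim_ne_top (R := A)
  have h' := ringKrullDim_ne_bot (R := A)
  generalize ringKrullDim A = r at h h' 
  induction r with
  | bot => exact absurd rfl h'
  | coe r =>
    induction r using ENat.recTopCoe with
    | top => exact absurd rfl h
    | coe r => exact ⟨r, rfl⟩

lemma exists_sop (d : ℕ) (hd : ringKrullDim A = d) :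
    ∃ xs : List A, xs.length = d ∧ (∀ x ∈ xs, x ∈ maximalIdeal A) ∧
      IsFiniteLength A (A ⧸ ((⊥ : Ideal A) ⊔ Ideal.ofList xs)) := by
  obtain ⟨s, hs, hc⟩ := Ideal.exists_finset_card_eq_height_of_isNoetherianRing (maximalIdeal A)
  refine ⟨s.toList, ?_, ?_, ?_⟩
  · have h1 := IsLocalRing.maximalIdeal_height_eq_ringKrullDim (R := A)
    rw [← hc, hd] at h1
    rw [Finset.length_toList]
    exact_mod_cast h1
  · intro x hx
    exact hs.1.2 (Ideal.subset_span (by simpa using hx))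
  · have h1 : (⊥ : Ideal A) ⊔ Ideal.ofList s.toList = Ideal.span s := by
      rw [bot_sup_eq, Ideal.ofList]
      congr 1
      ext x
      simp
    rw [h1]
    have := IsLocalRing.quotient_artinian_of_mem_minimalPrimes_of_isLocalRing _ hs
    rw [← Module.length_ne_top_iff, Module.length_eq_of_surjective
      (R := A ⧸ Ideal.span (s : Set A)) Ideal.Quotient.mk_surjective, Module.length_ne_top_iff]
    exact (isArtinianRing_iff_isFiniteLength _).1 this

end

section
variable {A : Type u} [CommRing A] (p : ℕ) [Fact p.Prime] [CharP A p]
  {ι : ℕ → Type*} [∀ j, Fintype (ι j)]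

/-- Frobenius twists -/
abbrev frob (D : ∀ j, Matrix (ι j) (ι (j + 1)) A) (e : ℕ) : ∀ j, Matrix (ι j) (ι (j + 1)) A :=
  fun j => (D j).map (iterateFrobenius A p e)

lemma map_dd {B : Type*} [CommRing B] (f : A →+* B) {D : ∀ j, Matrix (ι j) (ι (j + 1)) A}
    (DD : ∀ j, D j * D (j + 1) = 0) (j : ℕ) :
    (D j).map f * (D (j + 1)).map f = 0 := by
  rw [← Matrix.map_mul, DD, Matrix.map_zero _ (map_zero f)]

lemma frob_kills {D : ∀ j, Matrix (ι j) (ι (j + 1)) A} {x : A} {N : ℕ} (h : Kills D (x ^ N))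
    (e : ℕ) : Kills (frob p D e) (x ^ (N * p ^ e)) := by
  have := h.map (iterateFrobenius A p e)
  rwa [iterateFrobenius_def, ← pow_mul] at this

variable [IsLocalRing A]

lemma length_le_frob {D : ∀ j, Matrix (ι j) (ι (j + 1)) A} [Nonempty (ι 0)]
    (hD : ∀ a b, D 0 a b ∈ maximalIdeal A) (e : ℕ) :
    Module.length A (A ⧸ maximalIdeal A ^ (p ^ e)) ≤ mhl (frob p D e) A 0 := by
  obtain ⟨a⟩ := ‹Nonempty (ι 0)›
  rw [← slen_top]
  classical
  refine slen_le_map (LinearMap.single A (fun _ : ι 0 => A) a) _ _ _ _ (fun x _ => trivial) ?_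
  rintro x - ⟨v, hv⟩
  have h1 := congrFun hv a
  simp only [LinearMap.single_apply, Pi.single_eq_same] at h1
  rw [← h1]
  refine Ideal.sum_mem _ fun b _ => Ideal.mul_mem_right _ _ ?_
  simp only [Matrix.map_apply, iterateFrobenius_def]
  exact Ideal.pow_mem_pow (hD a b) _

/-- conclusion of the growth argument -/
lemma dim_of_bound [IsNoetherianRing A] {D : ∀ j, Matrix (ι j) (ι (j + 1)) A} [Nonempty (ι 0)]
    (hD : ∀ a b, D 0 a b ∈ maximalIdeal A) (d C : ℕ)
    (h : ∀ e, mhl (frob p D e) A 0 * (p ^ e : ℕ) ≤ (C * (p ^ e) ^ (d + 1) : ℕ)) : 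
    ringKrullDim A ≤ d := by
  refine dim_le_of_growth p (Nat.Prime.two_le Fact.out) C d fun e => ?_
  refine (length_le_frob p hD e).trans ?_
  have h1 := h e
  rw [pow_succ (p ^ e), ← mul_assoc, Nat.cast_mul _ (p ^ e)] at h1
  have hp : 0 < p ^ e := Nat.pos_of_ne_zero (pow_ne_zero _ (Nat.Prime.ne_zero Fact.out))
  rw [mul_comm, mul_comm _ ((p ^ e : ℕ) : ℕ∞)] at h1
  exact (ENat.mul_le_mul_left_iff (by exact_mod_cast hp.ne') (ENat.natCast_ne_top _)).1 h1

/-- New intersection theorem in characteristic `p`; 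
vanishing hypothesis stated for all twists. -/
theorem nit_charp' [IsNoetherianRing A] {D : ∀ j, Matrix (ι j) (ι (j + 1)) A}
    (DD : ∀ j, D j * D (j + 1) = 0) [Nonempty (ι 0)]
    (hD : ∀ a b, D 0 a b ∈ maximalIdeal A) (n : ℕ)
    (hvan : ∀ e i, n < i → ∀ (N : Type u) [AddCommGroup N] [Module A N],
      mhl (frob p D e) N i = 0)
    (hk : ∀ x ∈ maximalIdeal A, ∃ N : ℕ, Kills D (x ^ N)) : ringKrullDim A ≤ n := by
  obtain ⟨d, hd⟩ := exists_dim_eq (A := A)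
  rw [hd]
  by_contra! hlt
  have hlt : n < d := by exact_mod_cast hlt
  obtain ⟨xs, hxs, hxm, hfl⟩ := exists_sop d hd
  have hb := asym (fun e : ℕ => p ^ e) (fun e => Nat.one_le_pow _ _ (Nat.Prime.pos Fact.out))
    (frob p D) (fun e => map_dd _ DD) n hvan xs
    (fun x hx => (hk x (hxm x hx)).imp fun N hN e => frob_kills p hN e) ⊥ hfl 0 A inferInstance
    (by simp)
  obtain ⟨C, hC⟩ := hb
  obtain ⟨d, rfl⟩ : ∃ d', d = d' + 1 := ⟨d - 1, by omega⟩
  rw [hxs] at hC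
  simp only [zero_add, hlt, if_true] at hC
  have := dim_of_bound p hD d C hC
  rw [hd] at this
  have : d + 1 ≤ d := by exact_mod_cast this
  omega

include p in
/-- New intersection theorem in characteristic `p` -/
theorem nit_charp [IsNoetherianRing A] {D : ∀ j, Matrix (ι j) (ι (j + 1)) A}
    (DD : ∀ j, D j * D (j + 1) = 0) [Nonempty (ι 0)]
    (hD : ∀ a b, D 0 a b ∈ maximalIdeal A) (n : ℕ) (hn : ∀ j, n < j → IsEmpty (ι j))
    (hk : ∀ x ∈ maximalIdeal A, ∃ N : ℕ, Kills D (x ^ N)) : ringKrullDim A ≤ n := by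
  refine nit_charp' p DD hD n ?_ hk
  intro e i hi N _ _
  have := hn i hi
  refine le_antisymm ((hl_le_length _ _).trans ?_) bot_le
  rw [nonpos_iff_eq_zero, Module.length_eq_zero_iff]
  infer_instance

end
end NIT

end

section
namespace NIT
open CategoryTheory Opposite AlgebraicTopology
open scoped Simplicial


/-- simplicial finite free modules, given by matrices -/
structure SM (A : Type u) [CommRing A] where
  /-- bases -/
  ι : ℕ → Type
  /-- finiteness -/
  fin : ∀ k, Fintype (ι k)
  /-- structure maps -/
  map : ∀ {a b : SimplexCategory}, (a ⟶ b) → Matrix (ι a.len) (ι b.len) A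
  map_id : ∀ a : SimplexCategory, map (𝟙 a) = scal _ 1
  map_comp : ∀ {a b c : SimplexCategory} (f : a ⟶ b) (g : b ⟶ c), map (f ≫ g) = map f * map g

attribute [instance] SM.fin

namespace SM
variable {A : Type u} [CommRing A] (W : SM A) (N : Type u) [AddCommGroup N] [Module A N]

/-- associated simplicial module with coefficients -/
noncomputable def sob : SimplicialObject (ModuleCat.{u} A) where
  obj a := ModuleCat.of A (W.ι a.unop.len → N)
  map f := ModuleCat.ofHom (mact N (W.map f.unop))
  map_id a := by
    ext v : 2
    simp [W.map_id, mact_scal]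
  map_comp f g := by
    ext v : 2
    simp [W.map_comp, mact_mul]

/-- faces -/
def d {j : ℕ} (i : Fin (j + 2)) : Matrix (W.ι j) (W.ι (j + 1)) A := W.map (SimplexCategory.δ i)
/-- degeneracies -/
def s {j : ℕ} (i : Fin (j + 1)) : Matrix (W.ι (j + 1)) (W.ι j) A := W.map (SimplexCategory.σ i)

/-- differential -/
def D (j : ℕ) : Matrix (W.ι j) (W.ι (j + 1)) A := ∑ i : Fin (j + 2), (-1 : A) ^ (i : ℕ) • W.d i

/-- morphism given by a matrix -/
noncomputable def mor {j k : ℕ} (M : Matrix (W.ι j) (W.ι k) A) :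
    (W.sob N) _⦋k⦌ ⟶ (W.sob N) _⦋j⦌ := ModuleCat.ofHom (mact N M)

lemma mor_add {j k : ℕ} (M M' : Matrix (W.ι j) (W.ι k) A) :
    W.mor N (M + M') = W.mor N M + W.mor N M' := by
  unfold mor
  refine ModuleCat.hom_ext (LinearMap.ext fun v => ?_)
  exact mact_add M M' v

/-- additive version -/
noncomputable def morHom (j k : ℕ) : Matrix (W.ι j) (W.ι k) A →+
    ((W.sob N) _⦋k⦌ ⟶ (W.sob N) _⦋j⦌) := AddMonoidHom.mk' (W.mor N) (W.mor_add N)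

lemma mor_sum {j k : ℕ} {β : Type*} (t : Finset β) (M : β → Matrix (W.ι j) (W.ι k) A) :
    W.mor N (∑ i ∈ t, M i) = ∑ i ∈ t, W.mor N (M i) := map_sum (W.morHom N j k) M t

lemma mor_zsmul {j k : ℕ} (z : ℤ) (M : Matrix (W.ι j) (W.ι k) A) :
    W.mor N (z • M) = z • W.mor N M := map_zsmul (W.morHom N j k) z M

lemma mor_mul {j k l : ℕ} (M : Matrix (W.ι j) (W.ι k) A) (M' : Matrix (W.ι k) (W.ι l) A) :
    W.mor N (M * M') = W.mor N M' ≫ W.mor N M := by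
  refine ModuleCat.hom_ext (LinearMap.ext fun v => ?_)
  exact mact_mul M M' v

lemma mor_one {j : ℕ} : W.mor N (scal (W.ι j) 1) = 𝟙 _ := by
  refine ModuleCat.hom_ext (LinearMap.ext fun v => ?_)
  exact (mact_scal 1 v).trans (one_smul A _)

lemma objD_eq (j : ℕ) : AlternatingFaceMapComplex.objD (W.sob N) j = W.mor N (W.D j) := by
  rw [AlternatingFaceMapComplex.objD, D, mor_sum]
  refine Finset.sum_congr rfl fun i _ => ?_
  have : (-1 : A) ^ (i : ℕ) • W.d i = ((-1 : ℤ) ^ (i : ℕ)) • W.d i := by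
    rw [← Int.cast_smul_eq_zsmul A]
    simp
  rw [this, mor_zsmul]
  rfl

lemma eq_of_mact {ι κ : Type} [Fintype ι] [Fintype κ] {M M' : Matrix ι κ A}
    (h : ∀ v, mact A M v = mact A M' v) : M = M' := by
  classical
  ext i j
  have := congrFun (h (Pi.single j 1)) i
  simpa [mact_apply, Pi.single_apply] using this

lemma DD (j : ℕ) : W.D j * W.D (j + 1) = 0 := by
  apply eq_of_mact
  intro v
  have := AlternatingFaceMapComplex.d_squared (W.sob A) j
  rw [objD_eq, objD_eq, ← mor_mul] at this
  rw [mact_zero]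
  exact congrArg (fun f => f.hom v) this

/-- `n`-skeletal -/
def Skel (n : ℕ) : Prop :=
  ∀ k, n ≤ k → ∃ G : Fin (k + 1) → Matrix (W.ι k) (W.ι (k + 1)) A,
    ∑ i, W.s i * G i = scal _ 1

lemma Skel.mhl_eq_zero {n : ℕ} (h : W.Skel n) {i : ℕ} (hi : n < i) : mhl W.D N i = 0 := by
  obtain ⟨k, rfl⟩ : ∃ k, i = k + 1 := ⟨i - 1, by omega⟩
  obtain ⟨G, hG⟩ := h k (by omega)
  apply slen_eq_zero
  intro v hv
  have h0 : (DoldKan.PInfty (X := W.sob N)).f (k + 1) = 0 := by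
    have h1 : 𝟙 ((W.sob N) _⦋k + 1⦌) = ∑ i, W.mor N (G i) ≫ (W.sob N).σ i := by
      rw [← mor_one, ← hG, mor_sum]
      exact Finset.sum_congr rfl fun i _ => mor_mul W N _ _
    have h2 : 𝟙 ((W.sob N) _⦋k + 1⦌) ≫ (DoldKan.PInfty (X := W.sob N)).f (k + 1) = 0 := by
      rw [h1, Preadditive.sum_comp]
      refine Finset.sum_eq_zero fun i _ => ?_
      rw [Category.assoc, DoldKan.σ_comp_PInfty, Limits.comp_zero]
    rwa [Category.id_comp] at h2
  have h1 := (DoldKan.homotopyPInftyToId (W.sob N)).comm (k + 1)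
  rw [h0, dNext_eq _ (show (ComplexShape.down ℕ).Rel (k + 1) k from rfl), 
    prevD_eq _ (show (ComplexShape.down ℕ).Rel (k + 1 + 1) (k + 1) from rfl)] at h1
  have e1 : (AlternatingFaceMapComplex.obj (W.sob N)).d (k + 1) k =
     W.mor N (W.D k) := (AlternatingFaceMapComplex.obj_d_eq _ _).trans (W.objD_eq N k)
  have e2 : (AlternatingFaceMapComplex.obj (W.sob N)).d (k + 1 + 1) (k + 1) =
     W.mor N (W.D (k + 1)) := (AlternatingFaceMapComplex.obj_d_eq _ _).trans (W.objD_eq N (k + 1))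
  rw [e1, e2] at h1
  generalize (DoldKan.homotopyPInftyToId (W.sob N)).hom (k + 1) (k + 1 + 1) = a at h1
  generalize (DoldKan.homotopyPInftyToId (W.sob N)).hom k (k + 1) = b at h1
  have h2 := congrArg (fun f => f.hom v) h1
  obtain ⟨b', hb'⟩ : ∃ b' : (W.ι k → N) →ₗ[A] (W.ι (k + 1) → N), b' = b.hom := ⟨b.hom, rfl⟩
  obtain ⟨a', ha'⟩ : ∃ a' : (W.ι (k + 1) → N) →ₗ[A] (W.ι (k + 2) → N), a' = a.hom := ⟨a.hom, rfl⟩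
  have h3 : (0 : W.ι (k + 1) → N) = b' (mact N (W.D k) v) + mact N (W.D (k + 1)) (a' v) + v := by
    rw [hb', ha']
    exact h2
  have hv : mact N (W.D k) v = 0 := hv
  rw [hv, map_zero, zero_add] at h3
  refine ⟨-(a' v), ?_⟩
  change mact N (W.D (k + 1)) (-(a' v)) = v
  rw [map_neg, neg_eq_iff_add_eq_zero, h3]

/-- a contraction of multiplication by `x` -/
def Con (x : A) : Prop :=
  ∃ h : ∀ k, Matrix (W.ι (k + 1)) (W.ι k) A,
    (∀ k, W.d (j := k) 0 * h k = scal _ x) ∧ W.d (j := 0) 1 * h 0 = 0 ∧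
    ∀ k (i : Fin (k + 2)), W.d (j := k + 1) i.succ * h (k + 1) = h k * W.d (j := k) i

lemma Con.kills {x : A} (h : W.Con x) : Kills W.D x := by
  obtain ⟨h, h0, h1, h2⟩ := h
  refine ⟨h, ?_, fun j => ?_⟩
  · rw [D, Fin.sum_univ_two, Matrix.add_mul]
    simp [h0, h1]
  · have e1 : W.D (j + 1) * h (j + 1) = scal _ x + 
        ∑ i : Fin (j + 2), (-1 : A) ^ ((i : ℕ) + 1) • (h j * W.d i) := by
      rw [D, Fin.sum_univ_succ (n := j + 2), Matrix.add_mul, Matrix.sum_mul]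
      congr 1
      · simp [h0]
      · refine Finset.sum_congr rfl fun i _ => ?_
        rw [Matrix.smul_mul, h2, Fin.val_succ]
    have e2 : h j * W.D j = ∑ i : Fin (j + 2), (-1 : A) ^ (i : ℕ) • (h j * W.d i) := by
      rw [D, Matrix.mul_sum]
      simp only [Matrix.mul_smul]
    rw [e1, e2, add_left_comm, ← Finset.sum_add_distrib]
    simp [pow_succ]

/-- base change -/
def bc {B : Type*} [CommRing B] (f : A →+* B) : SM B where
  ι := W.ι
  fin := W.fin
  map g := (W.map g).map f
  map_id a := by rw [W.map_id, scal_map, map_one]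
  map_comp g h := by rw [W.map_comp, Matrix.map_mul]

variable {B : Type*} [CommRing B] (f : A →+* B)

lemma matrix_map_sum {ι κ β : Type*} (t : Finset β) (M : β → Matrix ι κ A) :
    (∑ i ∈ t, M i).map f = ∑ i ∈ t, (M i).map f :=
  map_sum (AddMonoidHom.mapMatrix (m := ι) (n := κ) f.toAddMonoidHom) M t

lemma bc_D (j : ℕ) : (W.bc f).D j = (W.D j).map f := by
  unfold D
  rw [matrix_map_sum]
  refine Finset.sum_congr rfl fun i _ => ?_
  ext a b
  change (-1 : B) ^ (i : ℕ) * f _ = f ((-1 : A) ^ (i : ℕ) * _)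
  rw [map_mul, map_pow, map_neg, map_one]
  rfl

lemma Con.bc {x : A} (h : W.Con x) : (W.bc f).Con (f x) := by
  obtain ⟨h, h0, h1, h2⟩ := h
  refine ⟨fun k => (h k).map f, fun k => ?_, ?_, fun k i => ?_⟩
  · exact (Matrix.map_mul).symm.trans ((congrArg (fun M => M.map f) (h0 k)).trans (scal_map f x))
  · exact (Matrix.map_mul).symm.trans ((congrArg (fun M => M.map f) h1).trans
      (Matrix.map_zero f (map_zero f)))
  · refine Eq.trans ?_ ((congrArg (fun M => M.map f) (h2 k i)).trans ?_)
    · simp only [Matrix.map_mul]; rfl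
    · simp only [Matrix.map_mul]; rfl

lemma Skel.bc {n : ℕ} (h : W.Skel n) : (W.bc f).Skel n := by
  intro k hk
  obtain ⟨G, hG⟩ := h k hk
  refine ⟨fun i => (G i).map f, ?_⟩
  rw [← map_one f, ← scal_map]
  refine Eq.trans ?_ (congrArg (fun M => M.map f) hG)
  rw [matrix_map_sum]
  refine Finset.sum_congr rfl fun i _ => ?_
  rw [Matrix.map_mul]
  rfl

end SM
end NIT

end

section
namespace NIT
open CategoryTheory
open scoped Simplicial


section gten
variable {A : Type*} [CommRing A] {P : Type} [Fintype P]

/-- tensor product of matrices -/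
def gten {α β : P → Type} (M : ∀ i, Matrix (α i) (β i) A) : Matrix (∀ i, α i) (∀ i, β i) A :=
  fun w v => ∏ i, M i (w i) (v i)

lemma gten_mul [DecidableEq P] {α β γ : P → Type} [∀ i, Fintype (β i)]
    (M : ∀ i, Matrix (α i) (β i) A) (N : ∀ i, Matrix (β i) (γ i) A) :
    gten (fun i => M i * N i) = gten M * gten N := by
  ext w v
  simp only [gten, Matrix.mul_apply, ← Finset.prod_mul_distrib]
  rw [Finset.prod_univ_sum, Fintype.piFinset_univ]

lemma gten_scal {α : P → Type} (x : A) :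
    gten (fun i => scal (α i) x) = scal (∀ i, α i) (x ^ Fintype.card P) := by
  classical
  ext w v
  simp only [gten, scal_eq, Matrix.diagonal_apply]
  split_ifs with h
  · subst h; simp
  · obtain ⟨i, hi⟩ := Function.ne_iff.1 h
    exact Finset.prod_eq_zero (Finset.mem_univ i) (by simp [hi])

lemma gten_zero [Nonempty P] {α β : P → Type} :
    gten (fun i => (0 : Matrix (α i) (β i) A)) = 0 := by
  ext w v
  simp [gten]

lemma gten_sum [DecidableEq P] {α β : P → Type} {T : Type} [Fintype T]
    (M : T → ∀ i, Matrix (α i) (β i) A) :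
    gten (fun i => ∑ t, M t i) = ∑ t : P → T, gten (fun i => M (t i) i) := by
  ext w v
  simp only [gten, Matrix.sum_apply]
  rw [Finset.prod_univ_sum, Fintype.piFinset_univ]

lemma gten_map {B : Type*} [CommRing B] (f : A →+* B) {α β : P → Type}
    (M : ∀ i, Matrix (α i) (β i) A) : (gten M).map f = gten (fun i => (M i).map f) := by
  ext w v
  simp [gten]

/-- tensor power of a matrix -/
abbrev ten (P : Type) [Fintype P] {α β : Type} (M : Matrix α β A) : Matrix (P → α) (P → β) A :=
  gten (fun _ : P => M)

end gten

lemma mul_scal_one {A : Type*} [CommRing A] {α β : Type} [Fintype β] (M : Matrix α β A) :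
    M = M * (scal β 1 : Matrix β β A) := by
  classical
  rw [scal_eq_smul, one_smul, Matrix.mul_one]

lemma scal_one_mul {A : Type*} [CommRing A] {α β : Type} [Fintype α] (M : Matrix α β A) :
    M = (scal α 1 : Matrix α α A) * M := by
  classical
  rw [scal_eq_smul, one_smul, Matrix.one_mul]

section orb
variable {A : Type*} [CommRing A] (p : ℕ) [Fact p.Prime] {α β γ : Type}

/-- rotation of words -/
def rot {p : ℕ} (a : ZMod p) (w : ZMod p → α) : ZMod p → α := fun i => w (i + a)

lemma rot_rot (a b : ZMod p) (w : ZMod p → α) : rot a (rot b w) = rot (a + b) w := by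
  funext i; simp [rot, add_assoc]

lemma rot_zero (w : ZMod p → α) : rot 0 w = w := by
  funext i; simp [rot]

/-- rotation as an equivalence -/
def rotE (α : Type) (a : ZMod p) : (ZMod p → α) ≃ (ZMod p → α) where
  toFun := rot a
  invFun := rot (-a)
  left_inv w := by rw [rot_rot, neg_add_cancel, rot_zero]
  right_inv w := by rw [rot_rot, add_neg_cancel, rot_zero]

lemma ten_rot (M : Matrix α β A) (a : ZMod p) (w : ZMod p → α) (v : ZMod p → β) :
    ten (ZMod p) M (rot a w) (rot a v) = ten (ZMod p) M w v := by
  simp only [gten, rot]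
  exact Fintype.prod_equiv (Equiv.addRight a) _ _ (fun i => rfl)

/-- orbit relation -/
def orel (α : Type) : Setoid (ZMod p → α) where
  r w v := ∃ a, v = rot a w
  iseqv := ⟨fun w => ⟨0, (rot_zero p w).symm⟩,
    fun {w v} ⟨a, h⟩ => ⟨-a, by rw [h, rot_rot, neg_add_cancel, rot_zero]⟩,
    fun {w v u} ⟨a, h⟩ ⟨b, h'⟩ => ⟨b + a, by rw [h', h, rot_rot]⟩⟩

/-- orbits -/
abbrev Orb (α : Type) : Type := Quotient (orel p α)

noncomputable instance [Fintype α] : Fintype (Orb p α) := Fintype.ofFinite _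

lemma mk_rot (a : ZMod p) (w : ZMod p → α) :
    (Quotient.mk (orel p α) (rot a w)) = Quotient.mk (orel p α) w :=
  Quotient.sound ((orel p α).symm ⟨a, rfl⟩)

open Classical in
/-- projection to coinvariants -/
noncomputable def opi (A : Type*) [CommRing A] (α : Type) : Matrix (Orb p α) (ZMod p → α) A :=
  fun q w => if Quotient.mk (orel p α) w = q then 1 else 0

open Classical in
/-- section -/
noncomputable def osec (A : Type*) [CommRing A] (α : Type) : Matrix (ZMod p → α) (Orb p α) A :=
  fun w q => if w = q.out then 1 else 0

variable [Fintype α] [Fintype β] [Fintype γ]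

lemma opi_osec : opi p A α * osec p A α = scal _ 1 := by
  classical
  ext q q'
  simp [Matrix.mul_apply, opi, osec, scal_eq, Matrix.diagonal_apply, eq_comm]

lemma opi_ten_rot (M : Matrix α β A) (q : Orb p α) (a : ZMod p) (v : ZMod p → β) :
    (opi p A α * ten (ZMod p) M) q (rot a v) = (opi p A α * ten (ZMod p) M) q v := by
  simp only [Matrix.mul_apply]
  refine (Fintype.sum_equiv (rotE p α a) _ _ fun w => ?_).symm
  change opi p A α q w * ten (ZMod p) M w v = opi p A α q (rot a w) * ten (ZMod p) M (rot a w) (rot a v)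
  rw [ten_rot]
  have h : opi p A α q (rot a w) = opi p A α q w := by
    unfold opi
    rw [mk_rot]
  rw [h]

lemma osec_opi (M : Matrix α β A) :
    opi p A α * ten (ZMod p) M * osec p A β * opi p A β = opi p A α * ten (ZMod p) M := by
  classical
  ext q v
  have h1 : ∀ (X : Matrix (Orb p α) (ZMod p → β) A) q v,
      (X * osec p A β * opi p A β) q v = X q ((Quotient.mk (orel p β) v).out) := by
    intro X q v
    simp [Matrix.mul_apply, opi, osec]
  rw [h1]
  obtain ⟨a, ha⟩ := Quotient.exact (Quotient.out_eq (Quotient.mk (orel p β) v))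
  conv_rhs => rw [ha]
  rw [opi_ten_rot]

/-- coinvariants of tensor power of a matrix -/
noncomputable def tc (M : Matrix α β A) : Matrix (Orb p α) (Orb p β) A :=
  opi p A α * ten (ZMod p) M * osec p A β

lemma tc_opi (M : Matrix α β A) : tc p M * opi p A β = opi p A α * ten (ZMod p) M := osec_opi p M

lemma tc_mul (M : Matrix α β A) (N : Matrix β γ A) : tc p (M * N) = tc p M * tc p N := by
  conv_rhs => rw [tc, tc, ← Matrix.mul_assoc, ← Matrix.mul_assoc, osec_opi]
  rw [tc, ten, gten_mul]
  simp only [Matrix.mul_assoc]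

lemma tc_scal (x : A) : tc p (scal α x) = scal _ (x ^ p) := by
  classical
  rw [tc, ten, gten_scal, ZMod.card]
  have : opi p A α * scal (ZMod p → α) (x ^ p) = (x ^ p) • opi p A α := by
    rw [scal_eq_smul, Matrix.mul_smul, Matrix.mul_one]
  rw [this, Matrix.smul_mul, opi_osec, scal_eq_smul, scal_eq_smul, one_smul]

lemma tc_zero : tc p (0 : Matrix α β A) = 0 := by
  rw [tc, ten, gten_zero, Matrix.mul_zero, Matrix.zero_mul]

lemma tc_map {B : Type*} [CommRing B] (f : A →+* B) (M : Matrix α β A) :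
    (tc p M).map f = tc p (M.map f) := by
  rw [tc, Matrix.map_mul, Matrix.map_mul, gten_map, tc]
  congr 2
  · ext q w
    simp [opi, apply_ite f]
  · ext q w
    simp [osec, apply_ite f]

end orb

namespace SM
variable {A : Type u} [CommRing A] (W : SM A) (p : ℕ) [Fact p.Prime]

/-- tensor power -/
noncomputable def T : SM A where
  ι k := ZMod p → W.ι k
  fin k := inferInstance
  map f := ten (ZMod p) (W.map f)
  map_id a := by rw [W.map_id, ten, gten_scal, one_pow]
  map_comp f g := by rw [W.map_comp, ten, gten_mul]

/-- cyclic coinvariants -/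
noncomputable def TC : SM A where
  ι k := Orb p (W.ι k)
  fin k := inferInstance
  map f := tc p (W.map f)
  map_id a := by rw [W.map_id, tc_scal, one_pow]
  map_comp f g := by rw [W.map_comp, tc_mul]

variable {W}
lemma Con.T {x : A} (h : W.Con x) : (W.T p).Con (x ^ p) := by
  obtain ⟨h, h0, h1, h2⟩ := h
  refine ⟨fun k => ten (ZMod p) (h k), fun k => ?_, ?_, fun k i => ?_⟩
  · refine (gten_mul _ _).symm.trans ?_
    have := gten_scal (P := ZMod p) (α := fun _ => W.ι k) x
    rw [ZMod.card] at this
    rw [← h0] at this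
    exact this
  · refine (gten_mul _ _).symm.trans ?_
    exact (congrArg (ten (ZMod p)) h1).trans gten_zero
  · refine (gten_mul _ _).symm.trans (.trans ?_ (gten_mul _ _))
    exact congrArg (ten (ZMod p)) (h2 k i)

lemma Con.TC {x : A} (h : W.Con x) : (W.TC p).Con (x ^ p) := by
  obtain ⟨h, h0, h1, h2⟩ := h
  refine ⟨fun k => tc p (h k), fun k => ?_, ?_, fun k i => ?_⟩
  · refine (tc_mul p _ _).symm.trans ?_
    exact (congrArg (tc p) (h0 k)).trans (tc_scal p x)
  · refine (tc_mul p _ _).symm.trans ?_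
    exact (congrArg (tc p) h1).trans (tc_zero p)
  · refine (tc_mul p _ _).symm.trans (.trans ?_ (tc_mul p _ _))
    exact congrArg (tc p) (h2 k i)

lemma Skel.all {n : ℕ} (h : W.Skel n) (k : ℕ) : ∃ (I : Type) (_ : Fintype I) (j : I → ℕ)
    (σ : ∀ t, ⦋k⦌ ⟶ ⦋j t⦌) (g : ∀ t, Matrix (W.ι (j t)) (W.ι k) A), (∀ t, j t ≤ n) ∧
    ∑ t, W.map (σ t) * g t = scal _ 1 := by
  classical
  induction k with
  | zero => exact ⟨Unit, inferInstance, fun _ => 0, fun _ => 𝟙 _, fun _ => scal _ 1,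
      fun _ => Nat.zero_le _, by
        simp only [Finset.univ_unique, Finset.sum_singleton, W.map_id]
        rw [scal_eq_smul, one_smul]
        exact Matrix.one_mul _⟩
  | succ k ih =>
    by_cases hk : k + 1 ≤ n
    · exact ⟨Unit, inferInstance, fun _ => k + 1, fun _ => 𝟙 _, fun _ => scal _ 1,
        fun _ => hk, by
        simp only [Finset.univ_unique, Finset.sum_singleton, W.map_id]
        rw [scal_eq_smul, one_smul]
        exact Matrix.one_mul _⟩
    · obtain ⟨I, _, j, σ, g, hj, hs⟩ := ih
      obtain ⟨G, hG⟩ := h k (by omega)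
      refine ⟨Fin (k + 1) × I, inferInstance, fun t => j t.2, fun t => SimplexCategory.σ t.1 ≫ σ t.2,
        fun t => g t.2 * G t.1, fun t => hj _, ?_⟩
      rw [← hG, Fintype.sum_prod_type]
      refine Finset.sum_congr rfl fun i _ => ?_
      rw [scal_one_mul (G i)]
      change _ = W.s (j := k) i * ((scal (W.ι ⦋k⦌.len) 1 : Matrix (W.ι ⦋k⦌.len) (W.ι ⦋k⦌.len) A) * G i)
      rw [← hs, Matrix.sum_mul, Matrix.mul_sum]
      refine Finset.sum_congr rfl fun t _ => ?_
      rw [W.map_comp, Matrix.mul_assoc, Matrix.mul_assoc]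
      rfl

lemma exists_common_edge {P : Type} [Fintype P] {n k : ℕ} (hk : Fintype.card P * n ≤ k)
    (j : P → ℕ) (hj : ∀ t, j t ≤ n) (σ : ∀ t, ⦋k + 1⦌ ⟶ ⦋j t⦌) :
    ∃ l : Fin (k + 1), ∀ t, ∃ θ : ⦋k⦌ ⟶ ⦋j t⦌, σ t = SimplexCategory.σ l ≫ θ := by
  classical
  let f : ∀ t, Fin (k + 1 + 1) →o Fin (j t + 1) := fun t => (σ t).toOrderHom
  let S : P → Finset (Fin (k + 1)) := fun t =>
    Finset.univ.filter fun l => f t l.castSucc ≠ f t l.succ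
  have hS : ∀ t, (S t).card ≤ n := by
    intro t
    refine le_trans ?_ (hj t)
    have : (S t).card ≤ (Finset.univ.erase (0 : Fin (j t + 1))).card := by
      refine Finset.card_le_card_of_injOn (fun l => f t l.succ) ?_ ?_
      · intro l hl
        simp only [S, Finset.coe_filter, Finset.mem_univ, true_and, Set.mem_ofPred_eq] at hl
        simp only [Finset.coe_erase, Finset.coe_univ, Set.mem_sdiff, Set.mem_univ, true_and,
          Set.mem_singleton_iff]
        intro h0
        have := (f t).monotone (show l.castSucc ≤ l.succ from Fin.castSucc_lt_succ.le)
        rw [h0] at this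
        exact hl ((Fin.le_zero_iff.1 this).trans h0.symm)
      · intro l hl l' hl' h
        simp only [S, Finset.coe_filter, Finset.mem_univ, true_and, Set.mem_ofPred_eq] at hl hl'
        by_contra hne
        rcases lt_or_gt_of_ne hne with h1 | h1
        · have a1 := (f t).monotone (show l.succ ≤ l'.castSucc from h1)
          have a2 := (f t).monotone (show l'.castSucc ≤ l'.succ from Fin.castSucc_lt_succ.le)
          have h' : f t l.succ = f t l'.succ := h
          rw [h'] at a1
          exact hl' (le_antisymm a2 a1)
        · have a1 := (f t).monotone (show l'.succ ≤ l.castSucc from h1)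
          have a2 := (f t).monotone (show l.castSucc ≤ l.succ from Fin.castSucc_lt_succ.le)
          have h' : f t l.succ = f t l'.succ := h
          rw [← h'] at a1
          exact hl (le_antisymm a2 a1)
    simpa using this
  have hU : (Finset.univ.biUnion S).card < (Finset.univ : Finset (Fin (k + 1))).card := by
    refine lt_of_le_of_lt (Finset.card_biUnion_le_card_mul _ _ n fun t _ => hS t) ?_
    simpa using Nat.lt_succ_of_le hk
  obtain ⟨l, -, hl⟩ := Finset.exists_mem_notMem_of_card_lt_card hU
  refine ⟨l, fun t => SimplexCategory.eq_σ_comp_of_not_injective' _ l ?_⟩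
  simp only [Finset.mem_biUnion, Finset.mem_univ, true_and, not_exists, S, Finset.mem_filter,
    not_not] at hl
  exact hl t

lemma Skel.T {n : ℕ} (h : W.Skel n) : (W.T p).Skel (p * n) := by
  classical
  intro k hk
  obtain ⟨I, _, j, σ, g, hj, hs⟩ := h.all (k + 1)
  have h1 := gten_scal (P := ZMod p) (α := fun _ => W.ι (k + 1)) (1 : A)
  rw [one_pow] at h1
  have h2 : ∀ t : ZMod p → I, ∃ (l : Fin (k + 1)) (G : Matrix (ZMod p → W.ι k) (ZMod p → W.ι (k + 1)) A),
      gten (fun i => W.map (σ (t i)) * g (t i)) = ten (ZMod p) (W.s l) * G := by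
    intro t
    obtain ⟨l, hl⟩ := exists_common_edge (P := ZMod p) (n := n) (k := k) (by simpa [ZMod.card] using hk)
      (fun i => j (t i)) (fun i => hj _) (fun i => σ (t i))
    choose θ hθ using hl
    refine ⟨l, gten (fun i => W.map (θ i) * g (t i)), ?_⟩
    rw [ten, ← gten_mul]
    congr 1
    funext i
    rw [hθ, W.map_comp, Matrix.mul_assoc]
    rfl
  choose l G hG using h2
  refine ⟨fun i => ∑ t ∈ Finset.univ.filter (fun t => l t = i), G t, ?_⟩
  refine Eq.trans ?_ h1
  rw [← hs, gten_sum (fun t _ => W.map (σ t) * g t)]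
  simp only [hG]
  rw [← Finset.sum_fiberwise_of_maps_to (s := Finset.univ) (t := Finset.univ) (g := l)
    (fun _ _ => Finset.mem_univ _)]
  refine Finset.sum_congr rfl fun i _ => ?_
  refine (Matrix.mul_sum _ _ _).trans ?_
  refine Finset.sum_congr rfl fun t ht => ?_
  rw [(Finset.mem_filter.1 ht).2]
  rfl

lemma Skel.TC {n : ℕ} (h : W.Skel n) : (W.TC p).Skel (p * n) := by
  classical
  intro k hk
  obtain ⟨G, hG⟩ : ∃ G : Fin (k + 1) → Matrix (ZMod p → W.ι k) (ZMod p → W.ι (k + 1)) A,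
    ∑ i, ten (ZMod p) (W.s i) * G i = scal _ 1 := h.T p k hk
  refine ⟨fun i => opi p A (W.ι k) * G i * osec p A (W.ι (k + 1)), ?_⟩
  refine Eq.trans ?_ (opi_osec p)
  rw [mul_scal_one (opi p A (W.ι (k + 1))), ← hG, Matrix.mul_sum, Matrix.sum_mul]
  refine Finset.sum_congr rfl fun i _ => ?_
  change tc p (W.s i) * (opi p A (W.ι k) * G i * osec p A (W.ι (k + 1))) =
    opi p A (W.ι (k + 1)) * (ten (ZMod p) (W.s i) * G i) * osec p A (W.ι (k + 1))
  rw [← Matrix.mul_assoc, ← Matrix.mul_assoc, tc_opi, ← Matrix.mul_assoc]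

end SM
end NIT

end

section
namespace NIT
open CategoryTheory
open scoped Simplicial


section Chi
variable {A : Type*} [CommRing A]

/-- alternating sum of lengths -/
def asum (h : ℕ → ℕ∞) (m : ℕ) : ℤ := ∑ j ∈ Finset.range m, (-1 : ℤ) ^ j * ((h j).toNat : ℤ)

lemma asum_stable {h : ℕ → ℕ∞} {m : ℕ} (hm : ∀ j, m ≤ j → h j = 0) {m' : ℕ} (hle : m ≤ m') :
    asum h m' = asum h m := by
  obtain ⟨k, rfl⟩ := Nat.exists_eq_add_of_le hle
  induction k with
  | zero => rfl
  | succ k ih =>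
    rw [← add_assoc, asum, Finset.sum_range_succ, hm (m + k) (Nat.le_add_right _ _)]
    simpa [asum] using ih (Nat.le_add_right _ _)

/-- Euler characteristic -/
def HasChi (h : ℕ → ℕ∞) (c : ℤ) : Prop :=
  (∀ j, h j ≠ ⊤) ∧ ∃ m, (∀ j, m ≤ j → h j = 0) ∧ asum h m = c

lemma HasChi.unique {h : ℕ → ℕ∞} {c c' : ℤ} (h1 : HasChi h c) (h2 : HasChi h c') : c = c' := by
  obtain ⟨-, m, hm, rfl⟩ := h1
  obtain ⟨-, m', hm', rfl⟩ := h2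
  rw [← asum_stable hm (le_max_left m m'), asum_stable hm' (le_max_right m m')]

lemma HasChi.exists {h : ℕ → ℕ∞} (hf : ∀ j, h j ≠ ⊤) {m : ℕ} (hm : ∀ j, m ≤ j → h j = 0) :
    ∃ c, HasChi h c := ⟨_, hf, m, hm, rfl⟩

lemma asum_add {a b : ℕ → ℕ∞} (ha : ∀ j, a j ≠ ⊤) (hb : ∀ j, b j ≠ ⊤) (m : ℕ) :
    asum (fun j => a j + b j) m = asum a m + asum b m := by
  rw [asum, asum, asum, ← Finset.sum_add_distrib]
  refine Finset.sum_congr rfl fun j _ => ?_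
  rw [ENat.toNat_add (ha j) (hb j)]
  push_cast; ring

/-- shift -/
def shf (r : ℕ → ℕ∞) (j : ℕ) : ℕ∞ := Nat.casesOn j 0 r

lemma asum_shf (r : ℕ → ℕ∞) (m : ℕ) : asum (shf r) (m + 1) = - asum r m := by
  rw [asum, Finset.sum_range_succ', asum, ← Finset.sum_neg_distrib]
  simp [shf, pow_succ]

lemma HasChi.of_les {h1 h2 h3 r a b : ℕ → ℕ∞} (e1 : ∀ j, h1 j = r j + a j)
    (e2 : ∀ j, h2 j = a j + b j) (e3 : ∀ j, h3 j = b j + shf r j)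
    (hr : ∀ j, r j ≠ ⊤) (ha : ∀ j, a j ≠ ⊤) (hb : ∀ j, b j ≠ ⊤) {m : ℕ}
    (hr' : ∀ j, m ≤ j → r j = 0) (ha' : ∀ j, m ≤ j → a j = 0) (hb' : ∀ j, m ≤ j → b j = 0) :
    ∃ c1 c3, HasChi h1 c1 ∧ HasChi h3 c3 ∧ HasChi h2 (c1 + c3) := by
  have hs : ∀ j, shf r j ≠ ⊤ := by
    intro j; cases j with
    | zero => exact ENat.zero_ne_top
    | succ j => exact hr j
  obtain rfl := funext e1
  obtain rfl := funext e2
  obtain rfl := funext e3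
  refine ⟨asum (fun j => r j + a j) (m + 1), asum (fun j => b j + shf r j) (m + 1),
    ⟨fun j => ?_, m + 1, fun j hj => ?_, rfl⟩, ⟨fun j => ?_, m + 1, fun j hj => ?_, rfl⟩,
    ⟨fun j => ?_, m + 1, fun j hj => ?_, ?_⟩⟩
  · simp [hr, ha]
  · simp [hr' j (by omega), ha' j (by omega)]
  · simp [hs, hb]
  · obtain ⟨k, rfl⟩ : ∃ k, j = k + 1 := ⟨j - 1, by omega⟩
    simp [shf, hr' k (by omega), hb' (k + 1) (by omega)]
  · simp [ha, hb]
  · simp [ha' j (by omega), hb' j (by omega)]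
  · rw [asum_add ha hb, asum_add hr ha, asum_add hb hs, asum_shf, asum_stable hr' (Nat.le_succ m)]
    ring

variable {h1 h2 h3 : ℕ → ℕ∞}
/-- long exact sequence numerically -/
def LES (h1 h2 h3 : ℕ → ℕ∞) : Prop := ∃ r a b : ℕ → ℕ∞, (∀ j, h1 j = r j + a j) ∧
    (∀ j, h2 j = a j + b j) ∧ ∀ j, h3 j = b j + shf r j

lemma LES.of {r a b : ℕ → ℕ∞} (e1 : ∀ j, h1 j = r j + a j) (e2 : ∀ j, h2 j = a j + b j)
    (e3 : h3 0 = b 0) (e4 : ∀ j, h3 (j + 1) = b (j + 1) + r j) : LES h1 h2 h3 := by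
  refine ⟨r, a, b, e1, e2, fun j => ?_⟩
  cases j with
  | zero => simp [shf, e3]
  | succ j => exact e4 j

lemma LES.chi2 (h : LES h1 h2 h3) {c1 c3 : ℤ} (H1 : HasChi h1 c1) (H3 : HasChi h3 c3) :
    HasChi h2 (c1 + c3) := by
  obtain ⟨r, a, b, e1, e2, e3⟩ := h
  have t1 := H1; have t3 := H3
  obtain ⟨f1, m1, v1, -⟩ := H1
  obtain ⟨f3, m3, v3, -⟩ := H3
  simp only [e1, ne_eq, ENat.add_eq_top, not_or] at f1
  simp only [e3, ne_eq, ENat.add_eq_top, not_or] at f3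
  simp only [e1, add_eq_zero] at v1
  simp only [e3, add_eq_zero] at v3
  obtain ⟨d1, d3, k1, k3, k⟩ := HasChi.of_les e1 e2 e3 (fun j => (f1 j).1) (fun j => (f1 j).2)
    (fun j => (f3 j).1) (m := max m1 m3) (fun j hj => (v1 j (le_of_max_le_left hj)).1)
    (fun j hj => (v1 j (le_of_max_le_left hj)).2) (fun j hj => (v3 j (le_of_max_le_right hj)).1)
  rw [t1.unique k1, t3.unique k3]
  exact k

lemma LES.chi3 (h : LES h1 h2 h3) {c1 c2 : ℤ} (H1 : HasChi h1 c1) (H2 : HasChi h2 c2) :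
    HasChi h3 (c2 - c1) := by
  obtain ⟨r, a, b, e1, e2, e3⟩ := h
  have t1 := H1; have t2 := H2
  obtain ⟨f1, m1, v1, -⟩ := H1
  obtain ⟨f2, m2, v2, -⟩ := H2
  simp only [e1, ne_eq, ENat.add_eq_top, not_or] at f1
  simp only [e2, ne_eq, ENat.add_eq_top, not_or] at f2
  simp only [e1, add_eq_zero] at v1
  simp only [e2, add_eq_zero] at v2
  obtain ⟨d1, d3, k1, k3, k⟩ := HasChi.of_les e1 e2 e3 (fun j => (f1 j).1) (fun j => (f1 j).2)
    (fun j => (f2 j).2) (m := max m1 m2) (fun j hj => (v1 j (le_of_max_le_left hj)).1)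
    (fun j hj => (v1 j (le_of_max_le_left hj)).2) (fun j hj => (v2 j (le_of_max_le_right hj)).2)
  rw [t1.unique k1, t2.unique k, add_sub_cancel_left]
  exact k3

end Chi

section Seq
variable {A : Type u} [CommRing A] (p : ℕ) [Fact p.Prime] [CharP A p] {α β γ : Type}

/-- rotation operator -/
def sg (A : Type u) [CommRing A] (α : Type) : ((ZMod p → α) → A) →ₗ[A] ((ZMod p → α) → A) :=
  LinearMap.funLeft A A (rot (1 : ZMod p))

/-- rotation minus one -/
def yy (A : Type u) [CommRing A] (α : Type) : ((ZMod p → α) → A) →ₗ[A] ((ZMod p → α) → A) :=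
  sg p A α - 1

lemma sg_pow (k : ℕ) (t : (ZMod p → α) → A) (w : ZMod p → α) :
    ((sg p A α) ^ k) t w = t (rot (k : ZMod p) w) := by
  induction k generalizing t with
  | zero => simp [rot_zero]
  | succ k ih =>
    rw [pow_succ, Module.End.mul_apply, ih]
    change t (rot 1 (rot (k : ZMod p) w)) = _
    rw [rot_rot, add_comm]; simp

lemma yy_pow : (yy p A α) ^ (p - 1) = ∑ k ∈ Finset.range p, (sg p A α) ^ k := by
  have h : ((Polynomial.X - 1 : Polynomial (ZMod p)) ^ (p - 1)) =
      ∑ k ∈ Finset.range p, Polynomial.X ^ k := by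
    have h0 : (Polynomial.X - 1 : Polynomial (ZMod p)) ≠ 0 := by
      simpa using Polynomial.X_sub_C_ne_zero (1 : ZMod p)
    apply mul_right_cancel₀ h0
    rw [geom_sum_mul, ← pow_succ, Nat.sub_add_cancel (Nat.Prime.one_le Fact.out), sub_pow_char,
      one_pow]
  have := congrArg (fun P => Polynomial.aeval (sg p A α) (P.map (ZMod.castHom (dvd_refl p) A))) h
  simpa [Polynomial.map_sum, yy] using this

lemma nn_apply (t : (ZMod p → α) → A) (w : ZMod p → α) :
    ((yy p A α) ^ (p - 1)) t w = ∑ a : ZMod p, t (rot a w) := by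
  rw [yy_pow, LinearMap.sum_apply, Finset.sum_apply]
  simp only [sg_pow]
  refine Finset.sum_nbij (fun k => (k : ZMod p)) (fun _ _ => Finset.mem_univ _) ?_ ?_ (fun _ _ => rfl)
  · intro a ha b hb h
    have := (ZMod.natCast_eq_natCast_iff' a b p).1 h
    rwa [Nat.mod_eq_of_lt (by simpa using ha), Nat.mod_eq_of_lt (by simpa using hb)] at this
  · intro a _
    exact ⟨a.val, by simpa using ZMod.val_lt a, by simp⟩

lemma const_of_rot {w : ZMod p → α} {a b : ZMod p} (hab : a ≠ b) (h : rot a w = rot b w) (i j : ZMod p) :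
    w i = w j := by
  have h1 : rot (a - b) w = w := by
    rw [sub_eq_neg_add, ← rot_rot, h, rot_rot, neg_add_cancel, rot_zero]
  have h2 : ∀ k : ℕ, ∀ i, w (i + k * (a - b)) = w i := by
    intro k
    induction k with
    | zero => simp
    | succ k ih =>
      intro i
      have := congrFun h1 (i + k * (a - b))
      rw [ih] at this
      rw [← this, rot]
      push_cast
      congr 1; ring
  have h3 := h2 ((j - i) / (a - b)).val i
  rw [ZMod.natCast_zmod_val, div_mul_cancel₀ _ (sub_ne_zero.2 hab)] at h3
  rw [← h3]; congr 1; ring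

variable [Fintype α] [Fintype β]

lemma mact_opi (t : (ZMod p → α) → A) (q : Orb p α) [DecidableEq (Orb p α)] :
    mact A (opi p A α) t q = ∑ v with Quotient.mk (orel p α) v = q, t v := by
  classical
  rw [mact_apply, Finset.sum_filter]
  refine Finset.sum_congr rfl fun v _ => ?_
  simp [opi]

/-- constant words -/
def IsC (w : ZMod p → α) : Prop := ∃ a, w = fun _ => a

lemma nn_const (t : (ZMod p → α) → A) (a : α) :
    ((yy p A α) ^ (p - 1)) t (fun _ => a) = 0 := by
  rw [nn_apply]
  change ∑ _a : ZMod p, t (fun _ => a) = 0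
  rw [Finset.sum_const, Finset.card_univ, ZMod.card, nsmul_eq_mul, CharP.cast_eq_zero, zero_mul]

lemma nn_nonconst (t : (ZMod p → α) → A) (w : ZMod p → α) (hw : ¬ IsC p w) :
    ((yy p A α) ^ (p - 1)) t w = mact A (opi p A α) t (Quotient.mk _ w) := by
  classical
  rw [nn_apply, mact_opi]
  refine Finset.sum_nbij (fun a => rot a w) ?_ ?_ ?_ (fun _ _ => rfl)
  · intro a _
    simp only [Finset.mem_filter, Finset.mem_univ, true_and]
    exact mk_rot p a w
  · intro a _ b _ h
    by_contra hne
    exact hw ⟨w 0, funext fun i => const_of_rot p hne h i 0⟩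
  · intro v hv
    simp only [Finset.coe_filter, Finset.mem_univ, true_and, Set.mem_ofPred_eq] at hv
    obtain ⟨a, ha⟩ := Quotient.exact hv.symm
    exact ⟨a, by simp, ha.symm⟩

lemma opi_sg (t : (ZMod p → α) → A) :
    mact A (opi p A α) (sg p A α t) = mact A (opi p A α) t := by
  ext q
  rw [mact_apply, mact_apply]
  refine Fintype.sum_equiv (rotE p α 1) _ _ fun w => ?_
  have h : opi p A α q (rotE p α 1 w) = opi p A α q w := by
    change opi p A α q (rot 1 w) = _
    unfold opi
    rw [mk_rot]
  rw [h]
  rfl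

lemma opi_yy (t : (ZMod p → α) → A) : mact A (opi p A α) (yy p A α t) = 0 := by
  rw [yy, LinearMap.sub_apply, map_sub, opi_sg]
  exact sub_self _

lemma osec_opi_sub (t : (ZMod p → α) → A) :
    mact A (osec p A α) (mact A (opi p A α) t) - t ∈ LinearMap.range (yy p A α) := by
  classical
  have key : ∀ t, t ∈ (LinearMap.range (yy p A α)).comap
      ((mact A (osec p A α)).comp (mact A (opi p A α)) - LinearMap.id) := by
    intro t
    rw [pi_eq_sum_univ' t]
    refine Submodule.sum_mem _ fun w _ => Submodule.smul_mem _ _ ?_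
    have hpi : (Pi.single w 1 : (ZMod p → α) → A) = fun j => if w = j then (1 : A) else 0 := by
      ext j; simp [Pi.single_apply, eq_comm]
    rw [hpi]
    obtain ⟨a, ha⟩ := Quotient.exact (Quotient.out_eq (Quotient.mk (orel p α) w)).symm
    -- out = rot a w
    have h1 : (mact A (osec p A α)) (mact A (opi p A α) (fun j => if w = j then (1 : A) else 0)) =
        (sg p A α ^ (-a).val) (fun j => if w = j then (1 : A) else 0) := by
      ext v
      rw [sg_pow, ZMod.natCast_zmod_val]
      rw [mact_apply]
      simp only [mact_opi, Finset.sum_ite_eq, Finset.mem_filter, Finset.mem_univ, true_and]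
      simp only [osec, smul_eq_mul, mul_ite, mul_one, mul_zero, Finset.sum_ite_eq, Finset.mem_univ,
        if_true, ha]
      have : (v = rot a w) ↔ w = rot (-a) v := by
        constructor
        · rintro rfl; rw [rot_rot, neg_add_cancel, rot_zero]
        · intro h; rw [h, rot_rot, add_neg_cancel, rot_zero]
      simp only [this]
    rw [Submodule.mem_comap, LinearMap.sub_apply, LinearMap.comp_apply, h1]
    have h2 := mul_geom_sum (sg p A α) (-a).val
    refine ⟨(∑ i ∈ Finset.range (-a).val, sg p A α ^ i) (fun j => if w = j then (1 : A) else 0), ?_⟩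
    have := LinearMap.congr_fun h2 (fun j => if w = j then (1 : A) else 0)
    exact this
  exact key t

lemma exact_opi : Function.Exact (LinearMap.range (yy p A α ^ 1)).subtype (mact A (opi p A α)) := by
  intro t
  rw [pow_one]
  constructor
  · intro h
    have := osec_opi_sub p t
    rw [h, map_zero, zero_sub, neg_mem_iff] at this
    exact ⟨⟨t, this⟩, rfl⟩
  · rintro ⟨⟨_, s, rfl⟩, rfl⟩
    exact opi_yy p s

lemma surj_opi : Function.Surjective (mact A (opi p A α)) := by
  intro u
  refine ⟨mact A (osec p A α) u, ?_⟩
  rw [← mact_mul, opi_osec, mact_scal, one_smul]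

lemma nn_of_opi {t t' : (ZMod p → α) → A} (h : mact A (opi p A α) t = mact A (opi p A α) t') :
    ((yy p A α) ^ (p - 1)) t = ((yy p A α) ^ (p - 1)) t' := by
  ext w
  by_cases hw : IsC p w
  · obtain ⟨a, rfl⟩ := hw
    rw [nn_const, nn_const]
  · rw [nn_nonconst p _ _ hw, nn_nonconst p _ _ hw, h]

lemma mem_range_nn {t : (ZMod p → α) → A} (h1 : t ∈ LinearMap.range (yy p A α))
    (h2 : yy p A α t = 0) : t ∈ LinearMap.range (yy p A α ^ (p - 1)) := by
  have h3 : sg p A α t = t := by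
    rw [yy, LinearMap.sub_apply] at h2
    exact sub_eq_zero.1 h2
  have h4 : ∀ k : ℕ, (sg p A α ^ k) t = t := by
    intro k
    induction k with
    | zero => rfl
    | succ k ih => rw [pow_succ, Module.End.mul_apply, h3, ih]
  have h5 : ∀ a w, t (rot a w) = t w := by
    intro a w
    have := congrFun (h4 a.val) w
    rwa [sg_pow, ZMod.natCast_zmod_val] at this
  obtain ⟨t', ht'⟩ := surj_opi p (A := A) (α := α) (fun q => t q.out)
  refine ⟨t', ?_⟩
  ext w
  by_cases hw : IsC p w
  · rw [IsC] at hw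
    obtain ⟨a, rfl⟩ := hw
    rw [nn_const]
    obtain ⟨s, rfl⟩ := h1
    change 0 = s _ - s _
    exact (sub_self _).symm
  · rw [nn_nonconst p _ _ hw, ht']
    obtain ⟨a, ha⟩ := Quotient.exact (Quotient.out_eq (Quotient.mk (orel p α) w)).symm
    change t (Quotient.mk (orel p α) w).out = _
    rw [ha, h5]

lemma sg_ten (M : Matrix α β A) (t : (ZMod p → β) → A) :
    sg p A α (mact A (ten (ZMod p) M) t) = mact A (ten (ZMod p) M) (sg p A β t) := by
  ext w
  change mact A (ten (ZMod p) M) t (rot 1 w) = _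
  rw [mact_apply, mact_apply]
  refine (Fintype.sum_equiv (rotE p β 1) _ _ fun v => ?_).symm
  change ten (ZMod p) M w v • t (rot 1 v) = ten (ZMod p) M (rot 1 w) (rot 1 v) • t (rot 1 v)
  rw [ten_rot]

open Classical in
/-- constant orbit matrix -/
noncomputable def cst (A : Type u) [CommRing A] (α : Type) : Matrix (Orb p α) α A :=
  fun q a => if Quotient.mk (orel p α) (fun _ => a) = q then 1 else 0

lemma mk_const {v : ZMod p → α} {a : α} (h : Quotient.mk (orel p α) v = Quotient.mk (orel p α) (fun _ => a)) :
    v = fun _ => a := by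
  obtain ⟨c, hc⟩ := Quotient.exact h.symm
  rw [hc]; rfl

lemma mact_cst_const (u : α → A) (a : α) :
    mact A (cst p A α) u (Quotient.mk _ (fun _ => a)) = u a := by
  classical
  rw [mact_apply, Finset.sum_eq_single a]
  · simp [cst]
  · intro b _ hb
    rw [cst, if_neg, zero_smul]
    intro h
    exact hb (congrFun (mk_const p h) 0)
  · simp

lemma mact_cst_nonconst (u : α → A) {w : ZMod p → α} (hw : ¬ IsC p w) :
    mact A (cst p A α) u (Quotient.mk _ w) = 0 := by
  rw [mact_apply]
  refine Finset.sum_eq_zero fun b _ => ?_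
  rw [cst, if_neg, zero_smul]
  intro h
  exact hw ⟨b, mk_const p h.symm⟩

lemma inj_cst : Function.Injective (mact A (cst p A α)) := by
  intro u v h
  ext a
  rw [← mact_cst_const p u a, h, mact_cst_const]

/-- norm map -/
noncomputable def gN (A : Type u) [CommRing A] (α : Type) [Fintype α] :
    (Orb p α → A) →ₗ[A] LinearMap.range (yy p A α ^ (p - 1)) :=
  ((yy p A α ^ (p - 1)).rangeRestrict).comp (mact A (osec p A α))

lemma gN_opi (t : (ZMod p → α) → A) : (gN p A α (mact A (opi p A α) t) : (ZMod p → α) → A) =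
    (yy p A α ^ (p - 1)) t := by
  change (yy p A α ^ (p - 1)) (mact A (osec p A α) _) = _
  apply nn_of_opi
  rw [← mact_mul, opi_osec, mact_scal, one_smul]

lemma surj_gN : Function.Surjective (gN p A α) := by
  rintro ⟨_, t, rfl⟩
  exact ⟨mact A (opi p A α) t, Subtype.ext (gN_opi p t)⟩

lemma exact_gN : Function.Exact (mact A (cst p A α)) (gN p A α) := by
  intro u
  obtain ⟨t, rfl⟩ := surj_opi p u
  have h0 : gN p A α (mact A (opi p A α) t) = 0 ↔ (yy p A α ^ (p - 1)) t = 0 := by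
    rw [← gN_opi, ZeroMemClass.coe_eq_zero]
  rw [h0]
  constructor
  · intro h
    refine ⟨fun a => mact A (opi p A α) t (Quotient.mk _ (fun _ => a)), ?_⟩
    ext q
    induction q using Quotient.inductionOn with | _ w => ?_
    by_cases hw : IsC p w
    · obtain ⟨a, rfl⟩ := hw
      rw [mact_cst_const]
    · rw [mact_cst_nonconst p _ hw, ← nn_nonconst p t w hw, h]; rfl
  · rintro ⟨v, hv⟩
    ext w
    by_cases hw : IsC p w
    · obtain ⟨a, rfl⟩ := hw
      rw [nn_const]; rfl
    · rw [nn_nonconst p _ _ hw, ← hv, mact_cst_nonconst p _ hw]; rfl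

end Seq
end NIT

end

section
namespace NIT
open CategoryTheory
open scoped Simplicial

section
variable {A : Type u} [CommRing A] (p : ℕ) [Fact p.Prime] [CharP A p] {α β γ : Type}
variable [Fintype α] [Fintype β]

lemma tc_cst (M : Matrix α β A) : tc p M * cst p A β = cst p A α * M.map (frobenius A p) := by
  classical
  ext q a
  set s : (ZMod p → α) → A := fun w => ten (ZMod p) M w (fun _ => a) with hs
  have h1 : (tc p M * cst p A β) q a = mact A (opi p A α) s q := by
    have : (tc p M * cst p A β) q a = tc p M q (Quotient.mk (orel p β) fun _ => a) := by
      simp [Matrix.mul_apply, cst]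
    rw [this]
    have h2 : (tc p M * opi p A β) q (fun _ => a) = tc p M q (Quotient.mk (orel p β) fun _ => a) := by
      simp [Matrix.mul_apply, opi]
    rw [← h2, tc_opi, Matrix.mul_apply, mact_apply]
    rfl
  have h3 : (cst p A α * M.map (frobenius A p)) q a =
      mact A (cst p A α) (fun b => (M b a) ^ p) q := by
    rw [Matrix.mul_apply, mact_apply]
    rfl
  rw [h1, h3]
  induction q using Quotient.inductionOn with | _ w => ?_
  by_cases hw : IsC p w
  · obtain ⟨b, rfl⟩ := hw
    rw [mact_cst_const, mact_opi]
    have : (Finset.univ.filter fun v : ZMod p → α => Quotient.mk (orel p α) v =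
        Quotient.mk (orel p α) fun _ => b) = {fun _ => b} := by
      ext v
      simp only [Finset.mem_filter, Finset.mem_univ, true_and, Finset.mem_singleton]
      exact ⟨fun h => mk_const p h, fun h => by rw [h]⟩
    rw [this, Finset.sum_singleton, hs]
    simp [gten, ZMod.card]
  · rw [mact_cst_nonconst p _ hw, ← nn_nonconst p s w hw, nn_apply]
    have h5 : ∀ b, s (rot b w) = s w := fun b => ten_rot p M b w (fun _ => a)
    simp [h5, ZMod.card]

end

namespace SM
variable {A : Type u} [CommRing A] (p : ℕ) [Fact p.Prime] [CharP A p] (V : SM A)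

/-- differential of the tensor power -/
noncomputable def TD (j : ℕ) : Matrix (ZMod p → V.ι j) (ZMod p → V.ι (j + 1)) A :=
  ∑ i : Fin (j + 2), (-1 : A) ^ (i : ℕ) • ten (ZMod p) (V.d i)
/-- differential of the coinvariants -/
noncomputable def TCD (j : ℕ) : Matrix (Orb p (V.ι j)) (Orb p (V.ι (j + 1))) A :=
  ∑ i : Fin (j + 2), (-1 : A) ^ (i : ℕ) • tc p (V.d i)
/-- differential of the Frobenius twist -/
noncomputable def FD (j : ℕ) : Matrix (V.ι j) (V.ι (j + 1)) A :=
  ∑ i : Fin (j + 2), (-1 : A) ^ (i : ℕ) • (V.d i).map (frobenius A p)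

lemma TDD (j : ℕ) : V.TD p j * V.TD p (j + 1) = 0 := (V.T p).DD j
lemma TCDD (j : ℕ) : V.TCD p j * V.TCD p (j + 1) = 0 := (V.TC p).DD j

lemma yy_D (j : ℕ) (t : (ZMod p → V.ι (j + 1)) → A) :
    yy p A (V.ι j) (mact A (V.TD p j) t) = mact A (V.TD p j) (yy p A (V.ι (j + 1)) t) := by
  have h : ∀ t, sg p A (V.ι j) (mact A (V.TD p j) t) = mact A (V.TD p j) (sg p A (V.ι (j + 1)) t) := by
    intro t
    unfold TD
    rw [mact_sum, mact_sum, map_sum]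
    refine Finset.sum_congr rfl fun i _ => ?_
    rw [mact_smul, mact_smul, map_smul]
    exact congrArg _ (sg_ten p (V.d i) t)
  rw [yy, yy, LinearMap.sub_apply, LinearMap.sub_apply, map_sub, h]
  rfl

lemma yy_pow_D (i j : ℕ) (t : (ZMod p → V.ι (j + 1)) → A) :
    (yy p A (V.ι j) ^ i) (mact A (V.TD p j) t) =
      mact A (V.TD p j) ((yy p A (V.ι (j + 1)) ^ i) t) := by
  induction i generalizing t with
  | zero => rfl
  | succ i ih => rw [pow_succ, pow_succ, Module.End.mul_apply, Module.End.mul_apply, yy_D, ih]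

/-- subcomplex -/
abbrev KX (i j : ℕ) : Type u := LinearMap.range (yy p A (V.ι j) ^ i)

/-- differential of the subcomplex -/
noncomputable def Kd (i j : ℕ) : V.KX p i (j + 1) →ₗ[A] V.KX p i j :=
  (mact A (V.TD p j)).restrict (by
    rintro _ ⟨t, rfl⟩
    exact ⟨mact A (V.TD p j) t, yy_pow_D p V i j t⟩)

lemma Kd_coe (i j : ℕ) (x : V.KX p i (j + 1)) :
    ((V.Kd p i j x : V.KX p i j) : (ZMod p → V.ι j) → A) = mact A (V.TD p j) x := rfl

lemma Kdd (i j : ℕ) (x : V.KX p i (j + 1 + 1)) : V.Kd p i j (V.Kd p i (j + 1) x) = 0 := by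
  apply Subtype.ext
  rw [Kd_coe, Kd_coe]
  exact mdd (V.TDD p) j _

lemma opi_D (j : ℕ) (t : (ZMod p → V.ι (j + 1)) → A) :
    mact A (opi p A (V.ι j)) (mact A (V.TD p j) t) =
      mact A (V.TCD p j) (mact A (opi p A (V.ι (j + 1))) t) := by
  unfold TD TCD
  rw [mact_sum, mact_sum, map_sum]
  refine Finset.sum_congr rfl fun i _ => ?_
  rw [mact_smul, mact_smul, map_smul]
  refine congrArg _ ?_
  refine (mact_mul _ _ _).symm.trans ?_
  refine .trans ?_ (mact_mul _ _ _)
  exact congrArg (fun M => mact A M t) (tc_opi p (V.d i)).symm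

lemma cst_D (j : ℕ) (t : V.ι (j + 1) → A) :
    mact A (cst p A (V.ι j)) (mact A (V.FD p j) t) =
      mact A (V.TCD p j) (mact A (cst p A (V.ι (j + 1))) t) := by
  unfold FD TCD
  rw [mact_sum, mact_sum, map_sum]
  refine Finset.sum_congr rfl fun i _ => ?_
  rw [mact_smul, mact_smul, map_smul]
  refine congrArg _ ?_
  refine (mact_mul _ _ _).symm.trans ?_
  refine .trans ?_ (mact_mul _ _ _)
  exact congrArg (fun M => mact A M t) (tc_cst p (V.d i)).symm

/-- sequence (1) -/
lemma les1 : LES (hl (V.Kd p 1)) (mhl (V.TD p) A) (mhl (V.TCD p) A) := by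
  obtain ⟨r, a, b, e1, e2, e3, e4, -⟩ := les (X₁ := V.KX p 1) (X₂ := fun j => (ZMod p → V.ι j) → A)
    (X₃ := fun j => Orb p (V.ι j) → A) (d₁ := V.Kd p 1) (d₂ := mcx (V.TD p) A)
    (d₃ := mcx (V.TCD p) A)
    (fun j x => mdd (V.TDD p) j x) (fun j => (LinearMap.range (yy p A (V.ι j) ^ 1)).subtype)
    (fun j x => rfl) (fun j => mact A (opi p A (V.ι j))) (fun j x => opi_D p V j x)
    (fun j => Subtype.val_injective) (fun j => exact_opi p) (fun j => surj_opi p)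
  exact LES.of e1 e2 e3 e4

/-- sequence (3) -/
lemma les3 : LES (mhl (V.FD p) A) (mhl (V.TCD p) A) (hl (V.Kd p (p - 1))) := by
  obtain ⟨r, a, b, e1, e2, e3, e4, -⟩ := les (X₁ := fun j => V.ι j → A)
    (X₂ := fun j => Orb p (V.ι j) → A)
    (X₃ := V.KX p (p - 1)) (d₁ := mcx (V.FD p) A) (d₂ := mcx (V.TCD p) A)
    (d₃ := V.Kd p (p - 1))
    (fun j x => mdd (V.TCDD p) j x) (fun j => mact A (cst p A (V.ι j)))
    (fun j x => cst_D p V j x) (fun j => gN p A (V.ι j)) (fun j x => by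
      obtain ⟨t, rfl⟩ := surj_opi p x
      apply Subtype.ext
      rw [Kd_coe]
      refine (congrArg (fun z => (gN p A (V.ι j) z : (ZMod p → V.ι j) → A)) (opi_D p V j t).symm).trans ?_
      refine (gN_opi p _).trans ?_
      rw [yy_pow_D]
      exact congrArg _ (gN_opi p t).symm)
    (fun j => inj_cst p) (fun j => exact_gN p) (fun j => surj_gN p)
  exact LES.of e1 e2 e3 e4

/-- sequence (2) -/
lemma les2 (i : ℕ) (hi : 1 ≤ i) (hip : i ≤ p - 1) :
    LES (hl (V.Kd p (p - 1))) (hl (V.Kd p i)) (hl (V.Kd p (i + 1))) := by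
  have hle : ∀ j, LinearMap.range (yy p A (V.ι j) ^ (p - 1)) ≤ LinearMap.range (yy p A (V.ι j) ^ i) := by
    rintro j _ ⟨t, rfl⟩
    refine ⟨(yy p A (V.ι j) ^ (p - 1 - i)) t, ?_⟩
    rw [← Module.End.mul_apply, ← pow_add, Nat.add_sub_cancel' hip]
  have hy : ∀ j, ∀ x ∈ LinearMap.range (yy p A (V.ι j) ^ i),
      yy p A (V.ι j) x ∈ LinearMap.range (yy p A (V.ι j) ^ (i + 1)) := by
    rintro j _ ⟨t, rfl⟩
    exact ⟨t, by rw [pow_succ', Module.End.mul_apply]⟩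
  have hker : ∀ j (t : (ZMod p → V.ι j) → A),
      yy p A (V.ι j) ((yy p A (V.ι j) ^ (p - 1)) t) = 0 := by
    intro j t
    rw [← Module.End.mul_apply, ← pow_succ', pow_succ, Module.End.mul_apply]
    refine (nn_of_opi p (t' := 0) ?_).trans (map_zero _)
    rw [opi_yy, map_zero]
  obtain ⟨r, a, b, e1, e2, e3, e4, -⟩ := les (X₁ := V.KX p (p - 1))
    (X₂ := V.KX p i) (X₃ := V.KX p (i + 1)) (d₁ := V.Kd p (p - 1)) (d₂ := V.Kd p i)
    (d₃ := V.Kd p (i + 1)) (V.Kdd p i) (fun j => Submodule.inclusion (hle j))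
    (fun j x => rfl) (fun j => (yy p A (V.ι j)).restrict (hy j))
    (fun j x => by
      apply Subtype.ext
      rw [Kd_coe]
      exact yy_D p V j _)
    (fun j => Submodule.inclusion_injective _)
    (fun j x => by
      constructor
      · intro h
        have h1 : yy p A (V.ι j) x.1 = 0 := congrArg Subtype.val h
        have h2 : x.1 ∈ LinearMap.range (yy p A (V.ι j)) := by
          obtain ⟨t, ht⟩ := x.2
          refine ⟨(yy p A (V.ι j) ^ (i - 1)) t, ?_⟩
          rw [← ht, ← Module.End.mul_apply, ← pow_succ', Nat.sub_add_cancel hi]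
        exact ⟨⟨x.1, mem_range_nn p h2 h1⟩, rfl⟩
      · rintro ⟨⟨_, t, rfl⟩, rfl⟩
        exact Subtype.ext (hker j t))
    (fun j => by
      rintro ⟨_, t, rfl⟩
      refine ⟨⟨_, t, rfl⟩, Subtype.ext ?_⟩
      change yy p A (V.ι j) ((yy p A (V.ι j) ^ i) t) = (yy p A (V.ι j) ^ (i + 1)) t
      rw [pow_succ', Module.End.mul_apply])
  exact LES.of e1 e2 e3 e4

theorem chi_frob (hT : HasChi (mhl (V.T p).D A) 0) (hTC : HasChi (mhl (V.TC p).D A) 0) {c : ℤ}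
    (h : HasChi (mhl (V.bc (frobenius A p)).D A) c) : c = 0 := by
  have hp : 2 ≤ p := Nat.Prime.two_le Fact.out
  have hT : HasChi (mhl (V.TD p) A) 0 := hT
  have hTC : HasChi (mhl (V.TCD p) A) 0 := hTC
  have h : HasChi (mhl (V.FD p) A) c := h
  have h3 := (les3 p V).chi3 h hTC
  have h2 : ∀ k : ℕ, k + 2 ≤ p → HasChi (hl (V.Kd p (p - 1 - k))) ((k + 1) * (0 - c)) := by
    intro k
    induction k with
    | zero => intro _; simpa using h3
    | succ k ih =>
      intro hk
      have := (les2 p V (p - 1 - (k + 1)) (by omega) (by omega)).chi2 h3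
        (by rw [show p - 1 - (k + 1) + 1 = p - 1 - k by omega]; exact ih (by omega))
      convert this using 1
      push_cast; ring
  have h4 := h2 (p - 2) (by omega)
  rw [show p - 1 - (p - 2) = 1 by omega] at h4
  have h5 := ((les1 p V).chi2 h4 hTC).unique hT
  rw [add_zero, mul_eq_zero] at h5
  rcases h5 with h5 | h5
  · exfalso; omega
  · omega

end SM
end NIT

end

section
namespace NIT
open CategoryTheory Opposite AlgebraicTopology
open scoped Simplicial


section Gam
variable {R : Type u} [CommRing R]

/-- coboundary -/
def dl {M : Type u} [AddCommGroup M] {a : SimplexCategory} {j : ℕ} (z : (⦋j⦌ ⟶ a) → M) :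
    (⦋j + 1⦌ ⟶ a) → M := fun f => ∑ k : Fin (j + 2), (-1 : ℤ) ^ (k : ℕ) • z (SimplexCategory.δ k ≫ f)

/-- cosimplicial module -/
def cosob (M : Type u) [AddCommGroup M] (a : SimplexCategory) : CosimplicialObject (ModuleCat.{u} ℤ) where
  obj b := ModuleCat.of ℤ ((b ⟶ a) → M)
  map {b c} f := ModuleCat.ofHom
    { toFun := fun (z : (b ⟶ a) → M) (g : c ⟶ a) => z (f ≫ g)
      map_add' := fun _ _ => rfl
      map_smul' := fun _ _ => rfl }
  map_id b := by
    refine ModuleCat.hom_ext (LinearMap.ext fun z => funext fun g => ?_)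
    simp
  map_comp f g := by
    refine ModuleCat.hom_ext (LinearMap.ext fun z => funext fun g => ?_)
    simp

lemma cosob_objD {M : Type u} [AddCommGroup M] {a : SimplexCategory} {j : ℕ} (z : (⦋j⦌ ⟶ a) → M) :
    (AlternatingCofaceMapComplex.objD (cosob M a) j).hom z = dl z := by
  rw [AlternatingCofaceMapComplex.objD]
  refine (congrArg (fun f : ((⦋j⦌ ⟶ a) → M) →ₗ[ℤ] ((⦋j + 1⦌ ⟶ a) → M) => f z)
    (ModuleCat.hom_sum (M := ModuleCat.of ℤ ((⦋j⦌ ⟶ a) → M)) 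
    (N := ModuleCat.of ℤ ((⦋j + 1⦌ ⟶ a) → M)) _ _)).trans ?_
  refine (LinearMap.sum_apply _ _ _).trans ?_
  funext f
  refine (Finset.sum_apply _ _ _).trans ?_
  rfl

lemma dl_dl {M : Type u} [AddCommGroup M] {a : SimplexCategory} {j : ℕ} (z : (⦋j⦌ ⟶ a) → M) :
    dl (dl z) = 0 := by
  rw [← cosob_objD, ← cosob_objD]
  have := AlternatingCofaceMapComplex.d_squared (cosob M a) j
  exact congrArg (fun f => f.hom z) this

lemma dl_deg {M : Type u} [AddCommGroup M] {a : SimplexCategory} {j : ℕ} (z : (⦋j⦌ ⟶ a) → M)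
    (hz : ∀ f, ¬ Function.Injective f.toOrderHom → z f = 0) (f : ⦋j + 1⦌ ⟶ a)
    (hf : ¬ Function.Injective f.toOrderHom) : dl z f = 0 := by
  obtain ⟨i, g, rfl⟩ := SimplexCategory.eq_σ_comp_of_not_injective f hf
  rw [dl, Finset.sum_eq_add i.castSucc i.succ]
  · rw [SimplexCategory.δ_comp_σ_self_assoc, SimplexCategory.δ_comp_σ_succ_assoc]
    simp [pow_succ]
  · exact Fin.castSucc_lt_succ.ne
  · intro c _ hc
    rw [hz, smul_zero]
    intro hinj
    obtain ⟨x, hx⟩ := Fin.exists_succAbove_eq hc.1.symm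
    obtain ⟨y, hy⟩ := Fin.exists_succAbove_eq hc.2.symm
    have := @hinj x y (by
      have h1 : (SimplexCategory.δ c).toOrderHom x = i.castSucc := hx
      have h2 : (SimplexCategory.δ c).toOrderHom y = i.succ := hy
      simp only [SimplexCategory.comp_toOrderHom, OrderHom.comp_coe, Function.comp_apply, h1, h2]
      congr 1
      change i.predAbove i.castSucc = i.predAbove i.succ
      simp)
    subst this
    exact Fin.castSucc_lt_succ.ne (hx.symm.trans hy)
  · simp
  · simp

variable (F : ℕ → Type u) [∀ j, AddCommGroup (F j)] [∀ j, Module R (F j)]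
  (del : ∀ j, F (j + 1) →ₗ[R] F j)

lemma dl_add {M : Type u} [AddCommGroup M] {a : SimplexCategory} {j : ℕ} (z w : (⦋j⦌ ⟶ a) → M) :
    dl (z + w) = dl z + dl w := by
  funext f; simp [dl, Finset.sum_add_distrib]

lemma dl_smul {M : Type u} [AddCommGroup M] [Module R M] {a : SimplexCategory} {j : ℕ} (r : R)
    (z : (⦋j⦌ ⟶ a) → M) :
    dl (r • z) = r • dl z := by
  funext f; simp [dl, Finset.smul_sum, smul_comm r]

lemma dl_map {M M' : Type u} [AddCommGroup M] [Module R M] [AddCommGroup M'] [Module R M']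
    (g : M →ₗ[R] M') {a : SimplexCategory} {j : ℕ}
    (z : (⦋j⦌ ⟶ a) → M) (f) : dl (fun f => g (z f)) f = g (dl z f) := by
  simp [dl, map_sum]

/-- the simplicial module -/
def VV (a : SimplexCategory) : Submodule R (∀ j, (⦋j⦌ ⟶ a) → F j) where
  carrier := {z | (∀ j f, ¬ Function.Injective f.toOrderHom → z j f = 0) ∧
    ∀ j f, del j (z (j + 1) f) = dl (z j) f}
  add_mem' {z w} hz hw := ⟨fun j f hf => by simp [hz.1 j f hf, hw.1 j f hf], fun j f => by
    change del j (z (j + 1) f + w (j + 1) f) = dl (z j + w j) f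
    rw [map_add, hz.2, hw.2, dl_add, Pi.add_apply]⟩
  zero_mem' := ⟨fun j f hf => rfl, fun j f => by simp [dl]⟩
  smul_mem' r z hz := ⟨fun j f hf => by simp [hz.1 j f hf], fun j f => by
    change del j (r • z (j + 1) f) = dl (r • z j) f
    rw [map_smul, hz.2, dl_smul, Pi.smul_apply]⟩

variable {F}

/-- functoriality -/
def pull {a b : SimplexCategory} (α : a ⟶ b) : VV F del b →ₗ[R] VV F del a where
  toFun z := ⟨fun j f => z.1 j (f ≫ α), fun j f hf => z.2.1 j _ fun h => hf (by
      rw [SimplexCategory.comp_toOrderHom] at h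
      exact Function.Injective.of_comp h), fun j f => by
      rw [z.2.2]
      simp [dl]⟩
  map_add' _ _ := rfl
  map_smul' _ _ := rfl

lemma pull_apply {a b : SimplexCategory} (α : a ⟶ b) (z : VV F del b) (j : ℕ) (f : ⦋j⦌ ⟶ a) :
    (pull del α z).1 j f = z.1 j (f ≫ α) := rfl

lemma pull_comp {a b c : SimplexCategory} (α : a ⟶ b) (β : b ⟶ c) :
    pull del (α ≫ β) = pull del α ∘ₗ pull del β := by
  ext z : 2
  funext j f
  simp [pull_apply]

lemma pull_id (a : SimplexCategory) : pull del (𝟙 a) = LinearMap.id := by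
  ext z : 2
  funext j f
  simp [pull_apply]

lemma VV.ext {a : SimplexCategory} {z w : VV F del a} (h : ∀ j f, z.1 j f = w.1 j f) : z = w :=
  Subtype.ext (funext fun j => funext fun f => h j f)

lemma inj0 {n : SimplexCategory} (f : ⦋0⦌ ⟶ n) : Function.Injective f.toOrderHom := by
  intro x y _
  exact @Subsingleton.elim (Fin 1) _ x y

/-- cone -/
def cons {j n : ℕ} (f : ⦋j⦌ ⟶ ⦋n⦌) : ⦋j + 1⦌ ⟶ ⦋n⦌ := SimplexCategory.Hom.mk
  ⟨(Fin.cons (0 : Fin (n + 1)) f.toOrderHom : Fin (j + 1 + 1) → Fin (n + 1)), by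
    intro x y hxy
    induction x using Fin.cases with
    | zero => simp
    | succ x =>
      induction y using Fin.cases with
      | zero => simp at hxy
      | succ y =>
        simp only [Fin.cons_succ]
        exact f.toOrderHom.monotone (by simpa using hxy)⟩

lemma cons_succ {j n : ℕ} (f : ⦋j⦌ ⟶ ⦋n⦌) (x : Fin (j + 1)) :
    (cons f).toOrderHom x.succ = f.toOrderHom x := rfl

lemma cons_zero {j n : ℕ} (f : ⦋j⦌ ⟶ ⦋n⦌) :
    (cons f).toOrderHom (0 : Fin (j + 2)) = (0 : Fin (n + 1)) := rfl

lemma δ_zero_cons {j n : ℕ} (f : ⦋j⦌ ⟶ ⦋n⦌) : SimplexCategory.δ 0 ≫ cons f = f := by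
  ext x : 3
  rfl

lemma δ_succ_cons {j n : ℕ} (f : ⦋j + 1⦌ ⟶ ⦋n⦌) (k : Fin (j + 2)) :
    SimplexCategory.δ k.succ ≫ cons f = cons (SimplexCategory.δ k ≫ f) := by
  ext x : 3
  change (cons f).toOrderHom (k.succ.succAbove x) = _
  induction x using Fin.cases with
  | zero => 
    rw [Fin.succ_succAbove_zero]
    rfl
  | succ x =>
    rw [Fin.succ_succAbove_succ]
    rfl

lemma cons_deg {j n : ℕ} (f : ⦋j⦌ ⟶ ⦋n⦌) (hf : ¬ Function.Injective f.toOrderHom) :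
    ¬ Function.Injective (cons f).toOrderHom := fun h => hf fun x y hxy =>
  Fin.succ_injective _ (h (a₁ := Fin.succ x) (a₂ := Fin.succ y) hxy)

/-- constant zero -/
def c0 (n : ℕ) : ⦋0⦌ ⟶ ⦋n⦌ := SimplexCategory.Hom.mk ⟨fun _ => (0 : Fin (n + 1)), fun _ _ _ => le_rfl⟩

lemma δ_one_cons {n : ℕ} (f : ⦋0⦌ ⟶ ⦋n⦌) : SimplexCategory.δ 1 ≫ cons f = c0 n := by
  ext x : 3
  have : x = 0 := @Subsingleton.elim (Fin 1) _ x 0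
  subst this
  rfl

open Classical in
/-- the retraction, raw -/
noncomputable def rdeg {n : ℕ} (z : ∀ j, (⦋j⦌ ⟶ ⦋n⦌) → F j) : ∀ j, (⦋j⦌ ⟶ ⦋n⦌) → F j :=
  fun j f => if Function.Injective f.toOrderHom then z j f else 0

/-- the retraction, raw -/
noncomputable def rraw {n : ℕ} (z : ∀ j, (⦋j⦌ ⟶ ⦋n⦌) → F j) (j : ℕ) : (⦋j⦌ ⟶ ⦋n⦌) → F j :=
  match j with
  | 0 => fun f => del 0 (z 1 (cons f)) + z 0 (c0 n)
  | j + 1 => fun f => del (j + 1) (z (j + 2) (cons f)) + dl (fun g => z (j + 1) (cons g)) f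

lemma rraw_mem (dd : ∀ j x, del j (del (j + 1) x) = 0) {n : ℕ} (z : ∀ j, (⦋j⦌ ⟶ ⦋n⦌) → F j)
    (hz : ∀ j f, ¬ Function.Injective f.toOrderHom → z j f = 0) : rraw del z ∈ VV F del ⦋n⦌ := by
  constructor
  · intro j f hf
    cases j with
    | zero => exact absurd (inj0 f) hf
    | succ j =>
      simp only [rraw]
      rw [hz _ _ (cons_deg f hf), map_zero, zero_add]
      exact dl_deg _ (fun g hg => hz _ _ (cons_deg g hg)) f hf
  · intro j f
    cases j with
    | zero =>
      simp only [rraw, map_add, dd, zero_add]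
      rw [← dl_map]
      simp [dl, Fin.sum_univ_two]
      abel
    | succ j =>
      simp only [rraw, map_add, dd, zero_add]
      rw [← dl_map]
      have := congrFun (dl_dl (fun g : ⦋j⦌ ⟶ ⦋n⦌ => z (j + 1) (cons g))) f
      exact ((congrFun (dl_add (fun f => del (j + 1) (z (j + 2) (cons f)))
        (dl (fun g => z (j + 1) (cons g)))) f).trans (by rw [Pi.add_apply, this]; simp)).symm

lemma rraw_eq {n : ℕ} (z : VV F del ⦋n⦌) : rraw del z.1 = z.1 := by
  funext j f
  cases j with
  | zero =>
    simp only [rraw]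
    rw [z.2.2, dl, Fin.sum_univ_two, δ_zero_cons, δ_one_cons]
    simp
  | succ j =>
    simp only [rraw]
    rw [z.2.2, dl, Fin.sum_univ_succ, δ_zero_cons]
    simp [dl, δ_succ_cons, pow_succ]

/-- the retraction -/
noncomputable def retr (dd : ∀ j x, del j (del (j + 1) x) = 0) (n : ℕ) :
    (∀ j, (⦋j⦌ ⟶ ⦋n⦌) → F j) →ₗ[R] VV F del ⦋n⦌ where
  toFun z := ⟨rraw del (rdeg z), rraw_mem del dd _ fun j f hf => by simp [rdeg, hf]⟩
  map_add' z w := by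
    apply VV.ext
    intro j f
    have : rdeg (z + w) = rdeg z + rdeg w := by
      funext j f; by_cases h : Function.Injective f.toOrderHom <;> simp [rdeg, h]
    cases j with
    | zero => simp [rraw, this]; abel
    | succ j => 
      simp only [rraw, this, Submodule.coe_add, Pi.add_apply, map_add]
      have := congrFun (dl_add (fun g => rdeg z (j + 1) (cons g)) (fun g => rdeg w (j + 1) (cons g))) f
      rw [Pi.add_apply] at this
      rw [add_add_add_comm, ← this]
      rfl
  map_smul' r z := by
    apply VV.ext
    intro j f
    have : rdeg (r • z) = r • rdeg z := by
      funext j f; by_cases h : Function.Injective f.toOrderHom <;> simp [rdeg, h]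
    cases j with
    | zero => simp [rraw, this]
    | succ j => 
      simp only [rraw, this, Submodule.coe_smul, Pi.smul_apply, map_smul, RingHom.id_apply, smul_add]
      have := congrFun (dl_smul r (fun g => rdeg z (j + 1) (cons g))) f
      rw [Pi.smul_apply] at this
      rw [← this]
      rfl

lemma retr_eq (dd : ∀ j x, del j (del (j + 1) x) = 0) (n : ℕ) (z : VV F del ⦋n⦌) :
    retr del dd n z.1 = z := by
  refine (Subtype.ext ?_ : retr del dd n z.1 = z)
  have : rdeg z.1 = z.1 := by
    funext j f
    by_cases h : Function.Injective f.toOrderHom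
    · simp [rdeg, h]
    · simp [rdeg, h, z.2.1 j f h]
  change rraw del (rdeg z.1) = z.1
  rw [this, rraw_eq]

variable (sh : ∀ j, F j →ₗ[R] F (j + 1))

/-- evaluation -/
def ev {j k : ℕ} (f : ⦋j⦌ ⟶ ⦋k⦌) (x : Fin (j + 1)) : Fin (k + 1) := f.toOrderHom x

lemma ev_comp {j k l : ℕ} (f : ⦋j⦌ ⟶ ⦋k⦌) (g : ⦋k⦌ ⟶ ⦋l⦌) (x : Fin (j + 1)) :
    ev (f ≫ g) x = ev g (ev f x) := rfl

lemma ev_δ {j : ℕ} (i : Fin (j + 2)) (x : Fin (j + 1)) :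
    ev (SimplexCategory.δ i) x = i.succAbove x := rfl

lemma ev_σ {j : ℕ} (i : Fin (j + 1)) (x : Fin (j + 2)) :
    ev (SimplexCategory.σ i) x = i.predAbove x := rfl

lemma ev_mono {j k : ℕ} (f : ⦋j⦌ ⟶ ⦋k⦌) : Monotone (ev f) := f.toOrderHom.monotone

lemma ev_ext {j k : ℕ} {f g : ⦋j⦌ ⟶ ⦋k⦌} (h : ∀ x, ev f x = ev g x) : f = g := by
  ext x : 3
  exact h x

lemma eq_tl {j k : ℕ} (f : ⦋j⦌ ⟶ ⦋k + 1⦌) (hf : ev f 0 ≠ 0) :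
    (f ≫ SimplexCategory.σ 0) ≫ SimplexCategory.δ 0 = f := by
  apply ev_ext
  intro x
  have : ev f x ≠ 0 := fun h => hf (le_antisymm (h ▸ ev_mono f (Fin.zero_le x)) (Fin.zero_le _))
  obtain ⟨y, hy⟩ := Fin.exists_succ_eq.2 this
  rw [ev_comp, ev_comp, ev_δ, ev_σ, ← hy]
  simp

variable (x : R)

/-- the contraction -/
noncomputable def hraw {k : ℕ} (y : ∀ j, (⦋j⦌ ⟶ ⦋k⦌) → F j) (j : ℕ) (f : ⦋j⦌ ⟶ ⦋k + 1⦌) : F j :=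
  match j with
  | 0 => if ev f 0 = 0 then 0 else x • y 0 (f ≫ SimplexCategory.σ 0)
  | j + 1 => if ev f 0 = 0 then
      if ev f 1 = 0 then 0 else sh j (y j (SimplexCategory.δ 0 ≫ f ≫ SimplexCategory.σ 0))
    else x • y (j + 1) (f ≫ SimplexCategory.σ 0)

lemma hraw_ne {k : ℕ} (y : ∀ j, (⦋j⦌ ⟶ ⦋k⦌) → F j) {j : ℕ} (f : ⦋j⦌ ⟶ ⦋k + 1⦌) (hf : ev f 0 ≠ 0) :
    hraw sh x y j f = x • y j (f ≫ SimplexCategory.σ 0) := by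
  cases j <;> simp [hraw, hf]

lemma hraw_zero {k : ℕ} (y : ∀ j, (⦋j⦌ ⟶ ⦋k⦌) → F j) (f : ⦋0⦌ ⟶ ⦋k + 1⦌) (hf : ev f 0 = 0) :
    hraw sh x y 0 f = 0 := by
  simp [hraw, hf]

lemma hraw_succ {k : ℕ} (y : ∀ j, (⦋j⦌ ⟶ ⦋k⦌) → F j) {j : ℕ} (f : ⦋j + 1⦌ ⟶ ⦋k + 1⦌)
    (hf : ev f 0 = 0) (hf' : ev f 1 ≠ 0) :
    hraw sh x y (j + 1) f = sh j (y j (SimplexCategory.δ 0 ≫ f ≫ SimplexCategory.σ 0)) := by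
  simp [hraw, hf, hf']

lemma hraw_succ' {k : ℕ} (y : ∀ j, (⦋j⦌ ⟶ ⦋k⦌) → F j) {j : ℕ} (f : ⦋j + 1⦌ ⟶ ⦋k + 1⦌)
    (hf : ev f 0 = 0) (hf' : ev f 1 = 0) : hraw sh x y (j + 1) f = 0 := by
  simp [hraw, hf, hf']

lemma not_inj_tl {j k : ℕ} (f : ⦋j⦌ ⟶ ⦋k + 1⦌) (hf : ev f 0 ≠ 0)
    (hinj : ¬ Function.Injective f.toOrderHom) :
    ¬ Function.Injective (f ≫ SimplexCategory.σ 0).toOrderHom := by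
  intro h
  apply hinj
  rw [← eq_tl f hf, SimplexCategory.comp_toOrderHom]
  exact (Fin.succAbove_right_injective (p := 0)).comp h

lemma hraw_deg {k : ℕ} (y : VV F del ⦋k⦌) {j : ℕ} (f : ⦋j⦌ ⟶ ⦋k + 1⦌)
    (hinj : ¬ Function.Injective f.toOrderHom) : hraw sh x y.1 j f = 0 := by
  by_cases hf : ev f 0 = 0
  · cases j with
    | zero => exact hraw_zero _ _ _ _ hf
    | succ j =>
      by_cases hf' : ev f 1 = 0
      · exact hraw_succ' _ _ _ _ hf hf'
      · rw [hraw_succ _ _ _ _ hf hf', y.2.1, map_zero]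
        rw [← Category.assoc]
        refine not_inj_tl _ (by simpa [ev_comp, ev_δ] using hf') fun h => hinj ?_
        intro a b hab
        change Fin (j + 2) at a b
        change ev f a = ev f b at hab
        have key : ∀ a : Fin (j + 1), ev f a.succ ≠ 0 := fun a h => hf' (le_antisymm
          (h ▸ ev_mono f (by simp [Fin.le_def])) (Fin.zero_le _))
        induction a using Fin.cases with
        | zero =>
          induction b using Fin.cases with
          | zero => rfl
          | succ b => exact absurd (hab.symm.trans hf) (key b)
        | succ a =>
          induction b using Fin.cases with
          | zero => exact absurd (hab.trans hf) (key a)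
          | succ b => exact congrArg Fin.succ (@h a b hab)
  · rw [hraw_ne _ _ _ _ hf, y.2.1 _ _ (not_inj_tl f hf hinj), smul_zero]

variable (hs0 : ∀ y, del 0 (sh 0 y) = x • y)
  (hs : ∀ j y, sh j (del j y) + del (j + 1) (sh (j + 1) y) = x • y)

include hs0 hs in
lemma hraw_mem {k : ℕ} (y : VV F del ⦋k⦌) : hraw sh x y.1 ∈ VV F del ⦋k + 1⦌ := by
  refine ⟨fun j f hf => hraw_deg del sh x y f hf, fun j f => ?_⟩
  by_cases hinj : Function.Injective f.toOrderHom
  swap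
  · rw [hraw_deg del sh x y f hinj, dl_deg _ (fun g hg => hraw_deg del sh x y g hg) f hinj, map_zero]
  by_cases hf : ev f 0 = 0
  · have key : ∀ a : Fin (j + 1), ev f a.succ ≠ 0 := fun a h => by
      have := hinj (a₁ := a.succ) (a₂ := (0 : Fin (j + 2))) (h.trans hf.symm)
      simp at this
    rw [hraw_succ _ _ _ _ hf (key 0), dl, Fin.sum_univ_succ, hraw_ne _ _ _ _ (by
      rw [ev_comp, ev_δ]; exact key 0)]
    cases j with
    | zero =>
      rw [Fin.sum_univ_one, hraw_zero, hs0]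
      · simp
      · rw [ev_comp, ev_δ]; simpa using hf
    | succ j =>
      have : ∀ i : Fin (j + 2), hraw sh x y.1 (j + 1) (SimplexCategory.δ i.succ ≫ f) =
          sh j (y.1 j (SimplexCategory.δ i ≫ SimplexCategory.δ 0 ≫ f ≫ SimplexCategory.σ 0)) := by
        intro i
        rw [hraw_succ]
        · have h3 := SimplexCategory.δ_comp_δ (i := 0) (j := i) (Fin.zero_le _)
          rw [Category.assoc, ← Category.assoc, h3, Category.assoc]
          rfl
        · rw [ev_comp, ev_δ]; simpa using hf
        · rw [ev_comp, ev_δ, ← Fin.succ_zero_eq_one, Fin.succ_succAbove_succ]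
          exact key _
      simp only [this]
      have h2 := hs j (y.1 (j + 1) (SimplexCategory.δ 0 ≫ f ≫ SimplexCategory.σ 0))
      rw [y.2.2, ← dl_map, ← eq_sub_iff_add_eq'] at h2
      rw [h2]
      simp [dl, pow_succ, sub_eq_add_neg]
  · have : ∀ i : Fin (j + 2), hraw sh x y.1 j (SimplexCategory.δ i ≫ f) =
        x • y.1 j (SimplexCategory.δ i ≫ f ≫ SimplexCategory.σ 0) := by
      intro i
      rw [hraw_ne, Category.assoc]
      rw [ev_comp]
      exact fun h => hf (le_antisymm (h ▸ ev_mono f (Fin.zero_le _)) (Fin.zero_le _))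
    rw [hraw_ne _ _ _ _ hf, map_smul, y.2.2]
    simp only [dl, this, Finset.smul_sum]
    exact Finset.sum_congr rfl fun i _ => smul_comm _ _ _

/-- the contraction -/
noncomputable def hcon (k : ℕ) : VV F del ⦋k⦌ →ₗ[R] VV F del ⦋k + 1⦌ where
  toFun y := ⟨hraw sh x y.1, hraw_mem del sh x hs0 hs y⟩
  map_add' y w := by
    apply VV.ext
    intro j f
    change hraw sh x (y.1 + w.1) j f = hraw sh x y.1 j f + hraw sh x w.1 j f
    cases j <;> (simp only [hraw]; split_ifs <;> simp)
  map_smul' r y := by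
    apply VV.ext
    intro j f
    change hraw sh x (r • y.1) j f = r • hraw sh x y.1 j f
    cases j <;> (simp only [hraw]; split_ifs <;> simp [smul_comm r])

lemma hcon_zero (k : ℕ) : pull del (SimplexCategory.δ 0) ∘ₗ hcon del sh x hs0 hs k = x • LinearMap.id := by
  ext y : 1
  apply VV.ext
  intro j f
  change hraw sh x y.1 j (f ≫ SimplexCategory.δ 0) = x • y.1 j f
  rw [hraw_ne _ _ _ _ (by rw [ev_comp, ev_δ]; simp), Category.assoc]
  have : SimplexCategory.δ 0 ≫ SimplexCategory.σ (0 : Fin (k + 1)) = 𝟙 _ := SimplexCategory.δ_comp_σ_self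
  rw [this, Category.comp_id]

lemma hcon_one : pull del (SimplexCategory.δ 1) ∘ₗ hcon del sh x hs0 hs 0 = 0 := by
  ext y : 1
  apply VV.ext
  intro j f
  change hraw sh x y.1 j (f ≫ SimplexCategory.δ 1) = 0
  have : ∀ a, ev (f ≫ SimplexCategory.δ 1) a = 0 := by
    intro a
    rw [ev_comp, @Subsingleton.elim (Fin 1) _ (ev f a) 0, ev_δ]
    simp
  cases j with
  | zero => rw [hraw_zero _ _ _ _ (this _)]
  | succ j => rw [hraw_succ' _ _ _ _ (this _) (this _)]

lemma tl_comp {j k : ℕ} (i : Fin (k + 2)) (f : ⦋j⦌ ⟶ ⦋k + 1⦌) (hf : ev f 0 ≠ 0) :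
    (f ≫ SimplexCategory.δ i.succ) ≫ SimplexCategory.σ 0 =
      (f ≫ SimplexCategory.σ 0) ≫ SimplexCategory.δ i := by
  nth_rewrite 1 [← eq_tl f hf]
  apply ev_ext
  intro a
  simp only [ev_comp]
  generalize ev (SimplexCategory.σ 0) (ev f a) = b
  simp only [ev_δ, ev_σ]
  rw [Fin.succAbove_zero, Fin.succ_succAbove_succ, Fin.predAbove_zero_succ]

lemma hcon_succ (k : ℕ) (i : Fin (k + 2)) :
    pull del (SimplexCategory.δ i.succ) ∘ₗ hcon del sh x hs0 hs (k + 1) =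
      hcon del sh x hs0 hs k ∘ₗ pull del (SimplexCategory.δ i) := by
  ext y : 1
  apply VV.ext
  intro j f
  change hraw sh x y.1 j (f ≫ SimplexCategory.δ i.succ) =
    hraw sh x (fun j f => y.1 j (f ≫ SimplexCategory.δ i)) j f
  have key : ∀ a, ev (f ≫ SimplexCategory.δ i.succ) a = 0 ↔ ev f a = 0 := by
    intro a
    rw [ev_comp, ev_δ]
    constructor
    · intro h
      by_contra h0
      obtain ⟨y, hy⟩ := Fin.exists_succ_eq.2 h0
      rw [← hy, Fin.succ_succAbove_succ] at h
      simp at h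
    · intro h; rw [h]; simp
  by_cases hf : ev f 0 = 0
  · cases j with
    | zero => rw [hraw_zero _ _ _ _ hf, hraw_zero _ _ _ _ ((key _).2 hf)]
    | succ j =>
      by_cases hf' : ev f 1 = 0
      · rw [hraw_succ' _ _ _ _ hf hf', hraw_succ' _ _ _ _ ((key _).2 hf) ((key _).2 hf')]
      · rw [hraw_succ _ _ _ _ hf hf', hraw_succ _ _ _ _ ((key _).2 hf) (fun h => hf' ((key _).1 h))]
        rw [← Category.assoc, ← Category.assoc, tl_comp]
        · simp
        · rw [ev_comp, ev_δ]; simpa using hf'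
  · rw [hraw_ne _ _ _ _ hf, hraw_ne _ _ _ _ (fun h => hf ((key _).1 h)), tl_comp _ _ hf]

lemma eq_zero_of_pull {k : ℕ} [Subsingleton (F (k + 1))] (y : VV F del ⦋k + 1⦌)
    (hy : ∀ i : Fin (k + 1), pull del (SimplexCategory.δ i.succ) y = 0) : y = 0 := by
  have hy' : ∀ (i : Fin (k + 1)) j (f : ⦋j⦌ ⟶ ⦋k⦌), y.1 j (f ≫ SimplexCategory.δ i.succ) = 0 := by
    intro i j f
    rw [← pull_apply, hy]; rfl
  have h0 : pull del (SimplexCategory.δ 0) y = 0 := by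
    apply VV.ext
    intro j g
    rw [pull_apply]
    change _ = 0
    by_cases hi : Function.Injective g.toOrderHom
    swap
    · rw [← pull_apply]
      exact (pull del _ y).2.1 _ _ hi
    by_cases hsu : Function.Surjective g.toOrderHom
    · have hjk : j = k := by
        have := Fintype.card_of_bijective ⟨hi, hsu⟩
        simpa using this
      subst hjk
      have : g = 𝟙 _ := by
        have : Mono g := SimplexCategory.mono_iff_injective.2 hi
        exact SimplexCategory.eq_id_of_mono g
      subst this
      have h3 := y.2.2 j (𝟙 _)
      rw [Subsingleton.elim (y.1 (j + 1) _) 0, map_zero, dl, Fin.sum_univ_succ] at h3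
      have h4 : ∀ i : Fin (j + 1), y.1 j (SimplexCategory.δ i.succ ≫ 𝟙 _) = 0 := by
        intro i
        have := hy' i j (𝟙 _)
        simpa using this
      simp only [h4, smul_zero, Finset.sum_const_zero, add_zero] at h3
      rw [Category.id_comp]
      simpa using h3.symm
    · cases k with
      | zero =>
        exfalso
        apply hsu
        intro b
        exact ⟨(0 : Fin (j + 1)), @Subsingleton.elim (Fin 1) _ _ _⟩
      | succ k =>
        obtain ⟨i, g', rfl⟩ := SimplexCategory.eq_comp_δ_of_not_surjective g hsu
        have h3 := SimplexCategory.δ_comp_δ (i := 0) (j := i) (Fin.zero_le _)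
        have h3 : SimplexCategory.δ i ≫ SimplexCategory.δ 0 =
          SimplexCategory.δ 0 ≫ SimplexCategory.δ i.succ := h3.symm
        rw [Category.assoc, h3, ← Category.assoc, hy']
  have hall : ∀ i : Fin (k + 2), pull del (SimplexCategory.δ i) y = 0 := by
    intro i
    induction i using Fin.cases with
    | zero => exact h0
    | succ i => exact hy i
  apply VV.ext
  intro j f
  change _ = 0
  by_cases hi : Function.Injective f.toOrderHom
  swap
  · exact y.2.1 _ _ hi
  by_cases hsu : Function.Surjective f.toOrderHom
  · have hjk : j = k + 1 := by
      have := Fintype.card_of_bijective ⟨hi, hsu⟩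
      simpa using this
    subst hjk
    exact Subsingleton.elim _ _
  · obtain ⟨i, g, rfl⟩ := SimplexCategory.eq_comp_δ_of_not_surjective f hsu
    rw [← pull_apply, hall]
    rfl

lemma exists_G {k : ℕ} (m : ℕ) (hm : m ≤ k + 1) : ∃ G : Fin (k + 1) → (VV F del ⦋k + 1⦌ →ₗ[R] VV F del ⦋k⦌),
    ∀ i : Fin (k + 1), k + 1 ≤ i + m → ∀ y,
      pull del (SimplexCategory.δ i.succ) (y - ∑ l, pull del (SimplexCategory.σ l) (G l y)) = 0 := by
  induction m with
  | zero =>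
    exact ⟨0, fun i hi => by have := i.2; omega⟩
  | succ m ih =>
    obtain ⟨G, hG⟩ := ih (by omega)
    let i0 : Fin (k + 1) := ⟨k - m, by omega⟩
    let Q : VV F del ⦋k + 1⦌ →ₗ[R] VV F del ⦋k + 1⦌ :=
      LinearMap.id - ∑ l, pull del (SimplexCategory.σ l) ∘ₗ G l
    have hQ : ∀ y, Q y = y - ∑ l, pull del (SimplexCategory.σ l) (G l y) := by
      intro y; simp [Q]
    let G' : Fin (k + 1) → (VV F del ⦋k + 1⦌ →ₗ[R] VV F del ⦋k⦌) := fun l =>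
      G l + if l = i0 then pull del (SimplexCategory.δ i0.succ) ∘ₗ Q else 0
    refine ⟨G', fun i hi y => ?_⟩
    have e : y - ∑ l, pull del (SimplexCategory.σ l)
        (G' l y) =
        Q y - pull del (SimplexCategory.σ i0) (pull del (SimplexCategory.δ i0.succ) (Q y)) := by
      have : ∀ l, pull del (SimplexCategory.σ l)
        (G' l y) =
        pull del (SimplexCategory.σ l) (G l y) + (if l = i0 then 
          pull del (SimplexCategory.σ i0) (pull del (SimplexCategory.δ i0.succ) (Q y)) else 0) := by
        intro l
        by_cases h : l = i0
        · subst h; simp [G']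
        · simp [G', h]
      simp only [this, Finset.sum_add_distrib, Finset.sum_ite_eq', Finset.mem_univ, if_true]
      rw [hQ, sub_sub]
    rw [e, map_sub]
    by_cases hii : i = i0
    · subst hii
      have : ∀ z, pull del (SimplexCategory.δ i0.succ) (pull del (SimplexCategory.σ i0) z) = z := by
        intro z
        rw [← LinearMap.comp_apply, ← pull_comp, SimplexCategory.δ_comp_σ_succ, pull_id]; rfl
      rw [this, sub_self]
    · have hlt : i0 < i := by
        have : (i : ℕ) ≠ k - m := fun h => hii (Fin.ext h)
        rw [Fin.lt_def]
        change k - m < i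
        omega
      have h1 := hG i (by have : k - m < (i : ℕ) := hlt
                          omega) y
      rw [← hQ] at h1
      rw [h1, zero_sub, neg_eq_zero]
      rw [← LinearMap.comp_apply, ← LinearMap.comp_apply, ← pull_comp, ← pull_comp]
      cases k with
      | zero => 
        exact absurd hlt (by rw [@Subsingleton.elim (Fin 1) _ i i0]; exact lt_irrefl _)
      | succ k =>
        have e1 := SimplexCategory.δ_comp_σ_of_gt' (i := i.succ) (j := i0) (by simpa using hlt)
        have e2 : ∃ i1 : Fin (k + 1), i0 = i1.castSucc := ⟨i0.castLT (by
          have : (i0 : ℕ) < i := hlt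
          have := i.2
          omega), by simp⟩
        obtain ⟨i1, hi1⟩ := e2
        have e3 : SimplexCategory.δ i.succ ≫ SimplexCategory.σ i0 = 
            SimplexCategory.σ i1 ≫ SimplexCategory.δ i := by
          rw [hi1]
          apply SimplexCategory.δ_comp_σ_of_gt
          rw [← hi1]; exact hlt
        rw [e3, Category.assoc]
        have e4 : SimplexCategory.δ i ≫ SimplexCategory.δ i0.succ = 
            SimplexCategory.δ i1.succ ≫ SimplexCategory.δ i.succ := by
          rw [SimplexCategory.δ_comp_δ (i := i1.succ) (j := i)
            (by rw [Fin.le_def]; have : (i0 : ℕ) < i := hlt; rw [hi1] at this; simpa using this)]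
          rw [hi1]; rfl
        rw [e4, pull_comp, pull_comp, LinearMap.comp_apply, LinearMap.comp_apply, h1]
        simp

lemma skelG {k : ℕ} [Subsingleton (F (k + 1))] :
    ∃ G : Fin (k + 1) → (VV F del ⦋k + 1⦌ →ₗ[R] VV F del ⦋k⦌),
      ∑ l, pull del (SimplexCategory.σ l) ∘ₗ G l = LinearMap.id := by
  obtain ⟨G, hG⟩ := exists_G del (k := k) (k + 1) le_rfl
  refine ⟨G, LinearMap.ext fun y => ?_⟩
  have := eq_zero_of_pull del _ fun i => hG i (by omega) y
  rw [sub_eq_zero] at this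
  rw [LinearMap.id_apply, LinearMap.sum_apply]
  exact this.symm

end Gam

section GamSM
variable {R : Type u} [CommRing R] [IsLocalRing R] {ι : ℕ → Type} [∀ j, Fintype (ι j)]
  (D : ∀ j, Matrix (ι j) (ι (j + 1)) R) (DD : ∀ j, D j * D (j + 1) = 0)
  (n : ℕ) (hn : ∀ j, n < j → IsEmpty (ι j))

/-- the simplicial module of a matrix complex -/
abbrev gV (k : ℕ) := VV (R := R) (fun j => ι j → R) (fun j => mact R (D j)) ⦋k⦌

include hn in
lemma fam_fin (k : ℕ) : Module.Finite R (∀ j, (⦋j⦌ ⟶ ⦋k⦌) → (ι j → R)) ∧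
    Module.Projective R (∀ j, (⦋j⦌ ⟶ ⦋k⦌) → (ι j → R)) := by
  let I := Σ j : ℕ, (⦋j⦌ ⟶ ⦋k⦌) × ι j
  have hI : Finite I := by
    let e : (Σ j : Fin (n + 1), ((⦋(j : ℕ)⦌ ⟶ ⦋k⦌) × ι j)) → I := fun x => ⟨x.1, x.2⟩
    have : Function.Surjective e := by
      rintro ⟨j, f, a⟩
      have hj : j < n + 1 := by
        by_contra h
        exact (hn j (by omega)).elim a
      exact ⟨⟨⟨j, hj⟩, f, a⟩, rfl⟩
    have : ∀ j : Fin (n + 1), Finite (⦋(j : ℕ)⦌ ⟶ ⦋k⦌) := fun j => by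
      refine Finite.of_injective (β := Fin (j + 1) → Fin (k + 1)) (fun f => ev f) ?_
      intro f g h
      exact ev_ext fun x => congrFun h x
    have : Finite (Σ j : Fin (n + 1), ((⦋(j : ℕ)⦌ ⟶ ⦋k⦌) × ι j)) := inferInstance
    exact Finite.of_surjective e ‹_›
  let E : (I → R) ≃ₗ[R] (∀ j, (⦋j⦌ ⟶ ⦋k⦌) → (ι j → R)) :=
    { toFun := fun z j f a => z ⟨j, f, a⟩
      invFun := fun z i => z i.1 i.2.1 i.2.2
      map_add' := fun _ _ => rfl
      map_smul' := fun _ _ => rfl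
      left_inv := fun _ => rfl
      right_inv := fun _ => rfl }
  exact ⟨Module.Finite.equiv E, Module.Projective.of_equiv E⟩

include DD hn in
lemma gV_fin (k : ℕ) : Module.Finite R (gV D k) ∧ Module.Free R (gV D k) := by
  obtain ⟨h1, h2⟩ := fam_fin (R := R) n hn k
  let r := retr (R := R) (F := fun j => ι j → R) (fun j => mact R (D j)) (fun j x => mdd DD j x) k
  have hr : ∀ z, r z.1 = z := fun z => retr_eq _ _ k z
  have hf : Module.Finite R (gV D k) := Module.Finite.of_surjective r fun z => ⟨z.1, hr z⟩
  have hp : Module.Projective R (gV D k) := Module.Projective.of_split (Submodule.subtype _) r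
    (LinearMap.ext hr)
  exact ⟨hf, Module.free_of_flat_of_isLocalRing⟩

/-- a basis -/
noncomputable def gB (k : ℕ) : Module.Basis (Fin (Module.finrank R (gV D k))) R (gV D k) :=
  haveI := (gV_fin D DD n hn k).1
  haveI := (gV_fin D DD n hn k).2
  Module.finBasis R (gV D k)

lemma toMatrix_id' {κ M : Type*} [Fintype κ] [DecidableEq κ] [AddCommGroup M] [Module R M]
    (b : Module.Basis κ R M) (x : R) : LinearMap.toMatrix b b (x • LinearMap.id) = scal κ x := by
  rw [map_smul, LinearMap.toMatrix_id]
  exact (scal_eq_smul _ x).symm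

/-- structure maps -/
def gpull {a b : SimplexCategory} (f : a ⟶ b) : gV D b.len →ₗ[R] gV D a.len :=
  pull (R := R) (F := fun j => ι j → R) (fun j => mact R (D j)) f

lemma gpull_id (a : SimplexCategory) : gpull D (𝟙 a) = LinearMap.id :=
  pull_id (R := R) (F := fun j => ι j → R) (fun j => mact R (D j)) a

lemma gpull_comp {a b c : SimplexCategory} (f : a ⟶ b) (g : b ⟶ c) :
    gpull D (f ≫ g) = gpull D f ∘ₗ gpull D g :=
  pull_comp (R := R) (F := fun j => ι j → R) (fun j => mact R (D j)) f g

/-- the simplicial module as matrices -/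
noncomputable def gam : SM R where
  ι k := Fin (Module.finrank R (gV D k))
  fin k := inferInstance
  map {a b} f := LinearMap.toMatrix (gB D DD n hn b.len) (gB D DD n hn a.len) (gpull D f)
  map_id a := by
    have := toMatrix_id' (gB D DD n hn a.len) 1
    rw [one_smul] at this
    rw [gpull_id]
    exact this
  map_comp {a b c} f g := by
    rw [gpull_comp]
    exact LinearMap.toMatrix_comp _ (gB D DD n hn b.len) _ _ _

lemma gam_skel : (gam D DD n hn).Skel n := by
  intro k hk
  have : IsEmpty (ι (k + 1)) := hn _ (by omega)
  obtain ⟨G, hG⟩ := skelG (R := R) (F := fun j => ι j → R) (fun j => mact R (D j)) (k := k)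
  refine ⟨fun i => LinearMap.toMatrix (gB D DD n hn (k + 1)) (gB D DD n hn k) (G i), ?_⟩
  have h1 := toMatrix_id' (gB D DD n hn (k + 1)) 1
  rw [one_smul, ← hG, map_sum] at h1
  refine Eq.trans (Finset.sum_congr rfl fun i _ => ?_) h1
  exact (LinearMap.toMatrix_comp _ (gB D DD n hn k) _ _ _).symm

lemma gam_con {x : R} (h : Kills D x) : (gam D DD n hn).Con x := by
  obtain ⟨s, h0, h1⟩ := h
  let H := hcon (R := R) (F := fun j => ι j → R) (fun j => mact R (D j)) (fun j => mact R (s j)) x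
    (fun y => by rw [← mact_mul, h0, mact_scal])
    (fun j y => by rw [← mact_mul, ← mact_mul, ← mact_add, h1, mact_scal])
  refine ⟨fun k => LinearMap.toMatrix (gB D DD n hn k) (gB D DD n hn (k + 1)) (H k), ?_, ?_, ?_⟩
  · intro k
    refine (LinearMap.toMatrix_comp _ (gB D DD n hn (k + 1)) _ _ _).symm.trans ?_
    refine Eq.trans ?_ (toMatrix_id' (gB D DD n hn k) x)
    exact congrArg _ (hcon_zero _ _ _ _ _ k)
  · refine (LinearMap.toMatrix_comp _ (gB D DD n hn 1) _ _ _).symm.trans ?_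
    refine (congrArg _ (hcon_one _ _ _ _ _)).trans ?_
    exact map_zero _
  · intro k i
    refine (LinearMap.toMatrix_comp _ (gB D DD n hn (k + 2)) _ _ _).symm.trans ?_
    refine (congrArg _ (hcon_succ _ _ _ _ _ k i)).trans ?_
    exact (LinearMap.toMatrix_comp _ (gB D DD n hn k) _ _ _)

/-- vertices -/
noncomputable def gv0 : (ι 0 → R) →ₗ[R] gV D 0 where
  toFun v := ⟨fun j => match j with
    | 0 => fun _ => v
    | j + 1 => fun _ => 0, fun j f hf => by
      cases j with
      | zero => exact absurd (inj0 f) hf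
      | succ j => rfl, fun j f => by
      cases j with
      | zero => simp [dl, Fin.sum_univ_two]
      | succ j => simp [dl]⟩
  map_add' v w := by
    apply VV.ext
    intro j f
    cases j with
    | zero => rfl
    | succ j => simp
  map_smul' v w := by
    apply VV.ext
    intro j f
    cases j with
    | zero => rfl
    | succ j => simp

lemma gv0_eq (z : gV D 0) : z = gv0 D (z.1 0 (𝟙 _)) := by
  apply VV.ext
  intro j f
  cases j with
  | zero =>
    have : f = 𝟙 _ := ev_ext fun x => @Subsingleton.elim (Fin 1) _ _ _
    subst this
    rfl
  | succ j =>
    rw [z.2.1]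
    · rfl
    · intro h
      have : (0 : Fin (j + 2)) = 1 := h (@Subsingleton.elim (Fin 1) _ _ _)
      simp at this

open IsLocalRing in
lemma mem_of_lin {κ : Type*} [Fintype κ] (φ : (κ → R) →ₗ[R] R) (v : κ → R) (I : Ideal R)
    (hv : ∀ a, v a ∈ I) : φ v ∈ I := by
  classical
  rw [φ.pi_apply_eq_sum_univ]
  exact Ideal.sum_mem _ fun i _ => by
    rw [smul_eq_mul]; exact I.mul_mem_right _ (hv i)

lemma gam_nonempty [Nonempty (ι 0)] : Nonempty ((gam D DD n hn).ι 0) := by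
  by_contra h
  rw [not_nonempty_iff] at h
  have : Subsingleton (gV D 0) := (gB D DD n hn 0).repr.toEquiv.subsingleton_congr.2
    (by have : IsEmpty (Fin (Module.finrank R (gV D 0))) := h
        infer_instance)
  have h2 := congrArg (fun z => z.1 0 (𝟙 _)) (Subsingleton.elim (gv0 D (fun _ => 1)) (gv0 D (fun _ => 0)))
  have h3 := congrFun h2 (Classical.arbitrary _)
  exact one_ne_zero h3

open IsLocalRing in
lemma gam_max (hD : ∀ a b, D 0 a b ∈ maximalIdeal R) (a b) :
    (gam D DD n hn).D 0 a b ∈ maximalIdeal R := by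
  let b0 := gB D DD n hn 0
  let b1 := gB D DD n hn 1
  let p0 : gV D 1 →ₗ[R] gV D 0 := gpull D (SimplexCategory.δ 0)
  let p1 : gV D 1 →ₗ[R] gV D 0 := gpull D (SimplexCategory.δ 1)
  have e1 : (gam D DD n hn).D 0 a b = b0.coord a (p0 (b1 b) - p1 (b1 b)) := by
    rw [SM.D, Fin.sum_univ_two, Matrix.add_apply, Matrix.smul_apply, Matrix.smul_apply, map_sub]
    simp only [Fin.val_zero, pow_zero, one_smul, Fin.val_one, pow_one, neg_smul]
    rw [← sub_eq_add_neg]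
    have h1 : (gam D DD n hn).d (j := 0) 0 a b = b0.coord a (p0 (b1 b)) :=
      LinearMap.toMatrix_apply b1 b0 p0 a b
    have h2 : (gam D DD n hn).d (j := 0) 1 a b = b0.coord a (p1 (b1 b)) :=
      LinearMap.toMatrix_apply b1 b0 p1 a b
    rw [h1, h2]
  rw [e1]
  set w := p0 (b1 b) - p1 (b1 b) with hw
  have hw2 : w.1 0 (𝟙 _) = mact R (D 0) ((b1 b).1 1 (𝟙 _)) := by
    rw [(b1 b).2.2, dl, Fin.sum_univ_two, hw]
    simp only [Fin.val_zero, pow_zero, one_smul, Fin.val_one, pow_one, neg_smul]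
    rw [← sub_eq_add_neg]
    rfl
  rw [gv0_eq D w]
  refine mem_of_lin ((b0.coord a) ∘ₗ gv0 D) _ _ fun i => ?_
  rw [hw2, mact_apply]
  exact Ideal.sum_mem _ fun c _ => Ideal.mul_mem_right _ _ (hD _ _)

end GamSM
end NIT

end

section
namespace NIT
open IsLocalRing


section
variable {R A : Type u} [CommRing R] [CommRing A] [Algebra R A]

lemma slen_restrict (h : Function.Surjective (algebraMap R A)) {M : Type*} [AddCommGroup M]
    [Module R M] [Module A M] [IsScalarTower R A M] (P Q : Submodule A M) :
    slen (P.restrictScalars R) (Q.restrictScalars R) = slen P Q := by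
  unfold slen
  rw [← Module.length_eq_of_surjective (M := Q ⧸ P.submoduleOf Q) h]
  exact (Submodule.Quotient.restrictScalarsEquiv R (P.submoduleOf Q)).length_eq

variable {ι : ℕ → Type*} [∀ j, Fintype (ι j)]

lemma mhl_quot (h : Function.Surjective (algebraMap R A)) (D : ∀ j, Matrix (ι j) (ι (j + 1)) R)
    (j : ℕ) : mhl D A j = mhl (fun j => (D j).map (algebraMap R A)) A j := by
  have key : ∀ j (v : ι (j + 1) → A), mact A (D j) v = mact A ((D j).map (algebraMap R A)) v := by
    intro j v
    ext a
    simp [mact_apply, Algebra.smul_def]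
  refine Eq.trans ?_ (slen_restrict h _ _)
  unfold mhl hl
  congr 1
  · ext x
    constructor
    · rintro ⟨v, hv⟩
      exact ⟨v, (key _ _).symm.trans hv⟩
    · rintro ⟨v, hv⟩
      exact ⟨v, (key _ _).trans hv⟩
  · cases j with
    | zero => rfl
    | succ j =>
      ext x
      exact (by rw [← key] : mact A (D j) x = 0 ↔ mact A ((D j).map (algebraMap R A)) x = 0)
end

section
variable {A : Type u} [CommRing A] [IsNoetherianRing A] [IsLocalRing A]

/-- the class of simplicial modules used in the mixed characteristic argument -/
def SM.Good (W : SM A) (n : ℕ) : Prop :=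
  W.Skel n ∧ ∀ x ∈ maximalIdeal A, ∃ N : ℕ, W.Con (x ^ N)

lemma SM.Good.fin {W : SM A} {n : ℕ} (h : W.Good n) (N : Type u) [AddCommGroup N] [Module A N]
    [Module.Finite A N] (i : ℕ) : mhl W.D N i ≠ ⊤ := by
  obtain ⟨d, hd⟩ := exists_dim_eq (A := A)
  obtain ⟨xs, hxs, hxm, hfl⟩ := exists_sop d hd
  obtain ⟨C, hC⟩ := asym (fun _ : Unit => 1) (fun _ => le_rfl) (fun _ => W.D) (fun _ => W.DD) n
    (fun _ i hi N _ _ => SM.Skel.mhl_eq_zero W N h.1 hi) xs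
    (fun x hx => (h.2 x (hxm x hx)).imp fun t ht e => by
      rw [mul_one]; exact SM.Con.kills W ht) ⊥ hfl i N inferInstance (by simp)
  have := hC ()
  simp only [ite_self, Nat.cast_one, mul_one] at this
  exact ne_top_of_le_ne_top (ENat.natCast_ne_top _) this

lemma SM.Good.chi {W : SM A} {n : ℕ} (h : W.Good n) (N : Type u) [AddCommGroup N] [Module A N]
    [Module.Finite A N] : ∃ c, HasChi (mhl W.D N) c :=
  HasChi.exists (h.fin N) (m := n + 1) (fun j hj => SM.Skel.mhl_eq_zero W N h.1 hj)

end

section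
variable {R : Type u} [CommRing R] [IsNoetherianRing R] [IsLocalRing R] [IsDomain R]

lemma SM.Good.chi_quot {W : SM R} {n : ℕ} (h : W.Good n) (x : R) (hx : x ≠ 0) :
    HasChi (mhl (W.bc (Ideal.Quotient.mk (Ideal.span {x}))).D (R ⧸ Ideal.span {x})) 0 := by
  obtain ⟨c, hc⟩ := h.chi R
  have key : LES (mhl W.D R) (mhl W.D R) (mhl W.D (R ⧸ Ideal.span {x})) := by
    obtain ⟨r, a, b, h1, h2, h3, h4, -⟩ := mles W.DD (LinearMap.mulLeft R x)
      (Submodule.mkQ (Ideal.span {x})) (mul_right_injective₀ hx) (by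
        intro y
        simp only [Submodule.mkQ_apply, Submodule.Quotient.mk_eq_zero, Ideal.mem_span_singleton]
        exact ⟨fun ⟨z, hz⟩ => ⟨z, hz.symm⟩, fun ⟨z, hz⟩ => ⟨z, hz.symm⟩⟩)
      (Submodule.mkQ_surjective _)
    exact LES.of h1 h2 h3 h4
  have h0 := key.chi3 hc hc
  rw [sub_self] at h0
  have e : mhl W.D (R ⧸ Ideal.span {x}) =
      mhl (W.bc (Ideal.Quotient.mk (Ideal.span {x}))).D (R ⧸ Ideal.span {x}) := by
    ext1 j
    refine (mhl_quot Ideal.Quotient.mk_surjective W.D j).trans ?_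
    have : ∀ j, (W.D j).map (algebraMap R (R ⧸ Ideal.span {x})) =
      (W.bc (Ideal.Quotient.mk (Ideal.span {x}))).D j := fun j => (SM.bc_D W _ j).symm
    simp only [this]
    rfl
  rw [← e]
  exact h0
end

namespace SM
variable {R A B : Type u} [CommRing R] [CommRing A] [CommRing B]

lemma ext_map {ι : ℕ → Type} (fin : ∀ k, Fintype (ι k)) {m1 m2 i1 i2 c1 c2}
    (h : @m1 = @m2) : (⟨ι, fin, m1, i1, c1⟩ : SM A) = ⟨ι, fin, m2, i2, c2⟩ := by
  subst h; rfl

lemma bc_T (W : SM R) (f : R →+* A) (p : ℕ) [Fact p.Prime] : (W.T p).bc f = (W.bc f).T p := by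
  refine ext_map _ ?_
  ext a b g : 3
  exact gten_map _ _

lemma bc_TC (W : SM R) (f : R →+* A) (p : ℕ) [Fact p.Prime] : (W.TC p).bc f = (W.bc f).TC p := by
  refine ext_map _ ?_
  ext a b g : 3
  exact tc_map _ _ _

lemma bc_bc (W : SM R) (f : R →+* A) (g : A →+* B) : (W.bc f).bc g = W.bc (g.comp f) := by
  refine ext_map _ ?_
  ext a b h : 3
  rfl
end SM

section
variable {R : Type u} [CommRing R] [IsNoetherianRing R] [IsLocalRing R] 

lemma SM.Good.bc {A : Type u} [CommRing A] [IsLocalRing A] {W : SM R} {n : ℕ} (h : W.Good n)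
    (f : R →+* A) (hf : ∀ x ∈ maximalIdeal A, ∃ y ∈ maximalIdeal R, ∃ k : ℕ, x ^ k = f y) :
    (W.bc f).Good n := by
  refine ⟨SM.Skel.bc W f h.1, fun x hx => ?_⟩
  obtain ⟨y, hy, k, e⟩ := hf x hx
  obtain ⟨N, hN⟩ := h.2 y hy
  refine ⟨k * N, ?_⟩
  rw [pow_mul, e, ← map_pow]
  exact SM.Con.bc W f hN

variable (p : ℕ) [Fact p.Prime]

lemma SM.Good.T {W : SM R} {n : ℕ} (h : W.Good n) : (W.T p).Good (p * n) :=
  ⟨SM.Skel.T p h.1, fun x hx => (by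
    obtain ⟨N, hN⟩ := h.2 x hx
    exact ⟨N * p, by rw [pow_mul]; exact SM.Con.T p hN⟩)⟩

lemma SM.Good.TC {W : SM R} {n : ℕ} (h : W.Good n) : (W.TC p).Good (p * n) :=
  ⟨SM.Skel.TC p h.1, fun x hx => (by
    obtain ⟨N, hN⟩ := h.2 x hx
    exact ⟨N * p, by rw [pow_mul]; exact SM.Con.TC p hN⟩)⟩

lemma quot_pow_mem {x : R} (hx : x ∈ maximalIdeal R) [IsLocalRing (R ⧸ Ideal.span {x})]
    [CharP (R ⧸ Ideal.span {x}) p] (e : ℕ) (a : R ⧸ Ideal.span {x})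
    (ha : a ∈ maximalIdeal (R ⧸ Ideal.span {x})) :
    ∃ y ∈ maximalIdeal R, ∃ k : ℕ, 
      a ^ k = ((iterateFrobenius (R ⧸ Ideal.span {x}) p e).comp (Ideal.Quotient.mk _)) y := by
  obtain ⟨y, rfl⟩ := Ideal.Quotient.mk_surjective a
  refine ⟨y, ?_, p ^ e, ?_⟩
  · rw [mem_maximalIdeal, mem_nonunits_iff] at ha ⊢
    exact fun h => ha (h.map _)
  · simp [iterateFrobenius_def]

lemma chi_iter [IsDomain R] {x : R} (hx : x ∈ maximalIdeal R) (hx0 : x ≠ 0)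
    [IsLocalRing (R ⧸ Ideal.span {x})] [CharP (R ⧸ Ideal.span {x}) p] (e : ℕ) :
    ∀ (W : SM R) (n : ℕ), W.Good n →
    HasChi (mhl (W.bc ((iterateFrobenius (R ⧸ Ideal.span {x}) p e).comp
      (Ideal.Quotient.mk (Ideal.span {x})))).D (R ⧸ Ideal.span {x})) 0 := by
  induction e with
  | zero =>
    intro W n h
    have := h.chi_quot x hx0
    rwa [iterateFrobenius_zero, RingHom.id_comp]
  | succ e ih =>
    intro W n h
    set A := R ⧸ Ideal.span {x}
    obtain ⟨c, hc⟩ := (h.bc _ (quot_pow_mem p hx (e + 1))).chi A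
    have e1 : (iterateFrobenius A p (e + 1)).comp (Ideal.Quotient.mk (Ideal.span {x})) =
      (frobenius A p).comp ((iterateFrobenius A p e).comp (Ideal.Quotient.mk (Ideal.span {x}))) := by
      ext y
      simp [iterateFrobenius_def, frobenius_def, pow_succ, pow_mul]
    have h0 := SM.chi_frob p (W.bc ((iterateFrobenius A p e).comp (Ideal.Quotient.mk (Ideal.span {x}))))
      (c := c) (by rw [← SM.bc_T]; exact ih _ _ (h.T p))
      (by rw [← SM.bc_TC]; exact ih _ _ (h.TC p)) (by rw [SM.bc_bc, ← e1]; exact hc)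
    rw [← h0]
    exact hc

end

lemma HasChi.le_sum {h : ℕ → ℕ∞} (hc : HasChi h 0) (d : ℕ) (hd : ∀ j, d < j → h j = 0) :
    h 0 ≤ ∑ i ∈ Finset.range d, h (i + 1) := by
  have h1 : asum h (d + 1) = 0 := HasChi.unique (h := h) ⟨hc.1, d + 1, hd, rfl⟩ hc
  have hf := hc.1
  rw [asum, Finset.sum_range_succ'] at h1
  lift h to ℕ → ℕ using hf
  simp only [pow_zero, one_mul, ENat.toNat_natCast, Function.comp] at h1 ⊢
  have h2 : (h 0 : ℤ) ≤ ∑ i ∈ Finset.range d, (h (i + 1) : ℤ) := by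
    have : (h 0 : ℤ) = ∑ i ∈ Finset.range d, -((-1) ^ (i + 1) * (h (i + 1) : ℤ)) := by
      rw [Finset.sum_neg_distrib]; linarith
    rw [this]
    refine Finset.sum_le_sum fun i _ => ?_
    rcases neg_one_pow_eq_or ℤ (i + 1) with h | h <;> rw [h] <;> simp
  exact_mod_cast h2

/-- New intersection theorem in mixed characteristic, domain case -/
theorem nit_mixed_dom {R : Type u} [CommRing R] [IsNoetherianRing R] [IsLocalRing R] [IsDomain R]
    (p : ℕ) [Fact p.Prime] (hp : (p : R) ∈ maximalIdeal R) (hp0 : (p : R) ≠ 0)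
    {ι : ℕ → Type} [∀ j, Fintype (ι j)] {D : ∀ j, Matrix (ι j) (ι (j + 1)) R}
    (DD : ∀ j, D j * D (j + 1) = 0) [Nonempty (ι 0)]
    (hD : ∀ a b, D 0 a b ∈ maximalIdeal R) (n : ℕ) (hn : ∀ j, n < j → IsEmpty (ι j))
    (hk : ∀ x ∈ maximalIdeal R, ∃ N : ℕ, Kills D (x ^ N)) : ringKrullDim R ≤ n := by
  set I : Ideal R := Ideal.span {(p : R)} with hI
  have hIm : I ≤ maximalIdeal R := by rwa [hI, Ideal.span_singleton_le_iff_mem]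
  have : Nontrivial (R ⧸ I) := Ideal.Quotient.nontrivial_iff.2
    (ne_top_of_le_ne_top (Ideal.IsPrime.ne_top inferInstance) hIm)
  have : IsLocalRing (R ⧸ I) := IsLocalRing.of_surjective' _ Ideal.Quotient.mk_surjective
  have : CharP (R ⧸ I) p := CharP.quotient R p hp
  obtain ⟨d, hd⟩ := exists_dim_eq (A := R ⧸ I)
  have hdim := ringKrullDim_quotient_span_singleton_succ_eq_ringKrullDim_of_mem_nonZeroDivisors
    (mem_nonZeroDivisors_of_ne_zero hp0) hp
  rw [hd] at hdim
  rw [← hdim]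
  by_contra! hlt
  have hlt : n ≤ d := by
    have : (n : WithBot ℕ∞) < ((d + 1 : ℕ) : WithBot ℕ∞) := by exact_mod_cast hlt
    have : n < d + 1 := by exact_mod_cast this
    omega
  have hW : (gam D DD n hn).Good n := ⟨gam_skel D DD n hn, fun x hx =>
    (hk x hx).imp fun N hN => gam_con D DD n hn hN⟩
  have hWm := gam_max D DD n hn hD
  have hWn := gam_nonempty D DD n hn
  generalize gam D DD n hn = W at hW hWm hWn
  have hV := hW.bc (Ideal.Quotient.mk I) (by
    intro a ha
    obtain ⟨y, hy, k, h⟩ := quot_pow_mem p hp 0 a ha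
    exact ⟨y, hy, k, by rwa [iterateFrobenius_zero, RingHom.id_comp] at h⟩)
  have hchi : ∀ e, HasChi (mhl ((W.bc (Ideal.Quotient.mk I)).bc
      (iterateFrobenius (R ⧸ I) p e)).D (R ⧸ I)) 0 := fun e => by
    rw [SM.bc_bc]; exact chi_iter p hp hp0 e W n hW
  have hVm : ∀ a b, (W.bc (Ideal.Quotient.mk I)).D 0 a b ∈ maximalIdeal (R ⧸ I) := by
    intro a b
    rw [SM.bc_D]
    change Ideal.Quotient.mk I (W.D 0 a b) ∈ _
    have := hWm a b
    rw [mem_maximalIdeal, mem_nonunits_iff] at this ⊢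
    have hl : IsLocalHom (Ideal.Quotient.mk I) := by
      exact IsLocalHom.of_surjective _ Ideal.Quotient.mk_surjective
    exact fun h => this (isUnit_of_map_unit _ _ h)
  have hVn : Nonempty ((W.bc (Ideal.Quotient.mk I)).ι 0) := hWn
  generalize W.bc (Ideal.Quotient.mk I) = V at hV hchi hVm hVn
  have e2 : ∀ e (N : Type u) [AddCommGroup N] [Module (R ⧸ I) N],
      mhl (V.bc (iterateFrobenius (R ⧸ I) p e)).D N = mhl (frob p V.D e) N := by
    intro e N _ _
    exact congrArg (fun D : ∀ j, Matrix (V.ι j) (V.ι (j + 1)) (R ⧸ I) => mhl D N)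
      (funext fun j => SM.bc_D V _ j)
  have hchi' : ∀ e, HasChi (mhl (frob p V.D e) (R ⧸ I)) 0 := fun e => by
    have := hchi e
    rw [e2 e] at this
    exact this
  have hvan : ∀ e i, d < i → ∀ (N : Type u) [AddCommGroup N] [Module (R ⧸ I) N],
      mhl (frob p V.D e) N i = 0 := by
    intro e i hi N _ _
    have h1 := SM.Skel.mhl_eq_zero (V.bc (iterateFrobenius (R ⧸ I) p e)) N
      (SM.Skel.bc V _ hV.1) (lt_of_le_of_lt hlt hi)
    rw [e2 e] at h1
    exact h1
  have hle := fun e => (hchi' e).le_sum d (fun j hj => hvan e j hj _)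
  obtain ⟨xs, hxs, hxm, hfl⟩ := exists_sop d hd
  have hb := fun i => asym (fun e : ℕ => p ^ e) (fun e => Nat.one_le_pow _ _ (Nat.Prime.pos Fact.out))
    (frob p V.D) (fun e => map_dd _ V.DD) d hvan xs
    (fun x hx => (hV.2 x (hxm x hx)).imp fun N hN e => frob_kills p (SM.Con.kills V hN) e)
    ⊥ hfl (i + 1) (R ⧸ I) inferInstance (by simp)
  rw [hxs] at hb
  choose C hC using hb
  cases d with
  | zero =>
    have h0 := (length_le_frob p hVm 0).trans (hle 0)
    simp only [Finset.range_zero, Finset.sum_empty, nonpos_iff_eq_zero, Module.length_eq_zero_iff] at h0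
    have h3 := Ideal.Quotient.subsingleton_iff.1 h0
    rw [pow_zero, pow_one] at h3
    exact (Ideal.IsPrime.ne_top inferInstance) h3
  | succ d =>
    have h3 := dim_of_bound p hVm d (∑ i ∈ Finset.range (d + 1), C i) (by
      intro e
      refine (mul_le_mul_left (hle e) _).trans ?_
      rw [Finset.sum_mul, Finset.sum_mul, Nat.cast_sum]
      refine Finset.sum_le_sum fun i _ => ?_
      have := hC i e
      rwa [if_pos (by omega)] at this)
    rw [hd] at h3
    have : d + 1 ≤ d := by exact_mod_cast h3
    omega

/-- New intersection theorem in mixed characteristic -/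
theorem nit_mixed {R : Type u} [CommRing R] [IsNoetherianRing R] [IsLocalRing R]
    (p : ℕ) [Fact p.Prime] (hp : (p : R) ∈ maximalIdeal R)
    {ι : ℕ → Type} [∀ j, Fintype (ι j)] {D : ∀ j, Matrix (ι j) (ι (j + 1)) R}
    (DD : ∀ j, D j * D (j + 1) = 0) [Nonempty (ι 0)]
    (hD : ∀ a b, D 0 a b ∈ maximalIdeal R) (n : ℕ) (hn : ∀ j, n < j → IsEmpty (ι j))
    (hk : ∀ x ∈ maximalIdeal R, ∃ N : ℕ, Kills D (x ^ N)) : ringKrullDim R ≤ n := by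
  obtain ⟨d, hd⟩ := exists_dim_eq (A := R)
  rw [hd]
  obtain ⟨P, hP, -, hdP⟩ := exists_prime_dim (⊥ : Ideal R) d
    (by rw [ringKrullDim_eq_of_ringEquiv (RingEquiv.quotientBot R), hd])
  refine hdP.trans ?_
  have : IsLocalRing (R ⧸ P) := IsLocalRing.of_surjective' _ Ideal.Quotient.mk_surjective
  have hl : IsLocalHom (Ideal.Quotient.mk P) := 
    IsLocalHom.of_surjective _ Ideal.Quotient.mk_surjective
  have hmap : ∀ x ∈ maximalIdeal R, Ideal.Quotient.mk P x ∈ maximalIdeal (R ⧸ P) := by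
    intro x hx
    rw [mem_maximalIdeal, mem_nonunits_iff] at hx ⊢
    exact fun h => hx (isUnit_of_map_unit _ _ h)
  have hk' : ∀ x ∈ maximalIdeal (R ⧸ P), ∃ N : ℕ, 
      Kills (fun j => (D j).map (Ideal.Quotient.mk P)) (x ^ N) := by
    intro x hx
    obtain ⟨x, rfl⟩ := Ideal.Quotient.mk_surjective x
    obtain ⟨N, hN⟩ := hk x (by
      rw [mem_maximalIdeal, mem_nonunits_iff] at hx ⊢
      exact fun h => hx (h.map _))
    exact ⟨N, by rw [← map_pow]; exact hN.map _⟩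
  have hpm : (p : R ⧸ P) ∈ maximalIdeal (R ⧸ P) := by
    have := hmap _ hp
    rwa [map_natCast] at this
  by_cases hp0 : (p : R ⧸ P) = 0
  · have : CharP (R ⧸ P) p := (CharP.charP_iff_prime_eq_zero Fact.out).2 hp0
    exact nit_charp p (map_dd (Ideal.Quotient.mk P) DD) (fun a b => hmap _ (hD a b)) n hn hk'
  · exact nit_mixed_dom p hpm hp0 (map_dd (Ideal.Quotient.mk P) DD) (fun a b => hmap _ (hD a b)) n hn hk'
end NIT

end

section
namespace NIT
open Polynomial
open scoped nonZeroDivisors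

theorem pl1 {Γ Δ : Type*} [CommRing Γ] [IsDomain Γ] [CharZero Γ] [CommRing Δ] [IsDomain Δ]
    [Algebra Γ Δ] [FaithfulSMul Γ Δ] [Algebra.IsAlgebraic Γ Δ] [Algebra.FiniteType Γ Δ] :
    ∃ (θ : Δ) (P : Γ[X]), aeval θ P = 0 ∧ aeval θ (derivative P) ≠ 0 ∧
      (∀ f : Γ[X], aeval θ f = 0 → ∃ c : Γ, c ≠ 0 ∧ P ∣ C c * f) ∧
      (∀ y : Δ, ∃ b : Γ, b ≠ 0 ∧ ∃ a : Γ[X], algebraMap Γ Δ b * y = aeval θ a) := by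
  let K := FractionRing Γ
  let F := FractionRing Δ
  letI : Algebra K F := FractionRing.liftAlgebra Γ F
  haveI : IsScalarTower Γ K F := FractionRing.isScalarTower_liftAlgebra Γ F
  haveI : CharZero K := charZero_of_injective_algebraMap (IsFractionRing.injective Γ K)
  haveI e1 : Algebra.EssFiniteType Δ F := Algebra.EssFiniteType.of_isLocalization F Δ⁰
  haveI e2 : Algebra.EssFiniteType Γ F := Algebra.EssFiniteType.comp Γ Δ F
  haveI e3 : Algebra.EssFiniteType K F := Algebra.EssFiniteType.of_comp Γ K F
  have key : ∀ x : F, ∃ γ : Γ, γ ≠ 0 ∧ ∃ θ : Δ, algebraMap Γ F γ * x = algebraMap Δ F θ := by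
    intro x
    obtain ⟨⟨_, γ, hγ, rfl⟩, θ, hθ⟩ := IsLocalization.exists_integer_multiple
      (M := Algebra.algebraMapSubmonoid Δ Γ⁰) x
    refine ⟨γ, nonZeroDivisors.ne_zero hγ, θ, ?_⟩
    rw [hθ, Algebra.smul_def, IsScalarTower.algebraMap_apply Γ Δ F]
  have i1 : Function.Injective (algebraMap Γ K) := IsFractionRing.injective Γ K
  have i2 : Function.Injective (algebraMap Δ F) := IsFractionRing.injective Δ F
  have ne : ∀ γ : Γ, γ ≠ 0 → algebraMap Γ F γ ≠ 0 := by
    intro γ h0 h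
    rw [IsScalarTower.algebraMap_apply Γ K F, map_eq_zero, map_eq_zero_iff _ i1] at h
    exact h0 h
  have inv : ∀ (γ : Γ) (x z : F), γ ≠ 0 → algebraMap Γ F γ * x = z →
      x = algebraMap K F (algebraMap Γ K γ)⁻¹ * z := by
    rintro γ x z h0 rfl
    rw [map_inv₀, ← IsScalarTower.algebraMap_apply, inv_mul_cancel_left₀ (ne _ h0)]
  haveI alg : Algebra.IsAlgebraic K F := by
    refine ⟨fun x => ?_⟩
    obtain ⟨γ, h0, θ, h⟩ := key x
    rw [inv γ x _ h0 h]
    refine (isAlgebraic_algebraMap _).mul ?_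
    have := (Algebra.IsAlgebraic.isAlgebraic (R := Γ) θ).algHom (IsScalarTower.toAlgHom Γ Δ F)
    exact this.extendScalars i1
  haveI fin : FiniteDimensional K F := by
    obtain ⟨s, hs⟩ := IntermediateField.fg_top K F
    have := IntermediateField.finiteDimensional_adjoin (K := K) (S := (s : Set F))
      (fun x _ => (Algebra.IsAlgebraic.isAlgebraic (R := K) x).isIntegral)
    rw [hs] at this
    exact Module.Finite.equiv (IntermediateField.topEquiv (F := K) (E := F)).toLinearEquiv
  obtain ⟨α, hα⟩ := Field.exists_primitive_element K F
  obtain ⟨γ, h0, θ, hθ⟩ := key α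
  have hprim : ∀ y : F, ∃ q : K[X], aeval (algebraMap Δ F θ) q = y := by
    intro y
    have h1 : y ∈ IntermediateField.adjoin K {α} := by rw [hα]; trivial
    have h2 : IntermediateField.adjoin K {α} ≤ IntermediateField.adjoin K {algebraMap Δ F θ} := by
      rw [IntermediateField.adjoin_simple_le_iff, inv γ α _ h0 hθ]
      exact mul_mem (IntermediateField.algebraMap_mem _ _)
        (IntermediateField.mem_adjoin_simple_self _ _)
    have h3 := h2 h1
    rw [← IntermediateField.mem_toSubalgebra, IntermediateField.adjoin_simple_toSubalgebra_of_isAlgebraic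
      (Algebra.IsAlgebraic.isAlgebraic _), Algebra.adjoin_singleton_eq_range_aeval] at h3
    exact h3
  have cl : ∀ q : K[X], ∃ c : Γ, c ≠ 0 ∧ ∃ r : Γ[X], r.map (algebraMap Γ K) = C (algebraMap Γ K c) * q := by
    intro q
    obtain ⟨c, hc, h⟩ := IsLocalization.integerNormalization_spec Γ⁰ q
    exact ⟨c, nonZeroDivisors.ne_zero hc, _, by rw [h, Polynomial.C_mul', algebraMap_smul]⟩
  have ev : ∀ r : Γ[X], algebraMap Δ F (aeval θ r) = aeval (algebraMap Δ F θ) (r.map (algebraMap Γ K)) := by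
    intro r
    rw [aeval_map_algebraMap, aeval_algebraMap_apply]
  have inj : Function.Injective (Polynomial.map (algebraMap Γ K)) := Polynomial.map_injective _ i1
  obtain ⟨c, hc, P, hP⟩ := cl (minpoly K (algebraMap Δ F θ))
  have hc' : algebraMap Γ K c ≠ 0 := fun h => hc ((map_eq_zero_iff _ i1).1 h)
  refine ⟨θ, P, ?_, ?_, ?_, ?_⟩
  · apply i2
    rw [ev, hP]; simp
  · intro h
    have := ev (derivative P)
    rw [h, map_zero, ← Polynomial.derivative_map, hP, derivative_C_mul, map_mul, aeval_C] at this
    rcases mul_eq_zero.1 this.symm with h | h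
    · exact hc' ((map_eq_zero _).1 h)
    · exact (Algebra.IsSeparable.isSeparable K _).aeval_derivative_ne_zero (minpoly.aeval _ _) h
  · intro f hf
    have := ev f
    rw [hf, map_zero] at this
    obtain ⟨q, hq⟩ := minpoly.dvd K _ this.symm
    obtain ⟨e, he, r, hr⟩ := cl q
    refine ⟨c * e, mul_ne_zero hc he, r, inj ?_⟩
    rw [Polynomial.map_mul, Polynomial.map_mul, hP, hr, hq, Polynomial.map_C, map_mul, map_mul]
    ring
  · intro y
    obtain ⟨q, hq⟩ := hprim (algebraMap Δ F y)
    obtain ⟨e, he, r, hr⟩ := cl q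
    refine ⟨e, he, r, i2 ?_⟩
    rw [ev, hr, map_mul, map_mul, aeval_C, hq, ← IsScalarTower.algebraMap_apply,
      ← IsScalarTower.algebraMap_apply]

theorem homogenize {Γ : Type*} [CommRing Γ] (b : Γ) {σ : Type*} (a : σ → Γ) (f : MvPolynomial σ ℤ) :
    ∃ (M : ℕ) (h : Γ), ∀ {B : Type u} [CommRing B] (φ : Γ →+* B) (y : σ → B),
      (∀ i, φ b * y i = φ (a i)) → φ h = φ b ^ M * MvPolynomial.aeval y f := by
  induction f using MvPolynomial.induction_on with
  | C n => exact ⟨0, n, fun φ y _ => by simp⟩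
  | add p q hp hq =>
    obtain ⟨M, h, H⟩ := hp
    obtain ⟨M', h', H'⟩ := hq
    refine ⟨M + M', b ^ M' * h + b ^ M * h', fun φ y hy => ?_⟩
    rw [map_add, map_mul, map_mul, map_pow, map_pow, map_add, H φ y hy, H' φ y hy]
    ring
  | mul_X p i hp =>
    obtain ⟨M, h, H⟩ := hp
    refine ⟨M + 1, h * a i, fun φ y hy => ?_⟩
    rw [map_mul, map_mul, H φ y hy, ← hy, MvPolynomial.aeval_X]
    ring

theorem pl2 (Δ : Type u) [CommRing Δ] [IsDomain Δ] [CharZero Δ] {m : ℕ} (y : Fin m → Δ)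
    (hy : Algebra.adjoin ℤ (Set.range y) = ⊤) :
    ∃ (J : Type u) (_ : Finite J) (φ : (MvPolynomial J ℤ)[X] →+* Δ) (P : (MvPolynomial J ℤ)[X])
      (b : MvPolynomial J ℤ) (a : Fin m → (MvPolynomial J ℤ)[X]),
      φ P = 0 ∧ φ (derivative P) ≠ 0 ∧ φ (C b) ≠ 0 ∧ (∀ i, φ (C b) * y i = φ (a i)) ∧
      ∀ (B : Type u) [CommRing B] [IsDomain B] (φ' : (MvPolynomial J ℤ)[X] →+* B) (y' : Fin m → B),
        φ' P = 0 → φ' (C b) ≠ 0 → (∀ i, φ' (C b) * y' i = φ' (a i)) →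
        ∃ g : Δ →+* B, ∀ i, g (y i) = y' i := by
  classical
  haveI : Algebra.IsAlgebraic (Algebra.adjoin ℤ (Set.range y)) Δ := by
    refine ⟨fun x => ?_⟩
    have hx : x ∈ Algebra.adjoin ℤ (Set.range y) := by rw [hy]; trivial
    exact isAlgebraic_algebraMap (⟨x, hx⟩ : Algebra.adjoin ℤ (Set.range y))
  obtain ⟨t, hts, ht⟩ := exists_isTranscendenceBasis_subset (R := ℤ) (Set.range y)
  haveI hfin : Finite t := ((Set.finite_range y).subset hts).to_subtype
  let Γ := MvPolynomial t ℤ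
  letI : Algebra Γ Δ := (MvPolynomial.aeval (R := ℤ) ((↑) : t → Δ)).toAlgebra
  have hinj : Function.Injective (algebraMap Γ Δ) := ht.1
  haveI : FaithfulSMul Γ Δ := (faithfulSMul_iff_algebraMap_injective _ _).2 hinj
  haveI : Algebra.FiniteType ℤ Δ := ⟨⟨Finset.univ.image y, by simpa using hy⟩⟩
  haveI : IsScalarTower ℤ Γ Δ := IsScalarTower.of_algebraMap_eq' (RingHom.ext_int _ _)
  haveI : Algebra.FiniteType Γ Δ := Algebra.FiniteType.of_restrictScalars_finiteType ℤ Γ Δ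
  haveI : Algebra.IsAlgebraic Γ Δ := by
    have h1 := ht.isAlgebraic
    exact Algebra.IsAlgebraic.of_ringHom_of_comp_eq ht.1.aevalEquiv (RingHom.id Δ)
      ht.1.aevalEquiv.surjective Function.injective_id
      (RingHom.ext fun x => ht.1.algebraMap_aevalEquiv x)
  obtain ⟨θ, P, hP, hP', hdiv, hgen⟩ := pl1 (Γ := Γ) (Δ := Δ)
  choose b1 hb1 a1 ha1 using fun i => hgen (y i)
  let b0 : Γ := ∏ i, b1 i
  let a0 : Fin m → Γ[X] := fun i => C (∏ j ∈ Finset.univ.erase i, b1 j) * a1 i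
  let φ : Γ[X] →+* Δ := (aeval θ : Γ[X] →ₐ[Γ] Δ).toRingHom
  have φC : ∀ c : Γ, φ (C c) = algebraMap Γ Δ c := fun c => aeval_C _ _
  have hφ0 : ∀ i, φ (C b0) * y i = φ (a0 i) := by
    intro i
    rw [map_mul, φC, φC]
    change _ = _ * aeval θ (a1 i)
    rw [← ha1, ← mul_assoc, ← map_mul, Finset.prod_erase_mul _ _ (Finset.mem_univ i)]
  let ev : MvPolynomial (Fin m) ℤ →+* Δ := (MvPolynomial.aeval y : MvPolynomial (Fin m) ℤ →ₐ[ℤ] Δ).toRingHom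
  have evs : Function.Surjective ev := by
    intro x
    have hx : x ∈ Algebra.adjoin ℤ (Set.range y) := by rw [hy]; trivial
    rw [Algebra.adjoin_range_eq_range_aeval] at hx
    exact hx
  obtain ⟨s, hs⟩ := (inferInstance : IsNoetherian (MvPolynomial (Fin m) ℤ) (MvPolynomial (Fin m) ℤ)).noetherian (RingHom.ker ev)
  have hs' : ∀ f ∈ s, ev f = 0 := fun f hf => by
    have : f ∈ RingHom.ker ev := hs ▸ Submodule.subset_span hf
    exact this
  choose M h H using homogenize.{u} (C b0) a0
  have hh : ∀ f, ∃ c : Γ, c ≠ 0 ∧ (f ∈ s → P ∣ C c * h f) := by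
    intro f
    by_cases hf : f ∈ s
    · have := H f φ y hφ0
      have h2 : MvPolynomial.aeval y f = 0 := hs' f hf
      rw [h2, mul_zero] at this
      obtain ⟨c, hc, hd⟩ := hdiv _ this
      exact ⟨c, hc, fun _ => hd⟩
    · exact ⟨1, one_ne_zero, fun h => absurd h hf⟩
  choose c hc hcd using hh
  let cc : Γ := ∏ f ∈ s, c f
  have hcc : cc ≠ 0 := Finset.prod_ne_zero_iff.2 fun f _ => hc f
  have hb0 : b0 ≠ 0 := Finset.prod_ne_zero_iff.2 fun f _ => hb1 f
  refine ⟨t, hfin, φ, P, b0 * cc, fun i => a0 i * C cc, hP, hP', ?_, ?_, ?_⟩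
  · rw [φC]
    exact fun h => mul_ne_zero hb0 hcc ((map_eq_zero_iff _ hinj).1 h)
  · intro i
    rw [C_mul, map_mul, map_mul, ← hφ0]; ring
  · intro B _ _ φ' y' h1 h2 h3
    rw [C_mul, map_mul] at h2
    have h2a := left_ne_zero_of_mul h2
    have h2b := right_ne_zero_of_mul h2
    have h3' : ∀ i, φ' (C b0) * y' i = φ' (a0 i) := by
      intro i
      have := h3 i
      rw [C_mul, map_mul, map_mul, mul_right_comm] at this
      exact mul_right_cancel₀ h2b this
    let ev' : MvPolynomial (Fin m) ℤ →+* B := (MvPolynomial.aeval y' : MvPolynomial (Fin m) ℤ →ₐ[ℤ] B).toRingHom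
    have hk : RingHom.ker ev ≤ RingHom.ker ev' := by
      rw [← hs, Submodule.span_le]
      intro f hf
      obtain ⟨q, hq⟩ := hcd f hf
      have e1 : φ' (C (c f)) * φ' (h f) = 0 := by
        rw [← map_mul, hq, map_mul, h1, zero_mul]
      have e2 : φ' (C (c f)) ≠ 0 := by
        intro h0
        apply h2b
        rw [map_prod, map_prod]
        exact Finset.prod_eq_zero hf h0
      have e3 := (mul_eq_zero.1 e1).resolve_left e2
      rw [H f φ' y' h3'] at e3
      exact (mul_eq_zero.1 e3).resolve_left (pow_ne_zero _ h2a)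
    refine ⟨(Ideal.Quotient.lift (RingHom.ker ev) ev' hk).comp
      (RingHom.quotientKerEquivOfSurjective evs).symm.toRingHom, fun i => ?_⟩
    have e : y i = RingHom.quotientKerEquivOfSurjective evs (Ideal.Quotient.mk _ (MvPolynomial.X i)) := by
      rw [RingHom.quotientKerEquivOfSurjective_apply_mk]
      exact (MvPolynomial.aeval_X _ _).symm
    rw [e]
    simp [ev']
end NIT

end

section
namespace NIT
open Polynomial

theorem fixpt {B : Type*} [CommRing B] (I : Ideal B) [IsAdicComplete I B] (z : B) (hz : z ∈ I)
    (H : B[X]) (Q : B) : ∃ s, s = Q + z * H.eval s := by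
  let f : ℕ → B := fun n => Nat.rec 0 (fun _ s => Q + z * H.eval s) n
  have f1 : ∀ n, f (n + 1) = Q + z * H.eval (f n) := fun n => rfl
  have f2 : ∀ n, f (n + 1) - f n ∈ I ^ n := by
    intro n
    induction n with
    | zero => simp
    | succ n ih =>
      rw [f1 (n + 1), f1 n, add_sub_add_left_eq_sub, ← mul_sub,
        (evalSubFactor H (f (n + 1)) (f n)).2, pow_succ']
      exact Ideal.mul_mem_mul hz (Ideal.mul_mem_left _ _ ih)
  have f3 : ∀ {m n}, m ≤ n → f m ≡ f n [SMOD (I ^ m • ⊤ : Submodule B B)] := by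
    intro m n hmn
    induction n, hmn using Nat.le_induction with
    | base => rfl
    | succ n hn ih =>
      refine ih.trans (SModEq.symm ?_)
      rw [SModEq.sub_mem]
      simpa using Ideal.pow_le_pow_right hn (f2 n)
  obtain ⟨s, hs⟩ := IsPrecomplete.prec (inferInstance : IsPrecomplete I B) f3
  refine ⟨s, ?_⟩
  have hs' : ∀ n, f n - s ∈ I ^ n := fun n => by
    have := SModEq.sub_mem.1 (hs n)
    simpa using this
  rw [← sub_eq_zero]
  refine IsHausdorff.haus (inferInstance : IsHausdorff I B) _ fun n => ?_
  rw [SModEq.zero]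
  have h1 : s - (Q + z * H.eval s) = (f n - s) * (z * (evalSubFactor H (f n) s).1 - 1) + (f n - f (n+1)) := by
    have := (evalSubFactor H (f n) s).2
    rw [f1]
    linear_combination (z) * this
  rw [h1]
  have h2 := f2 n
  have h3 : f n - f (n+1) ∈ I ^ n := by rw [← neg_sub]; exact neg_mem h2
  simpa using add_mem (Ideal.mul_mem_right _ _ (hs' n)) h3

theorem newton {B : Type*} [CommRing B] (I : Ideal B) [IsAdicComplete I B] (z : B) (hz : z ∈ I)
    (P : B[X]) (θ b Q : B) (h : P.eval θ = z ^ 2 * b ^ 2 * (derivative P).eval θ ^ 2 * Q) :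
    ∃ s, P.eval (θ + (derivative P).eval θ * b ^ 2 * z ^ 2 * s) = 0 := by
  obtain ⟨k, hk⟩ := binomExpansion (P.map C) (C θ) X
  set e := (derivative P).eval θ with he
  have key : ∀ y, P.eval (θ + y) = P.eval θ + e * y + k.eval y * y ^ 2 := by
    intro y
    have := congrArg (Polynomial.eval y) hk
    rw [Polynomial.derivative_map, Polynomial.eval_map, Polynomial.eval_map, Polynomial.eval_map] at this
    change eval y (P.comp (C θ + X)) = eval y (P.comp (C θ) + (derivative P).comp (C θ) * X + k * X ^ 2) at this
    simpa [eval_comp, ← he] using this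
  obtain ⟨s, hs⟩ := fixpt I z hz (- C (b ^ 2 * z) * X ^ 2 * k.comp (C (e * b ^ 2 * z ^ 2) * X)) (-Q)
  refine ⟨s, ?_⟩
  rw [key, h]
  simp only [eval_mul, eval_neg, eval_C, eval_pow, eval_X, eval_comp] at hs
  linear_combination (z ^ 2 * b ^ 2 * e ^ 2) * hs

theorem newton_core {Γ B : Type*} [CommRing Γ] [CommRing B] (I : Ideal B) [IsAdicComplete I B]
    (z : B) (hz : z ∈ I) (φ : Γ[X] →+* B) (P : Γ[X]) (b : Γ) {m : ℕ} (a : Fin m → Γ[X])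
    (y : Fin m → B) (G Q0 v : B) (Q : Fin m → B) (h1 : φ P = G * Q0)
    (h2 : ∀ i, φ (a i) = φ (C b) * y i + G * Q i)
    (h3 : z ^ 2 * (φ (C b) * φ (derivative P)) ^ 2 = G * v) (hv : IsUnit v) :
    ∃ φ' : Γ[X] →+* B, φ' P = 0 ∧ φ' (C b) = φ (C b) ∧
      ∃ r : Fin m → B, ∀ i, φ' (C b) * (y i + z ^ 2 * r i) = φ' (a i) := by
  obtain ⟨w, hw⟩ := hv.exists_left_inv
  have ev : ∀ f : Γ[X], φ f = (f.map (φ.comp C)).eval (φ X) := by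
    intro f
    rw [Polynomial.eval_map]
    have : φ = eval₂RingHom (φ.comp C) (φ X) := by
      ext <;> simp
    exact congrArg (fun ψ : Γ[X] →+* B => ψ f) this
  have hG : G = w * (z ^ 2 * (φ (C b) * φ (derivative P)) ^ 2) := by
    linear_combination (-G) * hw - w * h3
  set e := φ (derivative P) with he
  set β := φ (C b) with hβ
  obtain ⟨s, hs⟩ := newton I z hz (P.map (φ.comp C)) (φ X) β (w * Q0) (by
    rw [← ev, Polynomial.derivative_map, ← ev, h1, hG, ← he]; ring)
  rw [Polynomial.derivative_map, ← ev, ← he] at hs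
  set θ' := φ X + e * β ^ 2 * z ^ 2 * s with hθ'
  let φ' : Γ[X] →+* B := eval₂RingHom (φ.comp C) θ'
  have ev' : ∀ f, φ' f = (f.map (φ.comp C)).eval θ' := fun f => by rw [Polynomial.eval_map]; rfl
  have hb : φ' (C b) = β := by simp [φ', hβ]
  refine ⟨φ', by rw [ev', hs], hb, ?_⟩
  choose k hk using fun i => (⟨_, (evalSubFactor ((a i).map (φ.comp C)) θ' (φ X)).2⟩ :
    ∃ k, ((a i).map (φ.comp C)).eval θ' - ((a i).map (φ.comp C)).eval (φ X) = k * (θ' - φ X))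
  refine ⟨fun i => w * β * e ^ 2 * Q i + e * β * s * k i, fun i => ?_⟩
  have := hk i
  rw [← ev, ← ev', h2, hG, hθ'] at this
  rw [hb]
  linear_combination -this
end NIT

end

section
namespace NIT
open Polynomial IsLocalRing

def Good (d : ℕ) (D : Type u) [CommRing D] (ξ : Fin d → D) : Prop :=
  ∃ p : ℕ, p.Prime ∧ CharP D p ∧ IsDomain D ∧ IsNoetherianRing D ∧ ∃ _ : IsLocalRing D,
    (d : WithBot ℕ∞) ≤ ringKrullDim D ∧ (∀ i, ξ i ∈ maximalIdeal D) ∧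
    maximalIdeal D ≤ (Ideal.span (Set.range ξ)).radical

def FGZ (Δ : Type u) [CommRing Δ] : Prop :=
  ∃ (m : ℕ) (f : MvPolynomial (Fin m) ℤ →+* Δ), Function.Surjective f

theorem exists_fgz {S : Type u} [CommRing S] (W : Set S) (hW : W.Finite) :
    ∃ Δ : Subring S, FGZ Δ ∧ W ⊆ Δ := by
  obtain ⟨m, y, hy⟩ : ∃ (m : ℕ) (y : Fin m → S), Set.range y = W := by
    have := hW.to_subtype
    obtain ⟨m, ⟨e⟩⟩ := Finite.exists_equiv_fin W
    exact ⟨m, fun k => (e.symm k : S), by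
      ext z
      constructor
      · rintro ⟨k, rfl⟩; exact (e.symm k).2
      · intro hz; exact ⟨e ⟨z, hz⟩, by simp⟩⟩
  let f : MvPolynomial (Fin m) ℤ →+* S := MvPolynomial.eval₂Hom (Int.castRingHom _) y
  refine ⟨f.range, ⟨m, f.rangeRestrict, f.rangeRestrict_surjective⟩, ?_⟩
  rw [← hy]
  rintro _ ⟨k, rfl⟩
  exact ⟨MvPolynomial.X k, by simp [f]⟩

theorem FGZ.adjoin {Δ : Type u} [CommRing Δ] (h : FGZ Δ) (T : Set Δ) (hT : T.Finite) :
    ∃ (m : ℕ) (y : Fin m → Δ), Algebra.adjoin ℤ (Set.range y) = ⊤ ∧ T ⊆ Set.range y := by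
  obtain ⟨m, f, hf⟩ := h
  let W : Set Δ := T ∪ Set.range fun k => f (MvPolynomial.X k)
  have hW : W.Finite := hT.union (Set.finite_range _)
  obtain ⟨m, y, hy⟩ : ∃ (m : ℕ) (y : Fin m → Δ), Set.range y = W := by
    have := hW.to_subtype
    obtain ⟨m, ⟨e⟩⟩ := Finite.exists_equiv_fin W
    exact ⟨m, fun k => (e.symm k : Δ), by
      ext z
      constructor
      · rintro ⟨k, rfl⟩; exact (e.symm k).2
      · intro hz; exact ⟨e ⟨z, hz⟩, by simp⟩⟩
  refine ⟨m, y, ?_, by rw [hy]; exact Set.subset_union_left⟩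
  rw [eq_top_iff]
  intro z _
  obtain ⟨q, rfl⟩ := hf z
  rw [hy]
  induction q using MvPolynomial.induction_on with
  | C a => 
    have : f (MvPolynomial.C a) = (a : Δ) := by
      rw [show (MvPolynomial.C a : MvPolynomial (Fin _) ℤ) = (a : MvPolynomial (Fin _) ℤ) from by simp, map_intCast]
    rw [this]
    exact intCast_mem _ _
  | add p q hp hq => rw [map_add]; exact add_mem (hp trivial) (hq trivial)
  | mul_X p k hp =>
    rw [map_mul]
    exact mul_mem (hp trivial) (Algebra.subset_adjoin (Or.inr ⟨k, rfl⟩))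

def Red (d : ℕ) (S : Type u) [CommRing S] (x : Fin d → S) : Prop :=
  ∀ (Δ : Type u) [CommRing Δ] (_ : FGZ Δ) (h : Δ →+* S) (_ : Function.Injective h) (ξ : Fin d → Δ)
    (_ : ∀ i, h (ξ i) = x i),
    ∃ (D : Type u) (_ : CommRing D) (g : Δ →+* D), Good d D (fun i => g (ξ i))

theorem Good.powerSeries {d : ℕ} {D : Type u} [CommRing D] {ξ : Fin d → D} (h : Good d D ξ)
    (η : Fin (d + 1) → PowerSeries D)
    (h0 : ∃ r, η 0 = PowerSeries.X + PowerSeries.X ^ 2 * r)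
    (hs : ∀ i : Fin d, ∃ r, η i.succ = PowerSeries.C (ξ i) + PowerSeries.X * r) :
    Good (d + 1) (PowerSeries D) η := by
  obtain ⟨p, pp, hch, hdom, hnoe, hloc, hdim, hmem, hrad⟩ := h
  have hmax : ∀ f : PowerSeries D, f ∈ maximalIdeal (PowerSeries D) ↔
      PowerSeries.constantCoeff f ∈ maximalIdeal D := by
    intro f
    rw [mem_maximalIdeal, mem_maximalIdeal, mem_nonunits_iff, mem_nonunits_iff,
      PowerSeries.isUnit_iff_constantCoeff]
  refine ⟨p, pp, charP_of_injective_ringHom (f := (PowerSeries.C : D →+* PowerSeries D))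
    PowerSeries.C_injective p, inferInstance, inferInstance, inferInstance, ?_, ?_, ?_⟩
  · refine le_trans ?_ ringKrullDim_succ_le_ringKrullDim_powerseries
    push_cast
    gcongr
  · intro i
    rw [hmax]
    refine Fin.cases ?_ (fun j => ?_) i
    · obtain ⟨r, hr⟩ := h0
      rw [hr]; simp
    · obtain ⟨r, hr⟩ := hs j
      rw [hr]; simpa using hmem j
  · set I := Ideal.span (Set.range η) with hI
    have hη : ∀ i, η i ∈ I := fun i => Ideal.subset_span ⟨i, rfl⟩
    have hX : (PowerSeries.X : PowerSeries D) ∈ I := by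
      obtain ⟨r, hr⟩ := h0
      have hu : IsUnit (1 + PowerSeries.X * r) := by
        rw [PowerSeries.isUnit_iff_constantCoeff]; simp
      rw [← Ideal.mul_unit_mem_iff_mem I hu]
      convert hη 0 using 1
      rw [hr]; ring
    have hC : ∀ i, PowerSeries.C (ξ i) ∈ I := by
      intro i
      obtain ⟨r, hr⟩ := hs i
      rw [← add_sub_cancel_right (PowerSeries.C (ξ i)) (PowerSeries.X * r), ← hr]
      exact sub_mem (hη _) (Ideal.mul_mem_right _ _ hX)
    have hC2 : Ideal.span (Set.range ξ) ≤ I.comap (PowerSeries.C : D →+* PowerSeries D) := by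
      rw [Ideal.span_le]
      rintro _ ⟨i, rfl⟩
      exact hC i
    intro f hf
    rw [hmax] at hf
    rw [PowerSeries.eq_X_mul_shift_add_const f]
    refine add_mem (Ideal.le_radical (Ideal.mul_mem_right _ _ hX)) ?_
    obtain ⟨n, hn⟩ := hrad hf
    refine ⟨n, ?_⟩
    rw [← map_pow]
    exact hC2 hn

theorem red_step1 {d : ℕ} {S : Type u} [CommRing S] (x : Fin d → S) (hred : Red d S x)
    {J : Type u} [Finite J] (φ : (MvPolynomial J ℤ)[X] →+* S[X]) (P : (MvPolynomial J ℤ)[X])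
    (b : MvPolynomial J ℤ) {m : ℕ} (a : Fin m → (MvPolynomial J ℤ)[X])
    (y : Fin m → S[X]) (G Q0 v : S[X]) (Q : Fin m → S[X]) (hG : G.Monic) (h1 : φ P = G * Q0)
    (h2 : ∀ i, φ (a i) = φ (C b) * y i + G * Q i)
    (h3 : X ^ 2 * (φ (C b) * φ (derivative P)) ^ 2 = G * v) (hv : IsUnit (v.coeff 0)) :
    ∃ (D : Type u) (_ : CommRing D) (ξ : Fin d → D), Good d D ξ ∧
      ∃ (φ' : (MvPolynomial J ℤ)[X] →+* PowerSeries D) (y' : Fin m → PowerSeries D),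
        φ' P = 0 ∧ φ' (C b) ≠ 0 ∧ (∀ i, φ' (C b) * y' i = φ' (a i)) ∧
        (∀ i, y i = X → ∃ r : PowerSeries D, y' i = PowerSeries.X + PowerSeries.X ^ 2 * r) ∧
        (∀ i j, (y i).coeff 0 = x j → ∃ r : PowerSeries D, y' i = PowerSeries.C (ξ j) + PowerSeries.X * r) := by
  classical
  obtain ⟨w, hw⟩ := hv.exists_left_inv
  let T : Set S[X] := (Set.range fun j => φ (C (MvPolynomial.X j))) ∪ Set.range y ∪ Set.range Q ∪
    {φ X, G, Q0, v}
  have hT : T.Finite := by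
    refine (((Set.finite_range _).union (Set.finite_range _)).union (Set.finite_range _)).union ?_
    simp
  let W : Set S := (⋃ q ∈ T, (q.coeffs : Set S)) ∪ Set.range x ∪ {w}
  have hW : W.Finite := ((hT.biUnion fun q _ => q.coeffs.finite_toSet).union
    (Set.finite_range _)).union (Set.finite_singleton _)
  obtain ⟨Δ, hΔ, hWΔ⟩ := exists_fgz W hW
  have hx : ∀ i, x i ∈ Δ := fun i => hWΔ (Or.inl (Or.inr ⟨i, rfl⟩))
  have hwΔ : w ∈ Δ := hWΔ (Or.inr rfl)
  let ι : Δ[X] →+* S[X] := mapRingHom Δ.subtype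
  have hι : Function.Injective ι := Polynomial.map_injective _ Subtype.val_injective
  have lift : ∀ q ∈ T, ∃ q' : Δ[X], ι q' = q := by
    intro q hq
    have : q ∈ Polynomial.lifts Δ.subtype := by
      rw [lifts_iff_coeff_lifts]
      intro n
      by_cases h0 : q.coeff n = 0
      · exact ⟨0, by rw [h0, map_zero]⟩
      · exact ⟨⟨q.coeff n, hWΔ (Or.inl (Or.inl (Set.mem_biUnion hq (coeff_mem_coeffs h0))))⟩, rfl⟩
    exact (mem_lifts q).1 this
  choose t ht using fun j => lift (φ (C (MvPolynomial.X j))) (Or.inl (Or.inl (Or.inl ⟨j, rfl⟩)))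
  choose y1 hy1 using fun i => lift (y i) (Or.inl (Or.inl (Or.inr ⟨i, rfl⟩)))
  choose Q1 hQ1 using fun i => lift (Q i) (Or.inl (Or.inr ⟨i, rfl⟩))
  obtain ⟨θ, hθ⟩ := lift (φ X) (Or.inr (by simp))
  obtain ⟨G1, hG1⟩ := lift G (Or.inr (by simp))
  obtain ⟨Q01, hQ01⟩ := lift Q0 (Or.inr (by simp))
  obtain ⟨v1, hv1⟩ := lift v (Or.inr (by simp))
  let φ1 : (MvPolynomial J ℤ)[X] →+* Δ[X] :=
    eval₂RingHom (MvPolynomial.eval₂Hom (Int.castRingHom _) t) θ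
  have hφ1 : ∀ f, ι (φ1 f) = φ f := by
    have : ι.comp φ1 = φ := by
      apply Polynomial.ringHom_ext'
      · apply MvPolynomial.ringHom_ext'
        · exact RingHom.ext_int _ _
        · intro j
          simp [φ1, ht]
      · simp [φ1, hθ]
    intro f
    rw [← this]; rfl
  obtain ⟨D, _, g, hgood⟩ := hred Δ hΔ Δ.subtype Subtype.val_injective (fun i => ⟨x i, hx i⟩) (fun i => rfl)
  have hnt : Nontrivial D := by
    obtain ⟨p, pp, hch, hdom, -⟩ := hgood
    infer_instance
  have hdom : IsDomain D := by
    obtain ⟨p, pp, hch, hdom, -⟩ := hgood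
    exact hdom
  let ψ : Δ[X] →+* PowerSeries D := (coeToPowerSeries.ringHom).comp (mapRingHom g)
  have hψX : ψ X = PowerSeries.X := by simp [ψ]
  have hψc : ∀ q, PowerSeries.constantCoeff (ψ q) = g (q.coeff 0) := by
    intro q
    rw [← PowerSeries.coeff_zero_eq_constantCoeff_apply]
    change PowerSeries.coeff 0 ((q.map g : D[X]) : PowerSeries D) = _
    rw [Polynomial.coeff_coe, coeff_map]
  have hG1m : G1.Monic := by
    have : (G1.map Δ.subtype).Monic := by
      change (ι G1).Monic
      rw [hG1]; exact hG
    exact Polynomial.monic_of_injective Subtype.val_injective this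
  have hψG : ψ G1 ≠ 0 := by
    intro h
    exact (hG1m.map g).ne_zero (Polynomial.coe_eq_zero_iff.1 h)
  have hkey : X ^ 2 * (φ1 (C b) * φ1 (derivative P)) ^ 2 = G1 * v1 := by
    apply hι
    rw [map_mul, map_mul, map_pow, map_pow, map_mul, hφ1, hφ1, hG1, hv1, ← h3]
    simp [ι]
  have hcv : (v1.coeff 0 : S) = v.coeff 0 := by
    rw [← hv1]; simp [ι]
  have hψv : IsUnit (ψ v1) := by
    rw [PowerSeries.isUnit_iff_constantCoeff, hψc]
    have : IsUnit (v1.coeff 0) := by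
      refine IsUnit.of_mul_eq_one_right (⟨w, hwΔ⟩ : Δ) (Subtype.ext ?_)
      change w * (v1.coeff 0 : S) = 1
      rw [hcv, hw]
    exact this.map g
  obtain ⟨φ', e1, e2, r, e3⟩ := newton_core
    (Ideal.span (Set.range (MvPowerSeries.X : Unit → MvPowerSeries Unit D)) : Ideal (PowerSeries D))
    PowerSeries.X (Ideal.subset_span ⟨(), rfl⟩) (ψ.comp φ1) P b a (fun i => ψ (y1 i)) (ψ G1) (ψ Q01)
    (ψ v1) (fun i => ψ (Q1 i))
    (by
      rw [← map_mul, RingHom.comp_apply]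
      congr 1
      apply hι
      rw [hφ1, map_mul, hG1, hQ01, h1])
    (by
      intro i
      simp only [RingHom.comp_apply]
      rw [← map_mul, ← map_mul, ← map_add]
      congr 1
      apply hι
      rw [map_add, map_mul, map_mul, hφ1, hφ1, hG1, hQ1, hy1, h2])
    (by
      have h4 := congrArg ψ hkey
      rw [map_mul, map_mul, map_pow, map_pow, map_mul, hψX] at h4
      exact h4) hψv
  refine ⟨D, _, _, hgood, φ', fun i => ψ (y1 i) + PowerSeries.X ^ 2 * r i, e1, ?_, e3, ?_, ?_⟩
  · rw [e2]
    intro h0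
    have h4 := congrArg ψ hkey
    rw [RingHom.comp_apply] at h0
    rw [map_mul, map_mul, map_pow, map_pow, map_mul, h0, zero_mul, zero_pow two_ne_zero, mul_zero] at h4
    exact hψG ((hψv.mul_left_eq_zero).1 h4.symm)
  · intro i hi
    have : y1 i = X := hι (by rw [hy1, hi]; simp [ι])
    exact ⟨r i, by simp only [this, hψX]⟩
  · intro i j hij
    have : PowerSeries.constantCoeff (ψ (y1 i)) = g ⟨x j, hx j⟩ := by
      rw [hψc]
      congr 1
      apply Subtype.ext
      refine Eq.trans ?_ hij
      rw [← hy1]; simp [ι]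
    refine ⟨PowerSeries.mk (fun p => PowerSeries.coeff (p + 1) (ψ (y1 i))) + PowerSeries.X * r i, ?_⟩
    change ψ (y1 i) + PowerSeries.X ^ 2 * r i = _
    conv_lhs => rw [PowerSeries.eq_X_mul_shift_add_const (ψ (y1 i)), this]
    ring

theorem wdiv_dvd {S : Type*} [CommRing S] {I : Ideal S} [IsAdicComplete I S] (G : S[X])
    (hG : G.IsDistinguishedAt I) (q : S[X])
    (h : (G : PowerSeries S) ∣ (q : PowerSeries S)) : G ∣ q := by
  rw [← Ideal.mem_span_singleton, ← Ideal.Quotient.eq_zero_iff_mem] at h ⊢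
  apply hG.algEquivQuotient.injective
  rw [map_zero, ← h]
  rw [Polynomial.IsDistinguishedAt.algEquivQuotient_apply]
  rfl

theorem wdiv_exists {S : Type*} [CommRing S] {I : Ideal S} [IsAdicComplete I S] (G : S[X])
    (hG : G.IsDistinguishedAt I) (f : PowerSeries S) :
    ∃ q : S[X], (∃ h, f = (q : PowerSeries S) + G * h) ∧
      ∀ q0 : S[X], f = (q0 : PowerSeries S) → q = q0 := by
  by_cases hf : ∃ q0 : S[X], f = (q0 : PowerSeries S)
  · obtain ⟨q0, rfl⟩ := hf
    exact ⟨q0, ⟨0, by simp⟩, fun q1 h => Polynomial.coe_injective _ h⟩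
  · obtain ⟨h⟩ := hG.isWeierstrassDivisorAt'.isWeierstrassDivisionAt_div_mod f
    exact ⟨_, ⟨_, by rw [add_comm]; assumption⟩, fun q0 h0 => absurd ⟨q0, h0⟩ hf⟩

theorem red_step {d : ℕ} {S : Type u} [CommRing S] [IsDomain S] [CharZero S] [IsLocalRing S]
    [IsAdicComplete (maximalIdeal S) S] (x : Fin d → S) (hred : Red d S x)
    (hreg : ∀ E : PowerSeries S, E ≠ 0 → ∃ τ : PowerSeries S →+* PowerSeries S,
      τ PowerSeries.X = PowerSeries.X ∧
      (∀ i, ∃ c : S, τ (PowerSeries.C (x i)) = PowerSeries.C (x i) + PowerSeries.C c * PowerSeries.X) ∧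
      (τ E).map (residue S) ≠ 0) :
    Red (d + 1) (PowerSeries S) (Fin.cons PowerSeries.X (fun i => PowerSeries.C (x i))) := by
  classical
  intro Δ _ hΔ h0 h0i ξ0 hx
  obtain ⟨m, y, hy, hyT⟩ := hΔ.adjoin (Set.range ξ0) (Set.finite_range _)
  have hk : ∀ i, ∃ k, y k = ξ0 i := fun i => hyT ⟨i, rfl⟩
  haveI : IsDomain Δ := h0i.isDomain h0
  haveI : CharZero (PowerSeries S) := charZero_of_injective_ringHom
    (f := (PowerSeries.C : S →+* PowerSeries S)) PowerSeries.C_injective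
  haveI : CharZero Δ := charZero_of_injective_ringHom
    (f := (Int.castRingHom Δ)) (by
      have : Function.Injective (Int.castRingHom (PowerSeries S)) := Int.cast_injective
      have e : Int.castRingHom (PowerSeries S) = h0.comp (Int.castRingHom Δ) :=
        RingHom.ext_int _ _
      rw [e] at this
      exact Function.Injective.of_comp this)
  obtain ⟨J, _, φ, P, b, a, p1, p2, p3, p4, p5⟩ := pl2 Δ y hy
  obtain ⟨τ, t1, t2, t3⟩ := hreg (h0 ((φ (C b) * φ (derivative P)) ^ 2))
    (by
      have : (φ (C b) * φ (derivative P)) ^ 2 ≠ 0 := pow_ne_zero _ (mul_ne_zero p3 p2)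
      exact fun h => this (h0i (by rw [h, map_zero])))
  let σ : Δ →+* PowerSeries S := τ.comp h0
  have hres : (PowerSeries.X ^ 2 * σ ((φ (C b) * φ (derivative P)) ^ 2)).map (residue S) ≠ 0 := by
    rw [map_mul, map_pow, PowerSeries.map_X]
    exact mul_ne_zero (pow_ne_zero _ PowerSeries.X_ne_zero) t3
  obtain ⟨G, w, hW⟩ := PowerSeries.exists_isWeierstrassFactorization hres
  have hGd := hW.isDistinguishedAt
  choose o ho1 ho2 using wdiv_exists G hGd
  have ho3 : ∀ q : S[X], o q = q := fun q => ho2 _ q rfl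
  let φ0 : (MvPolynomial J ℤ)[X] →+* S[X] := eval₂RingHom
    (MvPolynomial.eval₂Hom (Int.castRingHom _) fun j => o (σ (φ (C (MvPolynomial.X j))))) (o (σ (φ X)))
  let π := Ideal.Quotient.mk (Ideal.span {(G : PowerSeries S)})
  have hπ : ∀ f, π (o f) = π f := by
    intro f
    obtain ⟨h, hh⟩ := ho1 f
    conv_rhs => rw [hh]
    rw [map_add, map_mul, (Ideal.Quotient.eq_zero_iff_mem (I := Ideal.span {(G : PowerSeries S)})).2
      (Ideal.mem_span_singleton_self _), zero_mul, add_zero]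
  have hcong : ∀ f, π (φ0 f) = π (σ (φ f)) := by
    have : (π.comp coeToPowerSeries.ringHom).comp φ0 = π.comp (σ.comp φ) := by
      apply Polynomial.ringHom_ext'
      · apply MvPolynomial.ringHom_ext'
        · exact RingHom.ext_int _ _
        · intro j
          simp only [RingHom.comp_apply, φ0, coe_eval₂RingHom, eval₂_C, MvPolynomial.eval₂Hom_X']
          exact hπ _
      · simp only [RingHom.comp_apply, φ0, coe_eval₂RingHom, eval₂_X]
        exact hπ _
    intro f
    exact congrArg (fun ψ => ψ f) this
  have hπ0 : ∀ f, π f = 0 → (G : PowerSeries S) ∣ f := fun f hf =>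
    Ideal.mem_span_singleton.1 (Ideal.Quotient.eq_zero_iff_mem.1 hf)
  obtain ⟨Q0, hQ0⟩ := wdiv_dvd G hGd (φ0 P) (hπ0 _ (by rw [hcong, p1]; simp))
  have hQ : ∀ i, ∃ Q, φ0 (a i) = φ0 (C b) * o (σ (y i)) + G * Q := by
    intro i
    obtain ⟨Q, hQ⟩ := wdiv_dvd G hGd (φ0 (a i) - φ0 (C b) * o (σ (y i))) (hπ0 _ (by
      rw [Polynomial.coe_sub, Polynomial.coe_mul, map_sub, map_mul, hcong, hcong, hπ, ← map_mul,
        ← map_mul, p4, sub_self]))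
    exact ⟨Q, by rw [← hQ]; ring⟩
  choose Q hQ using hQ
  obtain ⟨h', hh'⟩ : (G : PowerSeries S) ∣ ((φ0 (C b) * φ0 (derivative P)) ^ 2 : S[X]) -
      σ ((φ (C b) * φ (derivative P)) ^ 2) := by
    apply hπ0
    rw [map_sub, Polynomial.coe_pow, Polynomial.coe_mul, map_pow, map_mul, hcong, hcong,
      ← map_mul, ← map_mul, ← map_pow, ← map_pow, sub_self]
  have hv1 : (↑(X ^ 2 * (φ0 (C b) * φ0 (derivative P)) ^ 2 : S[X]) : PowerSeries S) =
      (G : PowerSeries S) * (w + PowerSeries.X ^ 2 * h') := by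
    have := hW.eq_mul
    rw [Polynomial.coe_mul, Polynomial.coe_pow, Polynomial.coe_X]
    linear_combination PowerSeries.X ^ 2 * hh' + this
  obtain ⟨v, hv⟩ := wdiv_dvd G hGd _ ⟨_, hv1⟩
  have hG0 : (G : PowerSeries S) ≠ 0 := by
    rw [Ne, Polynomial.coe_eq_zero_iff]; exact hGd.monic.ne_zero
  have hvw : (v : PowerSeries S) = w + PowerSeries.X ^ 2 * h' := by
    rw [hv, Polynomial.coe_mul] at hv1
    exact mul_left_cancel₀ hG0 hv1
  have hvu : IsUnit (v.coeff 0) := by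
    rw [← Polynomial.coeff_coe, hvw, PowerSeries.coeff_zero_eq_constantCoeff_apply]
    simpa using PowerSeries.isUnit_iff_constantCoeff.1 hW.isUnit
  obtain ⟨D, _, ξ, hgood, φ', y', q1, q2, q3, q4, q5⟩ := red_step1 x hred φ0 P b a
    (fun i => o (σ (y i))) G Q0 v Q hGd.monic hQ0 hQ hv hvu
  have hD : IsDomain D := by
    obtain ⟨p, pp, hch, hdom, -⟩ := hgood
    exact hdom
  obtain ⟨g, hg⟩ := p5 (PowerSeries D) φ' y' q1 q2 q3
  refine ⟨PowerSeries D, inferInstance, g, hgood.powerSeries _ ?_ ?_⟩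
  · obtain ⟨k, hk0⟩ := hk 0
    rw [← hk0, hg]
    apply q4
    rw [hk0]
    change o (τ (h0 (ξ0 0))) = X
    rw [hx, Fin.cons_zero, t1, ← Polynomial.coe_X, ho3]
  · intro i
    obtain ⟨k, hk0⟩ := hk i.succ
    rw [← hk0, hg]
    apply q5
    rw [hk0]
    obtain ⟨c, hc⟩ := t2 i
    change (o (τ (h0 (ξ0 i.succ)))).coeff 0 = x i
    have : PowerSeries.C (x i) + PowerSeries.C c * PowerSeries.X = ((C (x i) + C c * X : S[X]) : PowerSeries S) := by
      simp
    rw [hx, Fin.cons_succ, hc, this, ho3]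
    simp
end NIT

end

section
namespace NIT
open IsLocalRing

theorem mv_span {k : Type u} [Field k] : ∀ (d : ℕ) (f : MvPowerSeries (Fin d) k),
    MvPowerSeries.constantCoeff f = 0 → f ∈ Ideal.span (Set.range (MvPowerSeries.X : Fin d → _)) := by
  intro d
  induction d with
  | zero =>
    intro f hf
    have : f = 0 := by
      ext m
      rw [Subsingleton.elim m 0, MvPowerSeries.coeff_zero_eq_constantCoeff_apply, hf, map_zero]
    rw [this]; exact zero_mem _
  | succ d ih =>
    intro f hf
    let e := MvPowerSeries.finSuccEquiv k d
    have h1 : MvPowerSeries.constantCoeff (PowerSeries.constantCoeff (e f)) = 0 := by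
      rw [← PowerSeries.coeff_zero_eq_constantCoeff_apply, ← MvPowerSeries.coeff_zero_eq_constantCoeff_apply,
        MvPowerSeries.coeff_coeff_finSuccEquiv, Finsupp.cons_zero_zero,
        MvPowerSeries.coeff_zero_eq_constantCoeff_apply, hf]
    have h2 := ih _ h1
    have h3 : Ideal.span (Set.range (MvPowerSeries.X : Fin d → MvPowerSeries (Fin d) k)) ≤
        (Ideal.span (Set.range (MvPowerSeries.X : Fin (d+1) → _))).comap
          (e.symm.toRingEquiv.toRingHom.comp PowerSeries.C) := by
      rw [Ideal.span_le]
      rintro _ ⟨j, rfl⟩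
      refine Ideal.subset_span ⟨j.succ, ?_⟩
      change _ = e.symm (PowerSeries.C (MvPowerSeries.X j))
      rw [← MvPowerSeries.finSuccEquiv_X_succ, AlgEquiv.symm_apply_apply]
    rw [← e.symm_apply_apply f, PowerSeries.eq_X_mul_shift_add_const (e f), map_add, map_mul]
    refine add_mem (Ideal.mul_mem_right _ _ (Ideal.subset_span ⟨0, ?_⟩)) (h3 h2)
    rw [← MvPowerSeries.finSuccEquiv_X_zero, AlgEquiv.symm_apply_apply]

theorem mv_max {k : Type u} [Field k] (d : ℕ) :
    maximalIdeal (MvPowerSeries (Fin d) k) = Ideal.span (Set.range MvPowerSeries.X) := by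
  have : ∀ f : MvPowerSeries (Fin d) k, f ∈ maximalIdeal _ ↔ MvPowerSeries.constantCoeff f = 0 := by
    intro f
    rw [mem_maximalIdeal, mem_nonunits_iff, MvPowerSeries.isUnit_iff_constantCoeff, isUnit_iff_ne_zero,
      not_not]
  apply le_antisymm
  · intro f hf
    exact mv_span d f ((this f).1 hf)
  · rw [Ideal.span_le]
    rintro _ ⟨j, rfl⟩
    rw [SetLike.mem_coe, this]
    simp

instance mv_complete {k : Type u} [Field k] (d : ℕ) :
    IsAdicComplete (maximalIdeal (MvPowerSeries (Fin d) k)) (MvPowerSeries (Fin d) k) := by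
  rw [mv_max]; infer_instance

theorem exists_eval {k : Type u} [Field k] [Infinite k] {d n : ℕ} (q : MvPolynomial (Fin (d + 1)) k)
    (hq : q.IsHomogeneous n) (h0 : q ≠ 0) : ∃ c : Fin (d + 1) → k, c 0 = 1 ∧ MvPolynomial.eval c q ≠ 0 := by
  have h1 : q * MvPolynomial.X 0 ≠ 0 := mul_ne_zero h0 (MvPolynomial.X_ne_zero _)
  obtain ⟨a, ha⟩ : ∃ a, MvPolynomial.eval a (q * MvPolynomial.X 0) ≠ 0 := by
    by_contra! h
    exact h1 (MvPolynomial.funext (fun x => by rw [h x, map_zero]))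
  rw [map_mul, MvPolynomial.eval_X] at ha
  refine ⟨fun i => (a 0)⁻¹ * a i, inv_mul_cancel₀ (right_ne_zero_of_mul ha), ?_⟩
  have : MvPolynomial.eval (fun i => (a 0)⁻¹ * a i) q = (a 0)⁻¹ ^ n * MvPolynomial.eval a q := by
    rw [MvPolynomial.eval_eq, MvPolynomial.eval_eq, Finset.mul_sum]
    apply Finset.sum_congr rfl
    intro m hm
    have : m.degree = n := by
      have := hq (MvPolynomial.mem_support_iff.1 hm)
      rw [Finsupp.degree_eq_weight_one]
      exact this
    rw [← this, Finsupp.degree_apply, ← Finset.prod_pow_eq_pow_sum]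
    simp_rw [mul_pow]
    rw [Finset.prod_mul_distrib]
    ring
  rw [this]
  exact mul_ne_zero (pow_ne_zero _ (inv_ne_zero (right_ne_zero_of_mul ha))) (left_ne_zero_of_mul ha)

theorem mv_reg {k : Type u} [Field k] [Infinite k] (d : ℕ) (E : PowerSeries (MvPowerSeries (Fin d) k))
    (hE : E ≠ 0) : ∃ τ : PowerSeries (MvPowerSeries (Fin d) k) →+* PowerSeries (MvPowerSeries (Fin d) k),
      τ PowerSeries.X = PowerSeries.X ∧
      (∀ i, ∃ c : MvPowerSeries (Fin d) k, τ (PowerSeries.C (MvPowerSeries.X i)) =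
        PowerSeries.C (MvPowerSeries.X i) + PowerSeries.C c * PowerSeries.X) ∧
      (τ E).map (residue _) ≠ 0 := by
  classical
  let e := MvPowerSeries.finSuccEquiv k d
  let f := e.symm E
  have hf : f ≠ 0 := fun h => hE (by rw [← e.apply_symm_apply E]; change e f = 0; rw [h, map_zero])
  obtain ⟨m0, hm0⟩ : ∃ m, MvPowerSeries.coeff m f ≠ 0 := by
    by_contra! h
    exact hf (MvPowerSeries.ext (fun m => by rw [h m, map_zero]))
  set n := m0.degree with hn
  let q : MvPolynomial (Fin (d+1)) k := ∑ m ∈ Finset.finsuppAntidiag Finset.univ n,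
    MvPolynomial.monomial m (MvPowerSeries.coeff m f)
  have hmem : ∀ m : Fin (d+1) →₀ ℕ, m ∈ Finset.finsuppAntidiag Finset.univ n ↔ m.degree = n := by
    intro m
    rw [Finset.mem_finsuppAntidiag, Finsupp.degree_eq_sum]
    simp
  have hqh : q.IsHomogeneous n := by
    apply MvPolynomial.IsHomogeneous.sum
    intro m hm
    exact MvPolynomial.isHomogeneous_monomial _ ((hmem m).1 hm)
  have hq0 : q ≠ 0 := by
    intro h
    apply hm0
    have := congrArg (MvPolynomial.coeff m0) h
    rw [MvPolynomial.coeff_sum] at this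
    simp only [MvPolynomial.coeff_monomial] at this
    rw [Finset.sum_ite_eq', if_pos ((hmem m0).2 rfl)] at this
    simpa using this
  obtain ⟨c, hc0, hc⟩ := exists_eval q hqh hq0
  let a : Fin (d + 1) → MvPowerSeries (Fin (d + 1)) k :=
    Fin.cons (MvPowerSeries.X 0) fun j => MvPowerSeries.X j.succ + MvPowerSeries.C (c j.succ) * MvPowerSeries.X 0
  have ha : MvPowerSeries.HasSubst a := by
    apply MvPowerSeries.hasSubst_of_constantCoeff_zero
    intro s
    refine Fin.cases ?_ (fun j => ?_) s
    · simp [a]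
    · simp [a]
  let τ0 : MvPowerSeries (Fin (d + 1)) k →ₐ[k] MvPowerSeries (Fin (d + 1)) k := MvPowerSeries.substAlgHom ha
  have hτ0 : ∀ s, τ0 (MvPowerSeries.X s) = a s := fun s => MvPowerSeries.substAlgHom_X ha s
  let τ := (e.toRingEquiv.toRingHom.comp τ0.toRingHom).comp e.symm.toRingEquiv.toRingHom
  have hτ : ∀ z, τ z = e (τ0 (e.symm z)) := fun z => rfl
  refine ⟨τ, ?_, ?_, ?_⟩
  · rw [hτ, ← MvPowerSeries.finSuccEquiv_X_zero, AlgEquiv.symm_apply_apply, hτ0]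
    simp [a, e]
  · intro i
    refine ⟨MvPowerSeries.C (c i.succ), ?_⟩
    rw [hτ, ← MvPowerSeries.finSuccEquiv_X_succ, AlgEquiv.symm_apply_apply, hτ0]
    simp only [a, Fin.cons_succ, map_add, map_mul]
    rw [MvPowerSeries.finSuccEquiv_X_zero, MvPowerSeries.finSuccEquiv_C]
  · intro h
    apply hc
    let ρ : MvPowerSeries (Fin (d + 1)) k →+* PowerSeries k :=
      (PowerSeries.map (MvPowerSeries.constantCoeff (σ := Fin d) (R := k))).comp e.toRingEquiv.toRingHom
    have hρ : ∀ z j, PowerSeries.coeff j (ρ z) = MvPowerSeries.coeff (Finsupp.cons j 0) z := by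
      intro z j
      change PowerSeries.coeff j (PowerSeries.map MvPowerSeries.constantCoeff (e z)) = _
      rw [PowerSeries.coeff_map, ← MvPowerSeries.coeff_zero_eq_constantCoeff_apply,
        MvPowerSeries.coeff_coeff_finSuccEquiv]
    have hρa : ∀ s, ρ (a s) = PowerSeries.C (c s) * PowerSeries.X := by
      intro s
      change PowerSeries.map MvPowerSeries.constantCoeff (e _) = _
      refine Fin.cases ?_ (fun j => ?_) s
      · simp only [a, Fin.cons_zero, e]
        rw [MvPowerSeries.finSuccEquiv_X_zero, hc0]
        simp
      · simp only [a, Fin.cons_succ, e, map_add, map_mul]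
        rw [MvPowerSeries.finSuccEquiv_X_zero, MvPowerSeries.finSuccEquiv_X_succ, MvPowerSeries.finSuccEquiv_C]
        simp
    have h1 : MvPowerSeries.coeff (Finsupp.cons n 0) (τ0 f) = 0 := by
      rw [← hρ]
      change PowerSeries.coeff n (PowerSeries.map MvPowerSeries.constantCoeff (e (τ0 f))) = 0
      have := congrArg (PowerSeries.coeff n) h
      rw [PowerSeries.coeff_map, map_zero, residue_eq_zero_iff, mem_maximalIdeal, mem_nonunits_iff,
        MvPowerSeries.isUnit_iff_constantCoeff, isUnit_iff_ne_zero, not_not] at this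
      rw [PowerSeries.coeff_map]
      exact this
    have h2 : ∀ m : Fin (d+1) →₀ ℕ, MvPowerSeries.coeff (Finsupp.cons n 0) (m.prod fun s e => a s ^ e) =
        if m.degree = n then ∏ s, c s ^ m s else 0 := by
      intro m
      rw [← hρ, Finsupp.prod_fintype _ _ (by simp), map_prod]
      simp_rw [map_pow, hρa, mul_pow]
      rw [Finset.prod_mul_distrib, Finset.prod_pow_eq_pow_sum, ← Finsupp.degree_eq_sum]
      simp_rw [← map_pow]
      rw [← map_prod, PowerSeries.coeff_C_mul, PowerSeries.coeff_X_pow]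
      by_cases hmn : m.degree = n
      · simp [hmn]
      · simp [hmn, Ne.symm hmn]
    rw [← h1]
    change _ = MvPowerSeries.coeff _ (MvPowerSeries.substAlgHom ha f)
    rw [MvPowerSeries.substAlgHom_apply, MvPowerSeries.coeff_subst ha,
      finsum_eq_sum_of_support_subset (s := Finset.finsuppAntidiag Finset.univ n)]
    · rw [map_sum]
      apply Finset.sum_congr rfl
      intro m hm
      rw [h2, if_pos ((hmem m).1 hm), MvPolynomial.eval_monomial, Finsupp.prod_fintype _ _ (by simp)]
      rfl
    · intro m hm
      rw [Finset.mem_coe, hmem]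
      by_contra hne
      rw [Function.mem_support, h2, if_neg hne] at hm
      simp at hm

theorem Red.equiv {d : ℕ} {S T : Type u} [CommRing S] [CommRing T] (e : S ≃+* T) {x : Fin d → S}
    (h : Red d S x) : Red d T (fun i => e (x i)) := by
  intro Δ _ hΔ g hg ξ hξ
  exact h Δ hΔ (e.symm.toRingHom.comp g) (e.symm.injective.comp hg) ξ
    (fun i => by
      change e.symm (g (ξ i)) = _
      rw [hξ, RingEquiv.symm_apply_apply])

theorem jac_int : IsJacobsonRing ℤ := by
  rw [isJacobsonRing_iff_prime_eq]
  intro P hP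
  by_cases h : P = ⊥
  · subst h
    rw [eq_bot_iff]
    intro x hx
    have := (Ideal.mem_jacobson_bot.1 hx) x
    rw [Int.isUnit_iff] at this
    rcases this with h | h
    · have : x * x = 0 := by linarith
      simpa using this
    · nlinarith [mul_self_nonneg x]
  · have := hP.isMaximal h
    exact Ideal.jacobson_eq_self_of_isMaximal

theorem red_zero {k : Type u} [Field k] [CharZero k] (x : Fin 0 → k) : Red 0 k x := by
  intro Δ _ hΔ g hg ξ hξ
  haveI : Nontrivial Δ := g.domain_nontrivial
  haveI := jac_int
  obtain ⟨M, hM⟩ := Ideal.exists_maximal Δ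
  letI : Field (Δ ⧸ M) := Ideal.Quotient.field M
  obtain ⟨m, f, hf⟩ := hΔ
  have hintg := MvPolynomial.comp_C_integral_of_surjective_of_isJacobsonRing
    ((Ideal.Quotient.mk M).comp f) (Ideal.Quotient.mk_surjective.comp hf)
  obtain ⟨p, hp⟩ := CharP.exists (Δ ⧸ M)
  have hp0 : p ≠ 0 := by
    rintro rfl
    have : CharZero (Δ ⧸ M) := CharP.charP_to_charZero _
    have hfield : IsField ℤ := by
      letI := (((Ideal.Quotient.mk M).comp f).comp MvPolynomial.C).toAlgebra
      haveI : Algebra.IsIntegral ℤ (Δ ⧸ M) := ⟨hintg⟩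
      refine isField_of_isIntegral_of_isField (R := ℤ) (S := Δ ⧸ M) ?_ (Field.toIsField _)
      have e : algebraMap ℤ (Δ ⧸ M) = Int.castRingHom _ := RingHom.ext_int _ _
      rw [e]
      exact Int.cast_injective
    exact Int.not_isField hfield
  have hpp : p.Prime := (CharP.char_is_prime_or_zero (Δ ⧸ M) p).resolve_right hp0
  refine ⟨Δ ⧸ M, inferInstance, Ideal.Quotient.mk M, p, hpp, hp, inferInstance, inferInstance,
    inferInstance, ?_, fun i => i.elim0, ?_⟩
  · simpa using ringKrullDim_nonneg_of_nontrivial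
  · rw [IsLocalRing.maximalIdeal_eq_bot]
    exact bot_le

theorem red_mv (k : Type u) [Field k] [CharZero k] :
    ∀ d, Red d (MvPowerSeries (Fin d) k) MvPowerSeries.X := by
  intro d
  induction d with
  | zero =>
    intro Δ _ hΔ g hg ξ hξ
    refine red_zero (k := k) (fun i => i.elim0) Δ hΔ (MvPowerSeries.constantCoeff.comp g) ?_ ξ (fun i => i.elim0)
    rw [RingHom.coe_comp]
    refine Function.Injective.comp (g := MvPowerSeries.constantCoeff) ?_ hg
    intro f f' h
    ext m
    rw [Subsingleton.elim m 0]
    exact h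
  | succ d ih =>
    haveI : CharZero (MvPowerSeries (Fin d) k) := charZero_of_injective_ringHom
      (f := (MvPowerSeries.C : k →+* MvPowerSeries (Fin d) k)) MvPowerSeries.C_injective
    haveI : IsDomain (MvPowerSeries (Fin d) k) := NoZeroDivisors.to_isDomain _
    have := (red_step _ ih (mv_reg d)).equiv (MvPowerSeries.finSuccEquiv k d).symm.toRingEquiv
    convert this using 1
    funext i
    symm
    change (MvPowerSeries.finSuccEquiv k d).symm _ = _
    rw [AlgEquiv.symm_apply_eq]
    refine Fin.cases ?_ (fun j => ?_) i
    · rw [MvPowerSeries.finSuccEquiv_X_zero]; rfl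
    · rw [MvPowerSeries.finSuccEquiv_X_succ]; rfl
end NIT

end

section
namespace NIT
open IsLocalRing

theorem height_integral {D B : Type*} [CommRing D] [CommRing B] [Algebra D B] [Algebra.IsIntegral D B]
    (hinj : Function.Injective (algebraMap D B)) (n : ℕ) : ∀ (P : Ideal D) [P.IsPrime], (n : ℕ∞) ≤ P.height →
      ∃ Q : Ideal B, Q.IsPrime ∧ Q.comap (algebraMap D B) = P ∧ (n : ℕ∞) ≤ Q.height := by
  induction n with
  | zero =>
    intro P _ h
    obtain ⟨Q, -, hQ, hc⟩ := Ideal.exists_ideal_over_prime_of_isIntegral (S := B) P ⊥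
      (by rw [← RingHom.ker_eq_comap_bot, (RingHom.injective_iff_ker_eq_bot _).1 hinj]; exact bot_le)
    exact ⟨Q, hQ, hc, by simp⟩
  | succ n ih =>
    intro P _ h
    obtain ⟨P', hP', hlt, hh⟩ : ∃ P' : Ideal D, P'.IsPrime ∧ P' < P ∧ (n : ℕ∞) ≤ P'.height := by
      by_contra! hcon
      have h2 := Ideal.height_le_iff.2 hcon
      have : (n + 1 : ℕ) ≤ n := by exact_mod_cast h.trans h2
      omega
    obtain ⟨Q', hQ', hc', hh'⟩ := ih P' hh
    obtain ⟨Q, hle, hQ, hc⟩ := Ideal.exists_ideal_over_prime_of_isIntegral (S := B) P Q' (hc'.le.trans hlt.le)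
    refine ⟨Q, hQ, hc, ?_⟩
    have hlt2 : Q' < Q := lt_of_le_of_ne hle (fun h => hlt.ne (by rw [← hc', ← hc, h]))
    push_cast
    refine le_trans (by gcongr) (Ideal.height_add_one_le_of_lt_of_isPrime hlt2)

theorem Kills.add {A : Type*} [CommRing A] {ι : ℕ → Type*} [∀ j, Fintype (ι j)] [∀ j, DecidableEq (ι j)]
    {D : ∀ j, Matrix (ι j) (ι (j + 1)) A} {x y : A} (hx : Kills D x) (hy : Kills D y) : Kills D (x + y) := by
  obtain ⟨s, h0, hs⟩ := hx
  obtain ⟨t, k0, kt⟩ := hy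
  have e : ∀ j, scal (ι j) (x + y) = scal (ι j) x + scal (ι j) y := by
    intro j
    simp only [scal_eq_smul, add_smul]
  refine ⟨fun j => s j + t j, ?_, fun j => ?_⟩
  · rw [Matrix.mul_add, h0, k0, e]
  · rw [e, ← hs, ← kt, Matrix.mul_add, Matrix.add_mul]
    abel

theorem Kills.smul {A : Type*} [CommRing A] {ι : ℕ → Type*} [∀ j, Fintype (ι j)] [∀ j, DecidableEq (ι j)]
    {D : ∀ j, Matrix (ι j) (ι (j + 1)) A} (x : A) {y : A} (hy : Kills D y) : Kills D (x * y) := by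
  obtain ⟨t, k0, kt⟩ := hy
  have e : ∀ j, scal (ι j) (x * y) = x • scal (ι j) y := by
    intro j
    simp only [scal_eq_smul, mul_smul]
  refine ⟨fun j => x • t j, ?_, fun j => ?_⟩
  · rw [Matrix.mul_smul, k0, e]
  · rw [e, ← kt, Matrix.mul_smul, Matrix.smul_mul, smul_add]

theorem Kills.zero {A : Type*} [CommRing A] {ι : ℕ → Type*} [∀ j, Fintype (ι j)] [∀ j, DecidableEq (ι j)]
    (D : ∀ j, Matrix (ι j) (ι (j + 1)) A) : Kills D 0 := by
  refine ⟨fun j => 0, ?_, fun j => ?_⟩ <;> simp [scal_eq_smul]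

def killIdeal {A : Type*} [CommRing A] {ι : ℕ → Type*} [∀ j, Fintype (ι j)] [∀ j, DecidableEq (ι j)]
    (D : ∀ j, Matrix (ι j) (ι (j + 1)) A) : Ideal A where
  carrier := {x | Kills D x}
  add_mem' := Kills.add
  zero_mem' := Kills.zero D
  smul_mem' := fun c _ h => Kills.smul c h

/-- the char p part of the reduction: `B₀` is the ring of coefficients -/
theorem nit_app1 {Δ R0 D : Type u} [CommRing Δ] [CommRing R0] [CommRing D] [Algebra Δ R0]
    (hinj : Function.Injective (algebraMap Δ R0)) [Module.Finite Δ R0] {d : ℕ} (ξ : Fin d → Δ) (g : Δ →+* D)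
    (hD : Good d D (fun i => g (ξ i))) :
    ∃ (p : ℕ) (B : Type u) (_ : CommRing B) (θ : R0 →+* B), p.Prime ∧ CharP B p ∧ IsNoetherianRing B ∧ 
      ∃ _ : IsLocalRing B, (d : WithBot ℕ∞) ≤ ringKrullDim B ∧ 
        (∀ i, θ (algebraMap Δ R0 (ξ i)) ∈ maximalIdeal B) ∧
        maximalIdeal B ≤ (Ideal.span (Set.range fun i => θ (algebraMap Δ R0 (ξ i)))).radical := by
  classical
  obtain ⟨p, pp, hch, hdom, hnoe, hloc, hdim, hmem, hrad⟩ := hD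
  let L := AlgebraicClosure (FractionRing D)
  have hDL : Function.Injective (algebraMap D L) := by
    rw [IsScalarTower.algebraMap_eq D (FractionRing D) L]
    exact (algebraMap (FractionRing D) L).injective.comp (IsFractionRing.injective D _)
  let P := RingHom.ker g
  haveI : P.IsPrime := RingHom.ker_isPrime g
  obtain ⟨Q, -, hQ, hc⟩ := Ideal.exists_ideal_over_prime_of_isIntegral (S := R0) P ⊥
      (by rw [← RingHom.ker_eq_comap_bot, (RingHom.injective_iff_ker_eq_bot _).1 hinj]; exact bot_le)
  haveI : Q.LiesOver P := ⟨hc.symm⟩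
  letI : Algebra (Δ ⧸ P) L := ((algebraMap D L).comp (RingHom.kerLift g)).toAlgebra
  have hPL : Function.Injective (algebraMap (Δ ⧸ P) L) := hDL.comp (RingHom.kerLift_injective g)
  haveI : FaithfulSMul (Δ ⧸ P) L := (faithfulSMul_iff_algebraMap_injective _ _).2 hPL
  haveI : Module.IsTorsionFree (Δ ⧸ P) L := inferInstance
  haveI : FaithfulSMul (Δ ⧸ P) (R0 ⧸ Q) := (faithfulSMul_iff_algebraMap_injective _ _).2
    (FaithfulSMul.algebraMap_injective _ _)
  haveI : Module.IsTorsionFree (Δ ⧸ P) (R0 ⧸ Q) := FaithfulSMul.to_isTorsionFree _ _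
  haveI : Algebra.IsAlgebraic (Δ ⧸ P) (R0 ⧸ Q) := inferInstance
  let ψ : (R0 ⧸ Q) →ₐ[Δ ⧸ P] L := IsAlgClosed.lift
  let θ0 : R0 →+* L := ψ.toRingHom.comp (Ideal.Quotient.mk Q)
  have hθ0 : ∀ r, θ0 (algebraMap Δ R0 r) = algebraMap D L (g r) := by
    intro r
    exact ψ.commutes (Ideal.Quotient.mk P r)
  obtain ⟨T, hT⟩ := (Module.Finite.fg_top : (⊤ : Submodule Δ R0).FG)
  have hintg : ∀ r, IsIntegral D (θ0 r) := by
    intro r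
    have h1 : IsIntegral Δ r := Algebra.IsIntegral.isIntegral r
    obtain ⟨f, hf, h0⟩ := h1
    refine ⟨f.map g, hf.map g, ?_⟩
    rw [Polynomial.eval₂_map]
    have := congrArg θ0 h0
    rw [Polynomial.hom_eval₂, map_zero] at this
    have e : (algebraMap D L).comp g = θ0.comp (algebraMap Δ R0) := RingHom.ext fun z => (hθ0 z).symm
    rw [e]
    exact this
  let B0 : Subalgebra D L := Algebra.adjoin D (T.image θ0 : Finset L)
  haveI : Module.Finite D B0 := by
    apply Algebra.finite_adjoin_of_finite_of_isIntegral (Finset.finite_toSet _)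
    intro z hz
    rw [Finset.mem_coe, Finset.mem_image] at hz
    obtain ⟨r, -, rfl⟩ := hz
    exact hintg r
  have hθB : ∀ r, θ0 r ∈ B0 := by
    intro r
    have : r ∈ Submodule.span Δ (T : Set R0) := by rw [hT]; trivial
    induction this using Submodule.span_induction with
    | mem x hx => exact Algebra.subset_adjoin (by simpa using ⟨x, hx, rfl⟩)
    | zero => rw [map_zero]; exact zero_mem _
    | add x y _ _ hx hy => rw [map_add]; exact add_mem hx hy
    | smul a x _ hx => 
      rw [Algebra.smul_def, map_mul, hθ0]
      exact mul_mem (Subalgebra.algebraMap_mem _ _) hx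
  let θ1 : R0 →+* B0 := θ0.codRestrict B0 hθB
  have hθ1 : ∀ r, θ1 (algebraMap Δ R0 r) = algebraMap D B0 (g r) := fun r => Subtype.ext (hθ0 r)
  have hDB : Function.Injective (algebraMap D B0) := fun a b h => hDL (congrArg Subtype.val h)
  haveI : IsNoetherianRing B0 := IsNoetherianRing.of_finite D B0
  obtain ⟨M, hM, hMc, hMh⟩ := height_integral (B := B0) hDB d (maximalIdeal D) (by
    rw [← WithBot.coe_le_coe, maximalIdeal_height_eq_ringKrullDim]
    exact_mod_cast hdim)
  haveI : CharP B0 p := charP_of_injective_ringHom hDB p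
  let B := Localization.AtPrime M
  have hBinj : Function.Injective (algebraMap B0 B) :=
    IsLocalization.injective B M.primeCompl_le_nonZeroDivisors
  refine ⟨p, B, inferInstance, (algebraMap B0 B).comp θ1, pp, charP_of_injective_ringHom hBinj p, 
    inferInstance, inferInstance, ?_, ?_, ?_⟩
  · rw [IsLocalization.AtPrime.ringKrullDim_eq_height M B]
    exact_mod_cast hMh
  · intro i
    rw [RingHom.comp_apply, hθ1, IsLocalization.AtPrime.to_map_mem_maximal_iff B M, ← Ideal.mem_comap, hMc]
    exact hmem i
  · rw [Ideal.radical_eq_sInf]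
    refine le_sInf ?_
    rintro q ⟨hq, hqp⟩
    set q0 := q.comap (algebraMap B0 B) with hq0
    haveI : q0.IsPrime := Ideal.IsPrime.comap _
    have h1 : q0.comap (algebraMap D B0) = maximalIdeal D := by
      apply le_antisymm (IsLocalRing.le_maximalIdeal (Ideal.IsPrime.comap _).ne_top)
      refine hrad.trans ?_
      rw [Ideal.IsPrime.radical_le_iff (Ideal.IsPrime.comap _), Ideal.span_le]
      rintro _ ⟨i, rfl⟩
      apply hq
      refine Ideal.subset_span ⟨i, ?_⟩
      simp only [RingHom.comp_apply, hθ1]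
    haveI : q0.IsMaximal := Ideal.isMaximal_of_isIntegral_of_isMaximal_comap q0 (by rw [h1]; infer_instance)
    have h2 : q ≤ maximalIdeal B := IsLocalRing.le_maximalIdeal hqp.ne_top
    have h3 : q0 = M := by
      apply Ideal.IsMaximal.eq_of_le this hM.ne_top
      rw [← IsLocalization.AtPrime.comap_maximalIdeal B M]
      exact Ideal.comap_mono h2
    rw [← IsLocalization.AtPrime.map_eq_maximalIdeal M B, Ideal.map_le_iff_le_comap, ← hq0, h3]

theorem nit_app2 {R0 : Type u} [CommRing R0] {ι : ℕ → Type} [∀ j, Fintype (ι j)]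
    {D : ∀ j, Matrix (ι j) (ι (j + 1)) R0} (DD : ∀ j, D j * D (j + 1) = 0) [Nonempty (ι 0)] (n : ℕ)
    (hn : ∀ j, n < j → IsEmpty (ι j)) {d : ℕ} (x : Fin d → R0)
    (hD : ∀ a b, D 0 a b ∈ (Ideal.span (Set.range x)).radical) (hk : ∀ i, ∃ N : ℕ, Kills D (x i ^ N))
    {p : ℕ} {B : Type u} [CommRing B] (θ : R0 →+* B) (pp : p.Prime) [CharP B p] [IsNoetherianRing B]
    [IsLocalRing B] (hdim : (d : WithBot ℕ∞) ≤ ringKrullDim B) (hx : ∀ i, θ (x i) ∈ maximalIdeal B)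
    (hrad : maximalIdeal B ≤ (Ideal.span (Set.range fun i => θ (x i))).radical) : d ≤ n := by
  classical
  haveI : Fact p.Prime := ⟨pp⟩
  have := nit_charp p (D := fun j => (D j).map θ) (map_dd θ DD) (fun a b => by
    have h1 : (Ideal.span (Set.range x)).radical ≤ (maximalIdeal B).comap θ := by
      rw [Ideal.IsPrime.radical_le_iff (Ideal.IsPrime.comap _), Ideal.span_le]
      rintro _ ⟨i, rfl⟩
      exact hx i
    exact h1 (hD a b)) n hn (fun y hy => by
    have h1 : maximalIdeal B ≤ (killIdeal (fun j => (D j).map θ)).radical := by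
      refine hrad.trans ?_
      rw [Ideal.radical_le_radical_iff, Ideal.span_le]
      rintro _ ⟨i, rfl⟩
      obtain ⟨N, hN⟩ := hk i
      refine ⟨N, ?_⟩
      rw [← map_pow]
      exact hN.map θ
    exact h1 hy)
  exact_mod_cast hdim.trans this

theorem nit_red {S A : Type u} [CommRing S] [CommRing A] [Algebra S A]
    (hinj : Function.Injective (algebraMap S A)) [Algebra.IsIntegral S A] {d : ℕ} (x : Fin d → S)
    (hred : Red d S x)
    {ι : ℕ → Type} [∀ j, Fintype (ι j)]
    {D : ∀ j, Matrix (ι j) (ι (j + 1)) A} (DD : ∀ j, D j * D (j + 1) = 0) [Nonempty (ι 0)] (n : ℕ)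
    (hn : ∀ j, n < j → IsEmpty (ι j))
    (hD : ∀ a b, D 0 a b ∈ (Ideal.span (Set.range fun i => algebraMap S A (x i))).radical)
    (hk : ∀ i, ∃ N : ℕ, Kills D (algebraMap S A (x i) ^ N)) : d ≤ n := by
  classical
  choose N s hs0 hs using hk
  choose M hM using hD
  have hM' : ∀ a b, ∃ r : Fin d → A, ∑ i, r i * algebraMap S A (x i) = D 0 a b ^ M a b := by
    intro a b
    exact Ideal.mem_span_range_iff_exists_fun.1 (hM a b)
  choose r hr using hM'
  -- the finite set of elements we need
  let T : Set A := (⋃ j ∈ Finset.range (n + 1), Set.range fun q : ι j × ι (j + 1) => D j q.1 q.2) ∪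
    (⋃ j ∈ Finset.range (n + 1), Set.range fun q : (ι (j + 1) × ι j) × Fin d => s q.2 j q.1.1 q.1.2) ∪
    Set.range fun q : (ι 0 × ι 1) × Fin d => r q.1.1 q.1.2 q.2
  have hT : T.Finite := by
    refine ((Set.Finite.biUnion (Finset.finite_toSet _) fun _ _ => Set.finite_range _).union
      (Set.Finite.biUnion (Finset.finite_toSet _) fun _ _ => Set.finite_range _)).union
      (Set.finite_range _)
  have hTi : ∀ t : A, ∃ f : Polynomial S, f.Monic ∧ Polynomial.eval₂ (algebraMap S A) t f = 0 :=
    fun t => Algebra.IsIntegral.isIntegral (R := S) t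
  choose f hfm hf using hTi
  let W : Set S := (⋃ t ∈ T, ((f t).coeffs : Set S)) ∪ Set.range x
  have hW : W.Finite := (hT.biUnion fun t _ => Finset.finite_toSet _).union (Set.finite_range _)
  obtain ⟨Δ, hΔ, hWΔ⟩ := exists_fgz W hW
  have hx : ∀ i, x i ∈ Δ := fun i => hWΔ (Or.inr ⟨i, rfl⟩)
  let R0 : Subalgebra Δ A := Algebra.adjoin Δ T
  have hTR : T ⊆ R0 := Algebra.subset_adjoin
  have hintg : ∀ t ∈ T, IsIntegral Δ t := by
    intro t ht
    have h1 : (f t) ∈ Polynomial.lifts Δ.subtype := by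
      rw [Polynomial.lifts_iff_coeff_lifts]
      intro k
      by_cases h0 : (f t).coeff k = 0
      · exact ⟨0, by rw [h0, map_zero]⟩
      · exact ⟨⟨(f t).coeff k, hWΔ (Or.inl (Set.mem_biUnion ht (Polynomial.coeff_mem_coeffs h0)))⟩, rfl⟩
    obtain ⟨q, hq⟩ := (Polynomial.mem_lifts _).1 h1
    refine ⟨q, ?_, ?_⟩
    · apply Polynomial.monic_of_injective (f := Δ.subtype) Subtype.val_injective
      rw [hq]; exact hfm t
    · have := hf t
      rw [← hq, Polynomial.eval₂_map] at this
      exact this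
  haveI : Module.Finite Δ R0 := Algebra.finite_adjoin_of_finite_of_isIntegral hT hintg
  have hinj0 : Function.Injective (algebraMap Δ R0) := by
    intro a b h
    exact Subtype.ext (hinj (congrArg (fun z : R0 => (z : A)) h))
  obtain ⟨D', _, g, hgood⟩ := hred Δ hΔ Δ.subtype Subtype.val_injective (fun i => ⟨x i, hx i⟩) (fun i => rfl)
  obtain ⟨p, B, _, θ, pp, _, _, _, hdim, hxB, hradB⟩ := nit_app1 hinj0 (fun i => (⟨x i, hx i⟩ : Δ)) g hgood
  have mD : ∀ j a b, D j a b ∈ R0 := by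
    intro j a b
    by_cases hj : j ≤ n
    · exact hTR (Or.inl (Or.inl (Set.mem_biUnion (Finset.mem_coe.2 (Finset.mem_range.2 (by omega))) ⟨(a, b), rfl⟩)))
    · exact ((hn j (by omega)).false a).elim
  have ms : ∀ i j a b, s i j a b ∈ R0 := by
    intro i j a b
    by_cases hj : j ≤ n
    · exact hTR (Or.inl (Or.inr (Set.mem_biUnion (Finset.mem_coe.2 (Finset.mem_range.2 (by omega)))
        ⟨((a, b), i), rfl⟩)))
    · exact ((hn j (by omega)).false b).elim
  have mr : ∀ a b i, r a b i ∈ R0 := fun a b i => hTR (Or.inr ⟨((a, b), i), rfl⟩)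
  let D1 : ∀ j, Matrix (ι j) (ι (j + 1)) R0 := fun j => Matrix.of fun a b => ⟨D j a b, mD j a b⟩
  let s1 : ∀ i j, Matrix (ι (j + 1)) (ι j) R0 := fun i j => Matrix.of fun a b => ⟨s i j a b, ms i j a b⟩
  let v : R0 →+* A := R0.val.toRingHom
  have hv : ∀ {κ κ' : Type} (X Y : Matrix κ κ' R0), X.map v = Y.map v → X = Y := by
    intro κ κ' X Y h
    exact Matrix.map_injective (f := v) Subtype.val_injective h
  have eD : ∀ j, (D1 j).map v = D j := fun j => rfl
  have es : ∀ i j, (s1 i j).map v = s i j := fun i j => rfl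
  refine nit_app2 (D := D1) ?_ n hn (fun i => algebraMap Δ R0 ⟨x i, hx i⟩) ?_ ?_ θ pp hdim hxB hradB
  · intro j
    apply hv
    rw [Matrix.map_mul, eD, eD, DD, Matrix.map_zero _ (map_zero v)]
  · intro a b
    refine ⟨M a b, Ideal.mem_span_range_iff_exists_fun.2 ⟨fun i => ⟨r a b i, mr a b i⟩, ?_⟩⟩
    have hvi : Function.Injective v := Subtype.val_injective
    apply hvi
    have := hr a b
    rw [map_sum, map_pow]
    simp only [map_mul]
    exact this
  · intro i
    refine ⟨N i, s1 i, ?_, fun j => ?_⟩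
    · apply hv
      rw [Matrix.map_mul, eD, es, hs0, scal_map, map_pow]
      rfl
    · apply hv
      rw [Matrix.map_add v (map_add v), Matrix.map_mul, Matrix.map_mul, eD, es, eD, es, hs, scal_map, map_pow]
      rfl
end NIT

end

section
namespace NIT
open IsLocalRing
section
variable {A : Type u} [CommRing A] [IsNoetherianRing A] [IsLocalRing A]

lemma exists_sop_pow (d : ℕ) (hd : ringKrullDim A = d) :
    ∃ y : Fin d → A, (∀ i, y i ∈ maximalIdeal A) ∧
      ∃ T, maximalIdeal A ^ T ≤ Ideal.span (Set.range y) := by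
  obtain ⟨s, hs, hc⟩ := Ideal.exists_finset_card_eq_height_of_isNoetherianRing (maximalIdeal A)
  have h1 := IsLocalRing.maximalIdeal_height_eq_ringKrullDim (R := A)
  rw [← hc, hd] at h1
  have h2 : s.card = d := by exact_mod_cast h1
  subst h2
  have hr : Set.range (fun i => ((s.equivFin.symm i : s) : A)) = (s : Set A) := by
    ext x
    constructor
    · rintro ⟨i, rfl⟩
      exact (s.equivFin.symm i).2
    · intro hx
      exact ⟨s.equivFin ⟨x, hx⟩, by simp⟩
  refine ⟨fun i => (s.equivFin.symm i : s), fun i => hs.1.2 (Ideal.subset_span (s.equivFin.symm i).2), ?_⟩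
  rw [hr]
  have h3 : (Ideal.span (s : Set A)).radical = maximalIdeal A := by
    apply le_antisymm
    · exact (Ideal.IsPrime.radical_le_iff inferInstance).2 hs.1.2
    · rw [Ideal.radical_eq_sInf]
      refine le_sInf fun p hp => ?_
      have := hp.2
      exact hs.2 ⟨hp.2, hp.1⟩ (le_maximalIdeal hp.2.ne_top)
  exact Ideal.exists_pow_le_of_le_radical_of_fg h3.ge (Ideal.fg_of_isNoetherianRing _)

lemma dim_le_of_pow_le {e T : ℕ} (z : Fin e → A)
    (hT : maximalIdeal A ^ T ≤ Ideal.span (Set.range z)) (hz : ∀ i, z i ∈ maximalIdeal A) :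
    ringKrullDim A ≤ e := by
  rw [← IsLocalRing.maximalIdeal_height_eq_ringKrullDim]
  have h1 : maximalIdeal A ∈ (Ideal.span (Set.range z)).minimalPrimes := by
    refine ⟨⟨inferInstance, Ideal.span_le.2 (by rintro _ ⟨i, rfl⟩; exact hz i)⟩, fun p hp _ => ?_⟩
    have := hp.1
    exact Ideal.IsPrime.le_of_pow_le (hT.trans hp.2)
  have h2 := Ideal.height_le_card_of_mem_minimalPrimes_span (Set.finite_range z) h1
  have h3 : (Set.range z).ncard ≤ e := by
    rw [← Set.image_univ]
    refine (Set.ncard_image_le).trans ?_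
    simp
  have h4 : (maximalIdeal A).height ≤ (e : ℕ∞) := h2.trans (by exact_mod_cast h3)
  exact_mod_cast h4
end

section
variable {A : Type u} [CommRing A] [IsLocalRing A] [IsAdicComplete (maximalIdeal A) A]
  {k : Type u} [Field k] {d : ℕ}

theorem exists_ps (c : k →+* A) (x : Fin d → A) (hx : ∀ i, x i ∈ maximalIdeal A) :
    ∃ ψ : MvPowerSeries (Fin d) k →+* A, (∀ i, ψ (MvPowerSeries.X i) = x i) ∧
      ∀ a, ψ (MvPowerSeries.C a) = c a := by
  let e := MvPolynomial.eval₂Hom c x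
  have h (n : ℕ) : (MvPolynomial.idealOfVars (Fin d) k) ^ n ≤ (maximalIdeal A ^ n).comap e := by
    refine le_trans (Ideal.pow_right_mono ?_ n) (Ideal.le_comap_pow _ _)
    rw [MvPolynomial.idealOfVars, Ideal.span_le]
    rintro _ ⟨i, rfl⟩
    simpa [e] using hx i
  let f (n : ℕ) : MvPowerSeries (Fin d) k →+* A ⧸ maximalIdeal A ^ n :=
    (Ideal.quotientMap (maximalIdeal A ^ n) e (h n)).comp
      (MvPowerSeries.truncTotalAlgHom (Fin d) k n).toRingHom
  have hf {m n : ℕ} (hle : m ≤ n) : (Ideal.Quotient.factorPow _ hle).comp (f n) = f m := by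
    ext p
    have := h m (MvPowerSeries.truncTotal_sub_truncTotal_mem_pow_idealOfVars hle le_rfl p)
    rw [Ideal.mem_comap, map_sub, ← Ideal.Quotient.mk_eq_mk_iff_sub_mem] at this
    simpa [f] using this
  have key : ∀ p : MvPolynomial (Fin d) k, IsAdicComplete.liftRingHom (maximalIdeal A) f hf p = e p := by
    intro p
    rw [← sub_eq_zero]
    refine IsHausdorff.haus (I := maximalIdeal A) inferInstance _ fun n => ?_
    rw [SModEq.zero, smul_eq_mul, Ideal.mul_top, ← Ideal.Quotient.mk_eq_mk_iff_sub_mem, IsAdicComplete.mk_liftRingHom]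
    have := (MvPowerSeries.truncTotalAlgHom (Fin d) k n).commutes p
    simp only [f, RingHom.comp_apply]
    erw [this]
    rfl
  refine ⟨IsAdicComplete.liftRingHom (maximalIdeal A) f hf, fun i => ?_, fun a => ?_⟩
  · rw [← MvPolynomial.coe_X, key]
    simp [e]
  · rw [← MvPolynomial.coe_C, key]
    simp [e]

lemma prec_pi {S : Type u} [CommRing S] (I : Ideal S) [IsPrecomplete I S] (r : ℕ) :
    IsPrecomplete I (Fin r → S) := by
  have hm : ∀ (n : ℕ) (v : Fin r → S), v ∈ (I ^ n • ⊤ : Submodule S (Fin r → S)) ↔ ∀ i, v i ∈ I ^ n := by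
    intro n v
    constructor
    · intro hv i
      induction hv using Submodule.smul_induction_on' with
      | smul r hr m _ => exact Ideal.mul_mem_right _ _ hr
      | add a _ b _ ha hb => exact add_mem ha hb
    · intro hv
      rw [← Finset.univ_sum_single v]
      refine Submodule.sum_mem _ fun i _ => ?_
      have : Pi.single i (v i) = v i • (Pi.single i 1 : Fin r → S) := by
        rw [← Pi.single_smul, smul_eq_mul, mul_one]
      rw [this]
      exact Submodule.smul_mem_smul (hv i) trivial
  constructor
  intro f hf
  have : ∀ i, ∃ L : S, ∀ n, f n i ≡ L [SMOD (I ^ n • ⊤ : Submodule S S)] := by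
    intro i
    apply IsPrecomplete.prec inferInstance
    intro m n hmn
    have := hf hmn
    rw [SModEq.sub_mem, hm] at this
    rw [SModEq.sub_mem, smul_eq_mul, Ideal.mul_top]
    exact this i
  choose L hL using this
  refine ⟨L, fun n => ?_⟩
  rw [SModEq.sub_mem, hm]
  intro i
  have := hL i n
  rwa [SModEq.sub_mem, smul_eq_mul, Ideal.mul_top] at this

theorem ps_finite [Algebra (MvPowerSeries (Fin d) k) A] (hfg : (maximalIdeal A).FG)
    (hx : ∀ i, algebraMap (MvPowerSeries (Fin d) k) A (MvPowerSeries.X i) ∈ maximalIdeal A)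
    (hs : ∀ a : A, ∃ b : k, a - algebraMap (MvPowerSeries (Fin d) k) A (MvPowerSeries.C b) ∈ maximalIdeal A)
    (T : ℕ) (hT : maximalIdeal A ^ T ≤
      Ideal.span (Set.range fun i => algebraMap (MvPowerSeries (Fin d) k) A (MvPowerSeries.X i))) :
    Module.Finite (MvPowerSeries (Fin d) k) A := by
  have h1 : ∀ t, ∃ N : Submodule (MvPowerSeries (Fin d) k) A, N.FG ∧ ∀ a : A, ∃ n ∈ N, a - n ∈ maximalIdeal A ^ t := by
    intro t
    induction t with
    | zero => exact ⟨⊥, Submodule.fg_bot, fun a => ⟨0, by simp, by simp⟩⟩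
    | succ t ih =>
      obtain ⟨N, hN, h⟩ := ih
      obtain ⟨G, hG⟩ := hfg
      refine ⟨Submodule.span _ {1} ⊔ Submodule.span _ (G : Set A) * N, ?_, ?_⟩
      · exact (Submodule.fg_span (Set.finite_singleton _)).sup
          ((Submodule.fg_span G.finite_toSet).mul hN)
      · have h2 : ∀ a ∈ maximalIdeal A, ∀ c : A, ∃ n ∈ Submodule.span (MvPowerSeries (Fin d) k) (G : Set A) * N,
            c * a - n ∈ maximalIdeal A ^ (t + 1) := by
          intro a ha
          rw [← hG] at ha
          induction ha using Submodule.span_induction with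
          | mem g hg =>
            intro c
            obtain ⟨n, hn, h3⟩ := h c
            refine ⟨g * n, Submodule.mul_mem_mul (Submodule.subset_span hg) hn, ?_⟩
            rw [pow_succ', show c * g - g * n = g * (c - n) by ring]
            exact Ideal.mul_mem_mul (hG ▸ Submodule.subset_span hg) h3
          | zero => exact fun c => ⟨0, by simp, by simp⟩
          | add a b _ _ ha hb =>
            intro c
            obtain ⟨n, hn, h3⟩ := ha c
            obtain ⟨m, hm, h4⟩ := hb c
            exact ⟨n + m, add_mem hn hm, by rw [mul_add, add_sub_add_comm]; exact add_mem h3 h4⟩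
          | smul c' a _ ha =>
            intro c
            obtain ⟨n, hn, h3⟩ := ha (c * c')
            exact ⟨n, hn, by rwa [smul_eq_mul, ← mul_assoc]⟩
        intro a
        obtain ⟨b, hb⟩ := hs a
        obtain ⟨n, hn, h3⟩ := h2 _ hb 1
        refine ⟨algebraMap (MvPowerSeries (Fin d) k) A (MvPowerSeries.C b) + n,
          Submodule.add_mem_sup ?_ hn, by rwa [← sub_sub, ← one_mul (a - _)]⟩
        rw [Algebra.algebraMap_eq_smul_one]
        exact Submodule.smul_mem _ _ (Submodule.subset_span rfl)
  obtain ⟨N, ⟨G, hG⟩, hN⟩ := h1 T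
  have hmap : (maximalIdeal (MvPowerSeries (Fin d) k)).map (algebraMap _ A) =
      Ideal.span (Set.range fun i => algebraMap (MvPowerSeries (Fin d) k) A (MvPowerSeries.X i)) := by
    rw [mv_max, Ideal.map_span, ← Set.range_comp]
    rfl
  have hH : IsHausdorff (maximalIdeal (MvPowerSeries (Fin d) k)) A := by
    constructor
    intro a ha
    refine IsHausdorff.haus (I := maximalIdeal A) inferInstance _ fun n => ?_
    have := ha n
    rw [SModEq.zero, Ideal.smul_top_eq_map, Submodule.restrictScalars_mem, Ideal.map_pow] at this
    rw [SModEq.zero, smul_eq_mul, Ideal.mul_top]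
    refine Ideal.pow_right_mono ?_ n this
    rw [hmap, Ideal.span_le]
    rintro _ ⟨i, rfl⟩
    exact hx i
  have hP := prec_pi (maximalIdeal (MvPowerSeries (Fin d) k)) G.card
  let f : (Fin G.card → MvPowerSeries (Fin d) k) →ₗ[MvPowerSeries (Fin d) k] A :=
    Fintype.linearCombination _ (fun i => ((G.equivFin.symm i : G) : A))
  have hr : LinearMap.range f = N := by
    rw [Fintype.range_linearCombination, ← hG]
    congr 1
    ext x
    constructor
    · rintro ⟨i, rfl⟩
      exact (G.equivFin.symm i).2
    · intro hx
      exact ⟨G.equivFin ⟨x, hx⟩, by simp⟩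
  refine Module.Finite.of_surjective f (surjective_of_mkQ_comp_surjective
    (I := maximalIdeal (MvPowerSeries (Fin d) k)) fun y => ?_)
  obtain ⟨a, rfl⟩ := Submodule.Quotient.mk_surjective _ y
  obtain ⟨n, hn, h⟩ := hN a
  rw [← hr] at hn
  obtain ⟨v, rfl⟩ := hn
  refine ⟨v, ?_⟩
  symm
  rw [LinearMap.comp_apply, Submodule.mkQ_apply, Submodule.Quotient.eq, Ideal.smul_top_eq_map,
    Submodule.restrictScalars_mem, hmap]
  exact hT h
end

theorem ps_inj {R A : Type u} [CommRing R] [IsLocalRing R] [IsNoetherianRing R] [CommRing A] [IsLocalRing A]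
    {k : Type u} [Field k] {d : ℕ} (hd : ringKrullDim R = d) (φ : R →+* A)
    (hm : maximalIdeal A = (maximalIdeal R).map φ)
    (hb : ∀ n, ∀ a : A, ∃ r : R, a - φ r ∈ maximalIdeal A ^ n)
    (hc : ∀ n, ∀ r : R, φ r ∈ maximalIdeal A ^ n → r ∈ maximalIdeal R ^ n)
    (ψ : MvPowerSeries (Fin d) k →+* A) (hx : ∀ i, ψ (MvPowerSeries.X i) ∈ maximalIdeal A)
    (T : ℕ) (hT : maximalIdeal A ^ T ≤ Ideal.span (Set.range fun i => ψ (MvPowerSeries.X i))) :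
    Function.Injective ψ := by
  rw [injective_iff_map_eq_zero]
  intro f hf
  by_contra hf0
  have hS : maximalIdeal (MvPowerSeries (Fin d) k) ≤ (maximalIdeal A).comap ψ := by
    rw [mv_max, Ideal.span_le]
    rintro _ ⟨i, rfl⟩
    exact hx i
  have hfm : f ∈ maximalIdeal (MvPowerSeries (Fin d) k) := by
    rw [mem_maximalIdeal, mem_nonunits_iff]
    intro hu
    have := hu.map ψ
    rw [hf] at this
    exact not_isUnit_zero this
  have : Nontrivial (MvPowerSeries (Fin d) k ⧸ Ideal.span {f}) := by
    rw [Ideal.Quotient.nontrivial_iff]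
    intro h
    have h1 : Ideal.span {f} ≤ maximalIdeal (MvPowerSeries (Fin d) k) := by
      rw [Ideal.span_le]; simpa using hfm
    rw [h] at h1
    exact (maximalIdeal.isMaximal _).ne_top (top_le_iff.1 h1)
  have : IsLocalRing (MvPowerSeries (Fin d) k ⧸ Ideal.span {f}) :=
    IsLocalRing.of_surjective' _ Ideal.Quotient.mk_surjective
  obtain ⟨e, he⟩ := exists_dim_eq (A := MvPowerSeries (Fin d) k ⧸ Ideal.span {f})
  have hS' : ringKrullDim (MvPowerSeries (Fin d) k) ≤ d := by
    refine dim_le_of_pow_le (T := 1) (MvPowerSeries.X) ?_ ?_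
    · rw [pow_one, mv_max]
    · intro i
      rw [mv_max]
      exact Ideal.subset_span ⟨i, rfl⟩
  have hed : e + 1 ≤ d := by
    have h1 := (ringKrullDim_quotient_succ_le_of_nonZeroDivisor
      (mem_nonZeroDivisors_of_ne_zero hf0)).trans hS'
    rw [he] at h1
    exact_mod_cast h1
  obtain ⟨y, hy, T', hT'⟩ := exists_sop_pow e he
  let ψ' : MvPowerSeries (Fin d) k ⧸ Ideal.span {f} →+* A := Ideal.Quotient.lift _ ψ (by
    intro a ha
    obtain ⟨b, rfl⟩ := Ideal.mem_span_singleton'.1 ha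
    rw [map_mul, hf, mul_zero])
  have hψ' : ∀ s ∈ maximalIdeal (MvPowerSeries (Fin d) k ⧸ Ideal.span {f}), ψ' s ∈ maximalIdeal A := by
    intro s hs
    obtain ⟨s, rfl⟩ := Ideal.Quotient.mk_surjective s
    refine hS ?_
    rw [mem_maximalIdeal, mem_nonunits_iff] at hs ⊢
    exact fun h => hs (h.map _)
  have h1 : maximalIdeal A ^ T ≤ (maximalIdeal (MvPowerSeries (Fin d) k ⧸ Ideal.span {f})).map ψ' := by
    refine hT.trans ?_
    rw [Ideal.span_le]
    rintro _ ⟨i, rfl⟩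
    have : ψ (MvPowerSeries.X i) = ψ' (Ideal.Quotient.mk _ (MvPowerSeries.X i)) := rfl
    simp only [this]
    refine Ideal.mem_map_of_mem _ ?_
    rw [mem_maximalIdeal, mem_nonunits_iff]
    intro h
    have h2 := h.map ψ'
    have h3 := hx i
    rw [mem_maximalIdeal, mem_nonunits_iff] at h3
    exact h3 h2
  have h2 : maximalIdeal A ^ (T * T') ≤ Ideal.span (Set.range fun i => ψ' (y i)) := by
    rw [pow_mul]
    refine (Ideal.pow_right_mono h1 T').trans ?_
    rw [← Ideal.map_pow]
    refine (Ideal.map_mono hT').trans ?_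
    rw [Ideal.map_span, ← Set.range_comp]
    rfl
  choose z hz using fun i => hb (T * T' + 1) (ψ' (y i))
  have hzm : ∀ i, z i ∈ maximalIdeal R := by
    intro i
    rw [← pow_one (maximalIdeal R)]
    refine hc 1 _ ?_
    have h3 := Ideal.pow_le_pow_right (show 1 ≤ T * T' + 1 by omega) (hz i)
    rw [pow_one] at h3 ⊢
    have := sub_mem (hψ' _ (hy i)) h3
    rwa [sub_sub_cancel] at this
  have h3 : maximalIdeal R ^ (T * T') ≤ Ideal.span (Set.range z) := by
    refine Submodule.le_of_le_smul_of_le_jacobson_bot (I := maximalIdeal R)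
      (IsNoetherian.noetherian _) (maximalIdeal_le_jacobson _) ?_
    intro r hr
    have h4 : φ r ∈ maximalIdeal A ^ (T * T') := by
      rw [hm, ← Ideal.map_pow]
      exact Ideal.mem_map_of_mem _ hr
    obtain ⟨a, ha⟩ := (Ideal.mem_span_range_iff_exists_fun).1 (h2 h4)
    choose b hb' using fun i => hb (T * T' + 1) (a i)
    have h5 : r - ∑ i, b i * z i ∈ maximalIdeal R ^ (T * T' + 1) := by
      refine hc _ _ ?_
      rw [map_sub, ← ha, map_sum, ← Finset.sum_sub_distrib]
      refine Ideal.sum_mem _ fun i _ => ?_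
      rw [map_mul, show a i * ψ' (y i) - φ (b i) * φ (z i) =
        a i * (ψ' (y i) - φ (z i)) + (a i - φ (b i)) * φ (z i) by ring]
      exact add_mem (Ideal.mul_mem_left _ _ (hz i)) (Ideal.mul_mem_right _ _ (hb' i))
    rw [← add_sub_cancel (∑ i, b i * z i) r]
    refine Submodule.add_mem_sup ?_ (by rw [smul_eq_mul, ← pow_succ']; exact h5)
    exact Ideal.sum_mem _ fun i _ => Ideal.mul_mem_left _ _ (Ideal.subset_span ⟨i, rfl⟩)
  have h4 := dim_le_of_pow_le z h3 hzm
  rw [hd] at h4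
  have : d ≤ e := by exact_mod_cast h4
  omega

theorem exists_coeff {A : Type u} [CommRing A] [IsLocalRing A] [IsAdicComplete (maximalIdeal A) A]
    [CharZero (ResidueField A)] : ∃ c : ResidueField A →+* A, ∀ b, residue A (c b) = b := by
  have h0 : ∀ I : Ideal A, I ≠ ⊤ → CharZero (A ⧸ I) := by
    intro I hI
    let q : A ⧸ I →+* ResidueField A := Ideal.Quotient.factor (le_maximalIdeal hI)
    refine ⟨fun a b hab => ?_⟩
    have h := congrArg q hab
    rw [map_natCast, map_natCast] at h
    exact Nat.cast_injective h
  have : CharZero A := by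
    refine ⟨fun a b hab => ?_⟩
    have h := congrArg (residue A) hab
    simpa using h
  obtain ⟨inst⟩ := (EqualCharZero.nonempty_algebraRat_iff A).2 h0
  have : Algebra.FormallySmooth ℚ (ResidueField A) := by
    obtain ⟨s, hs⟩ := exists_isTranscendenceBasis ℚ (ResidueField A)
    have := hs.isAlgebraic_field
    exact Algebra.FormallySmooth.of_algebraicIndependent_of_isSeparable hs.1
  obtain ⟨g, hg⟩ := Algebra.FormallySmooth.exists_mkₐ_comp_eq_of_isAdicComplete (R := ℚ)
    (A := ResidueField A) (S := A) (I := maximalIdeal A)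
    (RingHom.toRatAlgHom (RingHom.id (ResidueField A) : ResidueField A →+* A ⧸ maximalIdeal A))
  exact ⟨g.toRingHom, fun b => DFunLike.congr_fun hg b⟩

theorem nit_zero {R : Type u} [CommRing R] [IsLocalRing R] [IsNoetherianRing R] [CharZero (ResidueField R)]
    {ι : ℕ → Type} [∀ j, Fintype (ι j)]
    {D : ∀ j, Matrix (ι j) (ι (j + 1)) R} (DD : ∀ j, D j * D (j + 1) = 0) [Nonempty (ι 0)]
    (hD : ∀ a b, D 0 a b ∈ maximalIdeal R) (n : ℕ)
    (hn : ∀ j, n < j → IsEmpty (ι j))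
    (hk : ∀ x ∈ maximalIdeal R, ∃ N : ℕ, Kills D (x ^ N)) : ringKrullDim R ≤ n := by
  classical
  obtain ⟨d, hd⟩ := exists_dim_eq (A := R)
  obtain ⟨x, hx, T, hT⟩ := exists_sop_pow d hd
  set A := AdicCompletion (maximalIdeal R) R with hA
  let φ : R →+* A := algebraMap R A
  have fg : (maximalIdeal R).FG := Ideal.fg_of_isNoetherianRing _
  have hm : maximalIdeal A = (maximalIdeal R).map φ := AdicCompletion.maximalIdeal_eq_map
  have hpow : ∀ n (a : A), a ∈ maximalIdeal A ^ n ↔ AdicCompletion.eval (maximalIdeal R) R n a = 0 := by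
    intro n a
    rw [hm, ← Ideal.map_pow, ← Submodule.restrictScalars_mem R, ← Ideal.smul_top_eq_map,
      AdicCompletion.pow_smul_top_eq_ker_eval fg, LinearMap.mem_ker]
  have hb : ∀ n, ∀ a : A, ∃ r : R, a - φ r ∈ maximalIdeal A ^ n := by
    intro n a
    obtain ⟨r, hr⟩ := Submodule.Quotient.mk_surjective _ (AdicCompletion.eval (maximalIdeal R) R n a)
    refine ⟨r, ?_⟩
    rw [hpow, map_sub, ← hr, sub_eq_zero]
    rfl
  have hc : ∀ n, ∀ r : R, φ r ∈ maximalIdeal A ^ n → r ∈ maximalIdeal R ^ n := by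
    intro n r hr
    rw [hpow] at hr
    have : (Submodule.Quotient.mk r : R ⧸ (maximalIdeal R ^ n • ⊤ : Submodule R R)) = 0 := hr
    rwa [Submodule.Quotient.mk_eq_zero, smul_eq_mul, Ideal.mul_top] at this
  have hch : CharZero (ResidueField A) := charZero_of_injective_ringHom
    (AdicCompletion.residueField_map_bijective R).1
  obtain ⟨c, hcr⟩ := exists_coeff (A := A)
  have hxA : ∀ i, φ (x i) ∈ maximalIdeal A := by
    intro i
    rw [hm]; exact Ideal.mem_map_of_mem _ (hx i)
  obtain ⟨ψ, hψX, hψC⟩ := exists_ps c (fun i => φ (x i)) hxA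
  have hTA : maximalIdeal A ^ T ≤ Ideal.span (Set.range fun i => ψ (MvPowerSeries.X i)) := by
    simp only [hψX]
    rw [hm, ← Ideal.map_pow]
    refine (Ideal.map_mono hT).trans ?_
    rw [Ideal.map_span, ← Set.range_comp]
    rfl
  have hinj := ps_inj hd φ hm hb hc ψ (fun i => by rw [hψX]; exact hxA i) T hTA
  letI : Algebra (MvPowerSeries (Fin d) (ResidueField A)) A := ψ.toAlgebra
  have hfin : Module.Finite (MvPowerSeries (Fin d) (ResidueField A)) A := by
    refine ps_finite ?_ (fun i => (hψX i).symm ▸ hxA i) (fun a => ⟨residue A a, ?_⟩) T hTA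
    · rw [hm]; exact fg.map _
    · change a - ψ _ ∈ _
      rw [hψC]
      rw [← residue_eq_zero_iff, map_sub, hcr, sub_self]
  rw [hd]
  have hdn : d ≤ n := by
    refine nit_red (S := MvPowerSeries (Fin d) (ResidueField A)) hinj _ (red_mv _ d)
      (D := fun j => (D j).map φ) (map_dd φ DD) n hn ?_ ?_
    · intro a b
      exact ⟨T, hTA (Ideal.pow_mem_pow (hm ▸ Ideal.mem_map_of_mem _ (hD a b)) T)⟩
    · intro i
      obtain ⟨N, hN⟩ := hk _ (hx i)
      refine ⟨N, ?_⟩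
      have := hN.map φ
      rw [map_pow] at this
      rwa [show algebraMap (MvPowerSeries (Fin d) (ResidueField A)) A (MvPowerSeries.X i) = φ (x i) from hψX i]
  exact_mod_cast hdn

/-- The New Intersection Theorem, in matrix form. -/
theorem nit {R : Type u} [CommRing R] [IsLocalRing R] [IsNoetherianRing R]
    {ι : ℕ → Type} [∀ j, Fintype (ι j)]
    {D : ∀ j, Matrix (ι j) (ι (j + 1)) R} (DD : ∀ j, D j * D (j + 1) = 0) [Nonempty (ι 0)]
    (hD : ∀ a b, D 0 a b ∈ maximalIdeal R) (n : ℕ)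
    (hn : ∀ j, n < j → IsEmpty (ι j))
    (hk : ∀ x ∈ maximalIdeal R, ∃ N : ℕ, Kills D (x ^ N)) : ringKrullDim R ≤ n := by
  obtain ⟨p, hp⟩ := CharP.exists (ResidueField R)
  rcases CharP.char_is_prime_or_zero (ResidueField R) p with h | h
  · have : Fact p.Prime := ⟨h⟩
    refine nit_mixed p ?_ DD hD n hn hk
    rw [← residue_eq_zero_iff, map_natCast, CharP.cast_eq_zero]
  · subst h
    have := CharP.charP_to_charZero (ResidueField R)
    exact nit_zero DD hD n hn hk
end NIT

end

section
open CategoryTheory IsLocalRing RingTheory.Sequence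
open scoped Pointwise

namespace NIT

lemma ses {R : Type u} [CommRing R] {A B M : Type u} [AddCommGroup A] [AddCommGroup B]
    [AddCommGroup M] [Module R A] [Module R B] [Module R M] (f : A →ₗ[R] B) (g : B →ₗ[R] M)
    (hf : Function.Injective f) (ex : Function.Exact f g) (hg : Function.Surjective g) :
    (ShortComplex.mk (ModuleCat.ofHom f) (ModuleCat.ofHom g)
      (by ext x; exact (ex _).2 ⟨x, rfl⟩)).ShortExact where
  exact := (ShortComplex.ShortExact.moduleCat_exact_iff_function_exact _).2 ex
  mono_f := (ModuleCat.mono_iff_injective _).2 hf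
  epi_g := (ModuleCat.epi_iff_surjective _).2 hg

section
variable {R : Type u} [CommRing R] [IsLocalRing R]

lemma min_gens (K : Type*) [AddCommGroup K] [Module R K] [Module.Finite R K] :
    ∃ (b : ℕ) (g : Fin b → K), (∀ y, ∃ u : Fin b → R, y = ∑ j, u j • g j) ∧
      ∀ v : Fin b → R, ∑ j, v j • g j = 0 → ∀ j, v j ∈ maximalIdeal R := by
  classical
  have ex : ∃ (b : ℕ), ∃ (g : Fin b → K), ∀ y, ∃ u : Fin b → R, y = ∑ j, u j • g j := by
    obtain ⟨b, g, hg⟩ := Module.Finite.exists_fin (R := R) (M := K)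
    refine ⟨b, g, fun y => ?_⟩
    have : y ∈ Submodule.span R (Set.range g) := by rw [hg]; trivial
    obtain ⟨u, hu⟩ := (Submodule.mem_span_range_iff_exists_fun R).1 this
    exact ⟨u, hu.symm⟩
  obtain ⟨g, hg⟩ := Nat.find_spec ex
  refine ⟨Nat.find ex, g, hg, fun v hv i => ?_⟩
  by_contra hi
  have hmin := fun k (hk : k < Nat.find ex) => Nat.find_min ex hk
  generalize Nat.find ex = b at *
  cases b with
  | zero => exact i.elim0
  | succ b =>
    refine hmin b (by omega) ⟨fun j => g (i.succAbove j), fun y => ?_⟩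
    obtain ⟨u, hu⟩ := hg y
    have hun : IsUnit (v i) := by simpa using hi
    obtain ⟨w, hw⟩ := hun.exists_left_inv
    refine ⟨fun j => u (i.succAbove j) - u i * w * v (i.succAbove j), ?_⟩
    rw [Fin.sum_univ_succAbove _ i] at hv hu
    have : g i = - w • ∑ j : Fin b, v (i.succAbove j) • g (i.succAbove j) := by
      have h2 : w • (v i • g i) = g i := by rw [smul_smul, hw, one_smul]
      rw [← h2, eq_neg_of_add_eq_zero_left hv, smul_neg, neg_smul]
    rw [hu, this]
    simp only [sub_smul, Finset.sum_sub_distrib, mul_smul, Finset.smul_sum, neg_smul, smul_neg]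
    rw [Finset.sum_neg_distrib]; abel

lemma mact_col {ι κ : Type*} [Fintype ι] [Fintype κ] (D : Matrix ι κ R) {μ : Type*} [Fintype μ] (E : Matrix ι μ R)
    (h : ∀ c, (fun a => E a c) ∈ LinearMap.range (mact R D)) : ∃ s : Matrix κ μ R, D * s = E := by
  choose s hs using h
  refine ⟨Matrix.of fun k c => s c k, ?_⟩
  ext a c
  rw [Matrix.mul_apply]
  exact congrFun (hs c) a

end

section AB
variable {R : Type u} [CommRing R] [IsLocalRing R] [IsNoetherianRing R]

lemma exists_reg (N : Type u) [AddCommGroup N] [Module R N] [Module.Finite R N]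
    (h : ∀ q : N, (∀ x ∈ maximalIdeal R, x • q = 0) → q = 0) :
    ∃ x ∈ maximalIdeal R, IsSMulRegular N x := by
  have : Subsingleton ((R ⧸ maximalIdeal R) →ₗ[R] N) := by
    refine subsingleton_of_forall_eq 0 fun f => ?_
    refine LinearMap.ext fun y => ?_
    refine h _ fun x hx => ?_
    rw [← map_smul]
    have : x • y = 0 := by
      obtain ⟨y, rfl⟩ := Ideal.Quotient.mk_surjective y
      rw [← Ideal.Quotient.mkₐ_eq_mk R, ← map_smul, Ideal.Quotient.mkₐ_eq_mk, Ideal.Quotient.eq_zero_iff_mem]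
      exact Ideal.mul_mem_right _ _ hx
    rw [this, map_zero]
  obtain ⟨x, hx, h⟩ := IsSMulRegular.subsingleton_linearMap_iff.1 this
  rw [Ideal.annihilator_quotient] at hx
  exact ⟨x, hx, h⟩

lemma ab {ι : ℕ → Type} [∀ j, Fintype (ι j)]
    {D : ∀ j, Matrix (ι j) (ι (j + 1)) R} (DD : ∀ j, D j * D (j + 1) = 0) (n : ℕ)
    (hD : ∀ a b, D n a b ∈ maximalIdeal R) [Nonempty (ι (n + 1))] [IsEmpty (ι (n + 2))] (t : ℕ) :
    ∀ (k : ℕ), n + 1 ≤ k + t → ∀ (N : Type u) [AddCommGroup N] [Module R N] [Module.Finite R N] [Nontrivial N],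
    (∀ i, k < i → mhl D N i = 0) →
    ∃ rs : List R, (∀ x ∈ rs, x ∈ maximalIdeal R) ∧ IsRegular N rs ∧ n + 1 ≤ k + rs.length := by
  classical
  induction t with
  | zero =>
    intro k hk N _ _ _ _ h
    exact ⟨[], by simp, IsRegular.nil R N, by simpa using hk⟩
  | succ t ih =>
    intro k hk N _ _ _ _ h
    by_cases hkn : n + 1 ≤ k
    · exact ⟨[], by simp, IsRegular.nil R N, by simpa using hkn⟩
    have h0 := le_of_slen_eq_zero _ _ (h (n + 1) (by omega))
    obtain ⟨x, hx, hr⟩ := exists_reg N (fun q hq => by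
      have : (fun _ => q : ι (n + 1) → N) ∈ LinearMap.ker (mact N (D n)) := by
        rw [LinearMap.mem_ker]
        ext a
        rw [mact_apply]
        exact Finset.sum_eq_zero fun b _ => hq _ (hD a b)
      obtain ⟨w, hw⟩ := h0 this
      have h2 := congrFun hw (Classical.arbitrary _)
      rw [← h2]
      change (mact N (D (n + 1)) w) _ = 0
      rw [mact_apply]
      simp)
    have : Nontrivial (QuotSMulTop x N) := by
      refine Submodule.Quotient.nontrivial_iff.2 ?_
      intro htop
      have : (⊤ : Submodule R N) ≤ maximalIdeal R • ⊤ := by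
        refine le_trans htop.ge ?_
        rintro _ ⟨y, -, rfl⟩
        exact Submodule.smul_mem_smul hx trivial
      have := Submodule.eq_bot_of_le_smul_of_le_jacobson_bot _ _ Module.Finite.fg_top this (maximalIdeal_le_jacobson _)
      exact (top_ne_bot this)
    obtain ⟨rs, h1, h2, h3⟩ := ih (k + 1) (by omega) (QuotSMulTop x N) (by
      intro i hi
      obtain ⟨r, a, b, e1, e2, e3, e4, -⟩ := mles DD (LinearMap.lsmul R N x)
        (Submodule.mkQ (x • (⊤ : Submodule R N))) hr (by
          intro y
          rw [Submodule.mkQ_apply, Submodule.Quotient.mk_eq_zero]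
          simp [Submodule.mem_smul_pointwise_iff_exists]) (Submodule.mkQ_surjective _)
      cases i with
      | zero => omega
      | succ i =>
        rw [e4]
        have f1 := h i (by omega)
        have f2 := h (i + 1) (by omega)
        rw [e1] at f1
        rw [e2] at f2
        simp only [add_eq_zero] at f1 f2 ⊢
        exact ⟨f2.2, f1.1⟩)
    exact ⟨x :: rs, by simpa using ⟨hx, h1⟩, (isRegular_cons_iff _ _ _).2 ⟨hr, h2⟩, by
      simp only [List.length_cons]; omega⟩

end AB

section Resol
variable {R : Type u} [CommRing R] [IsLocalRing R] [IsNoetherianRing R]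

lemma res_step (s : Σ b : ℕ, Submodule R (Fin b → R)) : ∃ (b : ℕ) (D : Matrix (Fin s.1) (Fin b) R),
    LinearMap.range (mact R D) = s.2 ∧ ∀ v, mact R D v = 0 → ∀ j, v j ∈ maximalIdeal R := by
  obtain ⟨b, g, h1, h2⟩ := min_gens (R := R) s.2
  have key : ∀ v : Fin b → R, mact R (Matrix.of fun a j => (g j : Fin s.1 → R) a) v =
      ((∑ j, v j • g j : s.2) : Fin s.1 → R) := by
    intro v
    ext a
    rw [mact_apply]
    simp [mul_comm]
  refine ⟨b, Matrix.of fun a j => (g j : Fin s.1 → R) a, ?_, ?_⟩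
  · apply le_antisymm
    · rintro _ ⟨v, rfl⟩
      rw [key]
      exact Subtype.prop _
    · intro y hy
      obtain ⟨u, hu⟩ := h1 ⟨y, hy⟩
      exact ⟨u, by rw [key, ← hu]⟩
  · intro v hv
    refine h2 v ?_
    rw [key] at hv
    exact Subtype.ext hv

/-- a minimal free resolution of the quotient by a submodule of a free module -/
lemma min_res (b₀ : ℕ) (K₀ : Submodule R (Fin b₀ → R)) (hK : ∀ v ∈ K₀, ∀ j, v j ∈ maximalIdeal R) :
    ∃ (b : ℕ → ℕ) (K : ∀ j, Submodule R (Fin (b j) → R)) (D : ∀ j, Matrix (Fin (b j)) (Fin (b (j + 1))) R),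
    (∃ h : b 0 = b₀, h ▸ K 0 = K₀) ∧ (∀ j, LinearMap.range (mact R (D j)) = K j) ∧
    (∀ j, LinearMap.ker (mact R (D j)) = K (j + 1)) ∧ ∀ j, ∀ v ∈ K j, ∀ i, v i ∈ maximalIdeal R := by
  choose b D h1 h2 using res_step (R := R)
  let s : ℕ → Σ b : ℕ, Submodule R (Fin b → R) := fun j =>
    Nat.rec ⟨b₀, K₀⟩ (fun _ s => ⟨b s, LinearMap.ker (mact R (D s))⟩) j
  refine ⟨fun j => (s j).1, fun j => (s j).2, fun j => D (s j), ⟨rfl, rfl⟩, fun j => h1 _, fun j => rfl, ?_⟩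
  intro j
  cases j with
  | zero => exact hK
  | succ j => exact fun v hv => h2 (s j) v hv

lemma proj_kills {b c : ℕ} (D : Matrix (Fin b) (Fin c) R)
    (hp : Module.Projective R (LinearMap.range (mact R D)))
    (hk : ∀ v ∈ LinearMap.ker (mact R D), ∀ i, v i ∈ maximalIdeal R) : LinearMap.ker (mact R D) = ⊥ := by
  obtain ⟨s, hs⟩ := Module.projective_lifting_property (mact R D).rangeRestrict LinearMap.id
    (LinearMap.surjective_rangeRestrict _)
  have hs' : ∀ y, (mact R D) (s y) = y := fun y => congrArg Subtype.val (LinearMap.congr_fun hs y)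
  let p : (Fin c → R) →ₗ[R] (Fin c → R) := LinearMap.id - s ∘ₗ (mact R D).rangeRestrict
  have hp1 : ∀ v, p v ∈ LinearMap.ker (mact R D) := by
    intro v
    rw [LinearMap.mem_ker]
    simp only [p, LinearMap.sub_apply, LinearMap.id_apply, LinearMap.comp_apply, map_sub, hs']
    exact sub_self _
  have hp2 : ∀ v ∈ LinearMap.ker (mact R D), p v = v := by
    intro v hv
    have : (mact R D).rangeRestrict v = 0 := by
      apply Subtype.ext; exact hv
    simp [p, this]
  refine Submodule.eq_bot_of_le_smul_of_le_jacobson_bot (maximalIdeal R) _ (IsNoetherian.noetherian _) ?_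
    (maximalIdeal_le_jacobson _)
  intro v hv
  rw [← hp2 v hv, pi_eq_sum_univ' v, map_sum]
  refine Submodule.sum_mem _ fun i _ => ?_
  rw [map_smul]
  exact Submodule.smul_mem_smul (hk v hv i) (hp1 _)

lemma pd_step {b c : ℕ} (D : Matrix (Fin b) (Fin c) R) (n : ℕ)
    (h : HasProjectiveDimensionLT (ModuleCat.of R (LinearMap.range (mact R D))) (n + 2)) :
    HasProjectiveDimensionLT (ModuleCat.of R (LinearMap.ker (mact R D))) (n + 1) := by
  have hS := ses (LinearMap.ker (mact R D)).subtype (mact R D).rangeRestrict Subtype.val_injective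
    (by
      intro v
      constructor
      · intro hv
        exact ⟨⟨v, congrArg Subtype.val hv⟩, rfl⟩
      · rintro ⟨w, rfl⟩
        exact Subtype.ext w.2) (LinearMap.surjective_rangeRestrict _)
  refine (hS.hasProjectiveDimensionLT_X₃_iff n ?_).1 h
  exact (IsProjective.iff_projective (R := R) (Fin c → R)).1 inferInstance

theorem cm_of_finpd (N : Type u) [AddCommGroup N] [Module R N] [Module.Finite R N] [Nontrivial N] (T : ℕ)
    (hT : ∀ x ∈ maximalIdeal R ^ T, ∀ y : N, x • y = 0) (n : ℕ)
    (hn : HasProjectiveDimensionLT (ModuleCat.of R N) n) :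
    ∃ rs : List R, (∀ x ∈ rs, x ∈ maximalIdeal R) ∧ IsRegular R rs ∧ ringKrullDim R ≤ rs.length := by
  classical
  obtain ⟨b₀, g, hg1, hg2⟩ := min_gens (R := R) N
  let p : (Fin b₀ → R) →ₗ[R] N := Fintype.linearCombination R g
  have hpd : ∀ v, p v = ∑ j, v j • g j := fun v => rfl
  have hps : Function.Surjective p := fun y => by
    obtain ⟨u, hu⟩ := hg1 y; exact ⟨u, hu.symm⟩
  obtain ⟨b, K, D, ⟨hb, hK0⟩, hr, hk, hm⟩ := min_res b₀ (LinearMap.ker p) (fun v hv => hg2 v hv)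
  subst hb
  change K 0 = _ at hK0
  have hDm : ∀ j a c, D j a c ∈ maximalIdeal R := by
    intro j a c
    have : mact R (D j) (Pi.single c 1) ∈ K j := by rw [← hr]; exact ⟨_, rfl⟩
    have := hm j _ this a
    rw [mact_apply] at this
    simpa [Pi.single_apply] using this
  have fac : ∀ j {μ : Type} [Fintype μ] (E : Matrix (Fin (b (j + 1))) μ R), D j * E = 0 →
      ∃ s : Matrix (Fin (b (j + 2))) μ R, D (j + 1) * s = E := by
    intro j μ _ E hE
    refine mact_col _ _ fun c => ?_
    rw [hr, ← hk, LinearMap.mem_ker]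
    ext a
    exact congrFun (congrFun hE a) c
  have DD : ∀ j, D j * D (j + 1) = 0 := by
    intro j
    ext a c
    have : mact R (D (j + 1)) (Pi.single c 1) ∈ LinearMap.ker (mact R (D j)) := by
      rw [hk, ← hr]; exact ⟨_, rfl⟩
    have := congrFun this a
    rw [← mact_mul, mact_apply] at this
    simpa [Pi.single_apply] using this
  have hne : Nonempty (Fin (b 0)) := by
    by_contra h
    rw [not_nonempty_iff] at h
    have : Subsingleton N := hps.subsingleton
    exact not_subsingleton N this
  have kill : ∀ x ∈ maximalIdeal R ^ T, Kills D x := by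
    intro x hx
    have h0 : ∃ s : Matrix (Fin (b 1)) (Fin (b 0)) R, D 0 * s = scal (Fin (b 0)) x := by
      refine mact_col _ _ fun c => ?_
      rw [hr, hK0, LinearMap.mem_ker]
      have : (fun a => scal (Fin (b 0)) x a c) = x • Pi.single c 1 := by
        ext a
        rw [scal_eq]
        simp [Matrix.diagonal_apply, Pi.single_apply]
      rw [this, map_smul, hT x hx]
    have sc : ∀ j, D j * scal (Fin (b (j + 1))) x = scal (Fin (b j)) x * D j := by
      intro j
      rw [scal_eq_smul, scal_eq_smul]; simp
    let P : ∀ j, Matrix (Fin (b (j + 1))) (Fin (b j)) R → Prop := fun j s => D j * (scal (Fin (b (j + 1))) x - s * D j) = 0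
    have st : ∀ j (s : {s // P j s}), ∃ s' : {s // P (j + 1) s}, s.1 * D j + D (j + 1) * s'.1 = scal (Fin (b (j + 1))) x := by
      intro j s
      obtain ⟨s', hs'⟩ := fac j _ s.2
      refine ⟨⟨s', ?_⟩, by rw [hs']; abel⟩
      change D (j + 1) * (scal (Fin (b (j + 2))) x - s' * D (j + 1)) = 0
      rw [Matrix.mul_sub, ← Matrix.mul_assoc, hs', sc, Matrix.sub_mul, Matrix.mul_assoc, DD]
      simp
    choose nx hnx using st
    obtain ⟨s0, hs0⟩ := h0
    let s : ∀ j, {s // P j s} := fun j => Nat.rec ⟨s0, by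
      change D 0 * (scal (Fin (b 1)) x - s0 * D 0) = 0
      rw [Matrix.mul_sub, ← Matrix.mul_assoc, hs0, sc, sub_self]⟩ (fun j s => nx j s) j
    exact ⟨fun j => (s j).1, hs0, fun j => hnx j (s j)⟩
  -- finiteness
  have zero1 : ∀ j, K j = ⊥ → b (j + 1) = 0 := by
    intro j hj
    by_contra h0
    have : mact R (D j) (fun _ => 1) = 0 := by
      have : mact R (D j) (fun _ => 1) ∈ K j := by rw [← hr]; exact ⟨_, rfl⟩
      rwa [hj] at this
    have h1 := hm (j + 1) (fun _ => 1) (by rw [← hk]; exact this) ⟨0, by omega⟩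
    exact (Ideal.ne_top_iff_one _).1 (Ideal.IsPrime.ne_top inferInstance) h1
  have zero2 : ∀ j, b j = 0 → b (j + 1) = 0 := by
    intro j hj
    refine zero1 j ?_
    have : IsEmpty (Fin (b j)) := by rw [hj]; infer_instance
    exact Subsingleton.elim _ _
  have hpd0 : HasProjectiveDimensionLT (ModuleCat.of R (K 0)) (n + 1) := by
    have hS := ses (LinearMap.ker p).subtype p Subtype.val_injective (LinearMap.exact_subtype_ker_map p) hps
    rw [hK0]
    refine (hS.hasProjectiveDimensionLT_X₃_iff n ?_).1 ?_
    · exact (IsProjective.iff_projective (R := R) (Fin (b 0) → R)).1 inferInstance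
    · exact hasProjectiveDimensionLT_of_ge _ n _ (by omega)
  have hpdj : ∀ j, j ≤ n → HasProjectiveDimensionLT (ModuleCat.of R (K j)) (n - j + 1) := by
    intro j
    induction j with
    | zero => intro _; exact hpd0
    | succ j ih =>
      intro hj
      have := ih (by omega)
      rw [← hr, show n - j + 1 = (n - (j + 1)) + 2 by omega] at this
      rw [← hk]
      exact pd_step _ _ this
  have hbn : b (n + 2) = 0 := by
    refine zero1 (n + 1) ?_
    rw [← hk]
    refine proj_kills _ ?_ ?_
    · rw [hr]
      have := hpdj n le_rfl
      rw [Nat.sub_self, zero_add, ← projective_iff_hasProjectiveDimensionLT_one] at this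
      exact (IsProjective.iff_projective (R := R) (K n)).2 this
    · rw [hk]; exact hm _
  have hex : ∃ j, b j = 0 := ⟨_, hbn⟩
  obtain ⟨l, hl⟩ : ∃ l, Nat.find hex = l + 1 := Nat.exists_eq_succ_of_ne_zero (by
    intro h
    have := Nat.find_spec hex
    rw [h] at this
    rw [this] at hne
    exact hne.elim Fin.elim0)
  have hl1 : b (l + 1) = 0 := hl ▸ Nat.find_spec hex
  have hl0 : b l ≠ 0 := Nat.find_min hex (by omega)
  have hall : ∀ j, l < j → IsEmpty (Fin (b j)) := by
    intro j hj
    have : b j = 0 := by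
      induction j, hj using Nat.le_induction with
      | base => exact hl1
      | succ j hj ih => exact zero2 _ ih
    rw [this]; infer_instance
  have hdim : ringKrullDim R ≤ l := by
    refine nit (ι := fun j => Fin (b j)) DD (hDm 0) l hall fun x hx => ⟨T, kill _ (Ideal.pow_mem_pow hx T)⟩
  cases l with
  | zero => exact ⟨[], by simp, IsRegular.nil R R, by simpa using hdim⟩
  | succ l =>
    have i1 : Nonempty (Fin (b (l + 1))) := ⟨⟨0, by omega⟩⟩
    have i2 : IsEmpty (Fin (b (l + 2))) := hall _ (by omega)
    obtain ⟨rs, h1, h2, h3⟩ := ab (ι := fun j => Fin (b j)) DD l (hDm l) (l + 1) 0 (by omega) R (by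
      intro i hi
      cases i with
      | zero => omega
      | succ i =>
        refine slen_eq_zero _ _ ?_
        change LinearMap.ker (mact R (D i)) ≤ LinearMap.range (mact R (D (i + 1)))
        rw [hr, hk])
    refine ⟨rs, h1, h2, hdim.trans ?_⟩
    have : l + 1 ≤ rs.length := by omega
    exact_mod_cast this

end Resol
end NIT

end

section
open CategoryTheory IsLocalRing RingTheory.Sequence
open scoped Pointwise TensorProduct

namespace NIT

section F1
variable {R : Type u} [CommRing R]

lemma ext_compare (A B : ModuleCat.{u} R) (i : ℕ)
    (h : Subsingleton (((Ext R (ModuleCat.{u} R) (i + 1)).obj (Opposite.op A)).obj B)) :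
    Subsingleton (Abelian.Ext A B (i + 1)) := by
  let P := projectiveResolution A
  have h1 : Limits.IsZero ((P.complex.linearYonedaObj R B).homology (i + 1)) :=
    (ModuleCat.isZero_iff_subsingleton.2 h).of_iso (P.isoExt (i + 1) B).symm
  rw [← HomologicalComplex.exactAt_iff_isZero_homology,
    HomologicalComplex.exactAt_iff' _ i (i + 1) (i + 2) (by simp) (by simp)] at h1
  rw [ShortComplex.moduleCat_exact_iff] at h1
  refine subsingleton_of_forall_eq 0 fun α => ?_
  obtain ⟨f, hf, rfl⟩ := P.extMk_surjective α (i + 2) rfl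
  rw [P.extMk_eq_zero_iff _ _ _ _ i rfl]
  obtain ⟨g, hg⟩ := h1 f hf
  exact ⟨g, hg⟩

end F1

section F2
variable {R : Type u} [CommRing R]

/-- vanishing of Ext -/
def EV (i : ℕ) (A B : Type u) [AddCommGroup A] [AddCommGroup B] [Module R A] [Module R B] : Prop :=
  Subsingleton (Abelian.Ext (ModuleCat.of R A) (ModuleCat.of R B) i)

variable {A B M K : Type u} [AddCommGroup A] [AddCommGroup B] [AddCommGroup M] [AddCommGroup K]
  [Module R A] [Module R B] [Module R M] [Module R K]

lemma ev_lift (f : A →ₗ[R] B) (g : B →ₗ[R] M)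
    (hf : Function.Injective f) (ex : Function.Exact f g) (hg : Function.Surjective g)
    (h : EV (R := R) 1 K A) (φ : K →ₗ[R] M) : ∃ ψ : K →ₗ[R] B, g ∘ₗ ψ = φ := by
  have hS := ses f g hf ex hg
  obtain ⟨x, hx⟩ := Abelian.Ext.covariant_sequence_exact₃ (ModuleCat.of R K) hS
    (Abelian.Ext.mk₀ (ModuleCat.ofHom φ)) (n₁ := 1) (zero_add 1) (h.elim _ _)
  obtain ⟨ψ, rfl⟩ := (Abelian.Ext.mk₀_bijective _ _).2 x
  rw [Abelian.Ext.mk₀_comp_mk₀] at hx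
  have := (Abelian.Ext.mk₀_bijective _ _).1 hx
  refine ⟨ψ.hom, ?_⟩
  exact congrArg ModuleCat.Hom.hom this

lemma ev_extend (f : A →ₗ[R] B) (g : B →ₗ[R] M)
    (hf : Function.Injective f) (ex : Function.Exact f g) (hg : Function.Surjective g)
    (h : EV (R := R) 1 M K) (φ : A →ₗ[R] K) : ∃ ψ : B →ₗ[R] K, ψ ∘ₗ f = φ := by
  have hS := ses f g hf ex hg
  obtain ⟨x, hx⟩ := Abelian.Ext.contravariant_sequence_exact₁ hS (ModuleCat.of R K)
    (Abelian.Ext.mk₀ (ModuleCat.ofHom φ)) (n₁ := 1) (add_zero 1) (h.elim _ _)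
  obtain ⟨ψ, rfl⟩ := (Abelian.Ext.mk₀_bijective _ _).2 x
  rw [Abelian.Ext.mk₀_comp_mk₀] at hx
  have := (Abelian.Ext.mk₀_bijective _ _).1 hx
  refine ⟨ψ.hom, ?_⟩
  exact congrArg ModuleCat.Hom.hom this

lemma ev_coker (f : A →ₗ[R] B) (g : B →ₗ[R] M)
    (hf : Function.Injective f) (ex : Function.Exact f g) (hg : Function.Surjective g) (i : ℕ)
    (hA : EV (R := R) (i + 1) K A) (hB : EV (R := R) i K B) : EV (R := R) i K M := by
  have hS := ses f g hf ex hg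
  refine subsingleton_of_forall_eq 0 fun x => ?_
  obtain ⟨y, hy⟩ := Abelian.Ext.covariant_sequence_exact₃ (ModuleCat.of R K) hS x rfl (hA.elim _ _)
  rw [← hy, hB.elim y 0, Abelian.Ext.zero_comp]

lemma ev_proj [Module.Projective R A] (i : ℕ) : EV (R := R) (i + 1) A M := by
  have : Projective (ModuleCat.of R A) := (IsProjective.iff_projective (R := R) A).1 inferInstance
  exact subsingleton_of_forall_eq 0 fun x => Abelian.Ext.eq_zero_of_projective x

lemma ev_dim (f : A →ₗ[R] B) (g : B →ₗ[R] M) [Module.Projective R B]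
    (hf : Function.Injective f) (ex : Function.Exact f g) (hg : Function.Surjective g) (i : ℕ)  :
    EV (R := R) (i + 2) M K ↔ EV (R := R) (i + 1) A K := by
  have hS := ses f g hf ex hg
  constructor
  · intro h
    refine subsingleton_of_forall_eq 0 fun x => ?_
    obtain ⟨y, hy⟩ := Abelian.Ext.contravariant_sequence_exact₁ hS (ModuleCat.of R K) x
      (n₁ := i + 2) (by omega) (h.elim _ _)
    rw [← hy, (ev_proj (R := R) (A := B) (M := K) i).elim y 0, Abelian.Ext.comp_zero]
  · intro h
    refine subsingleton_of_forall_eq 0 fun x => ?_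
    obtain ⟨y, hy⟩ := Abelian.Ext.contravariant_sequence_exact₃ hS (ModuleCat.of R K) x
      ((ev_proj (R := R) (A := B) (M := K) (i + 1)).elim _ _) (n₀ := i + 1) (by omega)
    rw [← hy, h.elim y 0, Abelian.Ext.comp_zero]

lemma ev_of_extend (f : A →ₗ[R] B) (g : B →ₗ[R] M) [Module.Projective R B]
    (hf : Function.Injective f) (ex : Function.Exact f g) (hg : Function.Surjective g)
    (h : ∀ φ : A →ₗ[R] K, ∃ ψ : B →ₗ[R] K, ψ ∘ₗ f = φ) : EV (R := R) 1 M K := by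
  have hS := ses f g hf ex hg
  refine subsingleton_of_forall_eq 0 fun x => ?_
  obtain ⟨y, hy⟩ := Abelian.Ext.contravariant_sequence_exact₃ hS (ModuleCat.of R K) x
      ((ev_proj (R := R) (A := B) (M := K) 0).elim _ _) (n₀ := 0) (by omega)
  obtain ⟨φ, rfl⟩ := (Abelian.Ext.mk₀_bijective _ _).2 y
  obtain ⟨ψ, hψ⟩ := h φ.hom
  have : φ = ModuleCat.ofHom f ≫ ModuleCat.ofHom ψ := by
    ext x; exact (LinearMap.congr_fun hψ x).symm
  rw [← hy, this, ← Abelian.Ext.mk₀_comp_mk₀]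
  exact hS.extClass_comp_assoc _

end F2

section LemA
variable {R : Type u} [CommRing R] {C P K : Type u} [AddCommGroup C] [Module R C]
  [AddCommGroup P] [Module R P] [AddCommGroup K] [Module R K] [Module.Projective R P]

lemma exists_phi : ∃ (s : P →ₗ[R] (P →₀ R)) (φ : C ⊗[R] P →ₗ[R] (P →₀ C)),
    (∀ p, Finsupp.linearCombination R id (s p) = p) ∧ (∀ c p i, φ (c ⊗ₜ p) i = s p i • c) ∧
    ∀ z, z = (φ z).sum fun i c => c ⊗ₜ[R] i := by
  classical
  obtain ⟨s, hs⟩ := Module.projective_def.1 (inferInstance : Module.Projective R P)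
  refine ⟨s, (TensorProduct.finsuppScalarRight R R C P).toLinearMap ∘ₗ s.lTensor C, hs, ?_, ?_⟩
  · intro c p i
    simp
  · let q : (P →₀ C) →ₗ[R] C ⊗[R] P := Finsupp.lsum R fun i => (TensorProduct.mk R C P).flip i
    have hq : ∀ v, q v = v.sum fun i c => c ⊗ₜ[R] i := fun v => rfl
    intro z
    rw [← hq]
    induction z with
    | zero => simp
    | add x y hx hy => rw [map_add, map_add, ← hx, ← hy]
    | tmul c p =>
      have : ((TensorProduct.finsuppScalarRight R R C P).toLinearMap ∘ₗ s.lTensor C) (c ⊗ₜ p)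
        = (s p).sum fun i n => Finsupp.single i (n • c) := by
        simp [TensorProduct.finsuppScalarRight_apply_tmul]
      rw [this, map_finsuppSum]
      conv_lhs => rw [← hs p]
      rw [Finsupp.linearCombination_apply, Finsupp.sum, Finsupp.sum, TensorProduct.tmul_sum]
      refine Finset.sum_congr rfl fun i _ => ?_
      rw [hq, Finsupp.sum_single_index (by simp)]
      simp [TensorProduct.smul_tmul]

lemma lemA [Module.Finite R K] (g : K →ₗ[R] C ⊗[R] P) :
    ∃ (S : Finset P) (h : P → (K →ₗ[R] C)), ∀ x, g x = ∑ i ∈ S, h i x ⊗ₜ[R] i := by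
  classical
  obtain ⟨s, φ, -, -, h3⟩ := exists_phi (R := R) (C := C) (P := P)
  obtain ⟨T, hT⟩ := (Module.Finite.fg_top : (⊤ : Submodule R K).FG)
  refine ⟨T.biUnion fun x => (φ (g x)).support, fun i => Finsupp.lapply i ∘ₗ φ ∘ₗ g, fun x => ?_⟩
  have hx : x ∈ (Finsupp.supported C R (↑(T.biUnion fun x => (φ (g x)).support) : Set P)).comap (φ ∘ₗ g) := by
    have : (⊤ : Submodule R K) ≤ (Finsupp.supported C R (↑(T.biUnion fun x => (φ (g x)).support) : Set P)).comap (φ ∘ₗ g) := by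
      rw [← hT, Submodule.span_le]
      intro y hy
      change _ ∈ Finsupp.supported C R _
      rw [Finsupp.mem_supported]
      exact_mod_cast Finset.subset_biUnion_of_mem (fun x => (φ (g x)).support) hy
    exact this trivial
  change _ ∈ Finsupp.supported C R _ at hx
  rw [Finsupp.mem_supported] at hx
  conv_lhs => rw [h3 (g x)]
  exact Finset.sum_subset (by exact_mod_cast hx) (fun i _ hi => by
    simp only [Finsupp.notMem_support_iff.1 hi, TensorProduct.zero_tmul])

lemma lemB [IsNoetherianRing R] (i : ℕ) : ∀ (K : Type u) [AddCommGroup K] [Module R K] [Module.Finite R K],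
    EV (R := R) (i + 1) K C → EV (R := R) (i + 1) K (C ⊗[R] P) := by
  induction i with
  | zero =>
    intro K _ _ _ h
    obtain ⟨b, p, hp⟩ := Module.Finite.exists_fin' R K
    refine ev_of_extend (LinearMap.ker p).subtype p Subtype.val_injective (LinearMap.exact_subtype_ker_map p) hp ?_
    intro φ
    obtain ⟨S, g, hg⟩ := lemA φ
    choose ψ hψ using fun i => ev_extend (LinearMap.ker p).subtype p Subtype.val_injective
      (LinearMap.exact_subtype_ker_map p) hp h (g i)
    refine ⟨∑ i ∈ S, (TensorProduct.mk R C P).flip i ∘ₗ ψ i, ?_⟩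
    ext x
    rw [hg]
    simp only [LinearMap.comp_apply, LinearMap.sum_apply]
    refine Finset.sum_congr rfl fun i _ => ?_
    rw [← hψ i]
    rfl
  | succ i ih =>
    intro K _ _ _ h
    obtain ⟨b, p, hp⟩ := Module.Finite.exists_fin' R K
    rw [ev_dim (LinearMap.ker p).subtype p Subtype.val_injective (LinearMap.exact_subtype_ker_map p) hp] at h ⊢
    exact ih _ h

lemma eta_bij [Module.Finite R C] (hC : Function.Bijective (fun r : R => (r • LinearMap.id : C →ₗ[R] C))) :
    Function.Bijective (TensorProduct.mk R C P).flip := by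
  constructor
  · rw [injective_iff_map_eq_zero]
    intro p hp
    obtain ⟨s, φ, h1, h2, -⟩ := exists_phi (R := R) (C := C) (P := P)
    have : s p = 0 := by
      ext i
      apply hC.1
      ext c
      have := h2 c p i
      rw [show c ⊗ₜ[R] p = 0 from LinearMap.congr_fun hp c, map_zero] at this
      simpa using this.symm
    rw [← h1 p, this, map_zero]
  · intro g
    obtain ⟨S, h, hg⟩ := lemA g
    choose r hr using fun i => hC.2 (h i)
    refine ⟨∑ i ∈ S, r i • i, ?_⟩
    ext c
    rw [hg]
    simp only [LinearMap.flip_apply, TensorProduct.mk_apply, TensorProduct.tmul_sum]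
    refine Finset.sum_congr rfl fun i _ => ?_
    rw [← hr i]
    simp [TensorProduct.smul_tmul]

end LemA

section Cls
variable {R : Type u} [CommRing R] (C : Type u) [AddCommGroup C] [Module R C]

/-- evaluation -/
noncomputable def evl (M : Type u) [AddCommGroup M] [Module R M] : C ⊗[R] (C →ₗ[R] M) →ₗ[R] M :=
  TensorProduct.lift LinearMap.applyₗ

@[simp] lemma evl_tmul (M : Type u) [AddCommGroup M] [Module R M] (c : C) (f : C →ₗ[R] M) :
    evl C M (c ⊗ₜ f) = f c := by simp [evl]

/-- the Foxby class condition with finite projective dimension -/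
structure FoxGood (M : Type u) [AddCommGroup M] [Module R M] : Prop where
  ev : ∀ i, EV (R := R) (i + 1) C M
  bij : Function.Bijective (evl (R := R) C M)
  pd : ∃ n, HasProjectiveDimensionLT (ModuleCat.of R (C →ₗ[R] M)) n

variable {C}

lemma good_coker {A B M : Type u} [AddCommGroup A] [AddCommGroup B] [AddCommGroup M]
    [Module R A] [Module R B] [Module R M] (f : A →ₗ[R] B) (g : B →ₗ[R] M)
    (hf : Function.Injective f) (ex : Function.Exact f g) (hg : Function.Surjective g)
    (hA : FoxGood (R := R) C A) (hB : FoxGood (R := R) C B) : FoxGood (R := R) C M := by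
  let f' : (C →ₗ[R] A) →ₗ[R] (C →ₗ[R] B) := LinearMap.llcomp R C A B f
  let g' : (C →ₗ[R] B) →ₗ[R] (C →ₗ[R] M) := LinearMap.llcomp R C B M g
  have hf' : Function.Injective f' := by
    intro a b h
    ext c
    exact hf (LinearMap.congr_fun h c)
  have hg' : Function.Surjective g' := fun φ => ev_lift f g hf ex hg (hA.ev 0) φ
  have ex' : Function.Exact f' g' := by
    intro φ
    constructor
    · intro h
      have : ∀ c, ∃ a, f a = φ c := fun c => (ex _).1 (LinearMap.congr_fun h c)
      refine ⟨LinearMap.codRestrictOfInjective φ f hf (fun c => this c), ?_⟩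
      ext c
      exact LinearMap.codRestrictOfInjective_comp_apply φ f hf (fun c => this c) c
    · rintro ⟨ψ, rfl⟩
      ext c
      exact (ex _).2 ⟨ψ c, rfl⟩
  have nf : ∀ z, evl C B (f'.lTensor C z) = f (evl C A z) := by
    intro z
    induction z with
    | zero => simp
    | add x y hx hy => simp only [map_add, hx, hy]
    | tmul c φ => simp [f']
  have ng : ∀ z, evl C M (g'.lTensor C z) = g (evl C B z) := by
    intro z
    induction z with
    | zero => simp
    | add x y hx hy => simp only [map_add, hx, hy]
    | tmul c φ => simp [g']
  have ext := lTensor_exact C ex' hg'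
  refine ⟨fun i => ev_coker f g hf ex hg _ (hA.ev _) (hB.ev _), ⟨?_, ?_⟩, ?_⟩
  · rw [injective_iff_map_eq_zero]
    intro z hz
    obtain ⟨w, rfl⟩ := LinearMap.lTensor_surjective C hg' z
    rw [ng] at hz
    obtain ⟨a, ha⟩ := (ex _).1 hz
    obtain ⟨t, rfl⟩ := hA.bij.2 a
    rw [← nf] at ha
    have := hB.bij.1 ha
    exact (ext _).2 ⟨t, this⟩
  · intro y
    obtain ⟨b, rfl⟩ := hg y
    obtain ⟨t, rfl⟩ := hB.bij.2 b
    exact ⟨_, ng t⟩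
  · obtain ⟨n, hn⟩ := hA.pd
    obtain ⟨m, hm⟩ := hB.pd
    refine ⟨max n m + 1, (ses f' g' hf' ex' hg').hasProjectiveDimensionLT_X₃ (max n m) ?_ ?_⟩
    · exact hasProjectiveDimensionLT_of_ge _ n _ (le_max_left _ _)
    · exact hasProjectiveDimensionLT_of_ge _ m _ ((le_max_right n m).trans (Nat.le_succ _))

lemma good_zero (A : Type u) [AddCommGroup A] [Module R A] [Subsingleton A] : FoxGood (R := R) C A := by
  have hs : Subsingleton (C →ₗ[R] A) := ⟨fun a b => LinearMap.ext fun c => Subsingleton.elim _ _⟩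
  refine ⟨fun i => ?_, ⟨?_, ?_⟩, 0, ?_⟩
  · refine subsingleton_of_forall_eq 0 fun x => ?_
    have : Limits.IsZero (ModuleCat.of R A) := ModuleCat.isZero_of_iff_subsingleton.2 inferInstance
    rw [← Abelian.Ext.comp_mk₀_id x, this.eq_of_src (𝟙 _) 0, Abelian.Ext.mk₀_zero, Abelian.Ext.comp_zero]
  · intro x y _
    exact Subsingleton.elim _ _
  · intro y
    exact ⟨0, Subsingleton.elim _ _⟩
  · exact (hasProjectiveDimensionLT_zero_iff_isZero _).2 (ModuleCat.isZero_of_iff_subsingleton.2 hs)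

lemma good_equiv {A B : Type u} [AddCommGroup A] [AddCommGroup B]
    [Module R A] [Module R B] (e : A ≃ₗ[R] B) (hA : FoxGood (R := R) C A) : FoxGood (R := R) C B := by
  have : Subsingleton (LinearMap.ker e.toLinearMap) := by
    rw [e.ker]; infer_instance
  exact good_coker (LinearMap.ker e.toLinearMap).subtype e.toLinearMap Subtype.val_injective
    (LinearMap.exact_subtype_ker_map _) e.surjective (good_zero _) hA

lemma good_quot {M : Type u} [AddCommGroup M] [Module R M] (x : R) (hx : IsSMulRegular M x)
    (hM : FoxGood (R := R) C M) : FoxGood (R := R) C (QuotSMulTop x M) := by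
  refine good_coker (LinearMap.lsmul R M x) (Submodule.mkQ (x • (⊤ : Submodule R M))) hx ?_
    (Submodule.mkQ_surjective _) hM hM
  intro y
  rw [Submodule.mkQ_apply, Submodule.Quotient.mk_eq_zero]
  simp [Submodule.mem_smul_pointwise_iff_exists]

lemma good_list (rs : List R) : ∀ {M : Type u} [AddCommGroup M] [Module R M], IsWeaklyRegular M rs →
    FoxGood (R := R) C M → FoxGood (R := R) C (M ⧸ (Ideal.ofList rs • ⊤ : Submodule R M)) := by
  induction rs with
  | nil =>
    intro M _ _ _ h
    refine good_equiv (Submodule.quotEquivOfEqBot _ ?_).symm h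
    simp
  | cons x rs ih =>
    intro M _ _ hr h
    rw [isWeaklyRegular_cons_iff] at hr
    exact good_equiv (Submodule.quotOfListConsSMulTopEquivQuotSMulTopInner M x rs).symm
      (ih hr.2 (good_quot x hr.1 h))

lemma good_tensor [IsNoetherianRing R] [Module.Finite R C]
    (hC : Function.Bijective (fun r : R => (r • LinearMap.id : C →ₗ[R] C)))
    (hE : ∀ i, EV (R := R) (i + 1) C C) (P : Type u) [AddCommGroup P] [Module R P] [Module.Projective R P] :
    FoxGood (R := R) C (C ⊗[R] P) := by
  let e : P ≃ₗ[R] (C →ₗ[R] C ⊗[R] P) := LinearEquiv.ofBijective _ (eta_bij hC)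
  refine ⟨fun i => lemB i C (hE i), ?_, 1, ?_⟩
  · have : (evl C (C ⊗[R] P)) ∘ₗ (e.lTensor C).toLinearMap = LinearMap.id := by
      ext c p
      simp [e]
    have h2 : evl C (C ⊗[R] P) = (e.lTensor C).symm.toLinearMap := by
      refine LinearMap.ext fun z => ?_
      obtain ⟨z, rfl⟩ := (e.lTensor C).surjective z
      rw [LinearEquiv.coe_coe, LinearEquiv.symm_apply_apply]
      exact LinearMap.congr_fun this z
    rw [h2]
    exact LinearEquiv.bijective _
  · have : Module.Projective R (C →ₗ[R] C ⊗[R] P) := Module.Projective.of_equiv e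
    rw [← projective_iff_hasProjectiveDimensionLT_one]
    exact (IsProjective.iff_projective (R := R) _).1 inferInstance

end Cls
end NIT

end

open Paper IsLocalRing

namespace NIT

open RingTheory.Sequence in
lemma fin_aux (R : Type u) [CommRing R] [IsNoetherianRing R] [IsLocalRing R]
    (C : Type u) [AddCommGroup C] [Module R C] (hC : IsSemidualizing R C)
    (M : Type u) [AddCommGroup M] [Module R M] (hfin : cProjDim R C M ≠ ⊤) : FoxGood (R := R) C M := by
  obtain ⟨h1, h2, h3⟩ := hC
  have hE : ∀ i, EV (R := R) (i + 1) C C := fun i => ext_compare _ _ i (h3 (i + 1) (by omega))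
  have key : ∀ (k : ℕ) (N : ModuleCat.{u} R), ResDimLE R (fun N => IsCProjective R C N) k N → FoxGood (R := R) C N := by
    have base : ∀ N : ModuleCat.{u} R, IsCProjective R C N → FoxGood (R := R) C N := by
      rintro N ⟨P, hP, ⟨e⟩⟩
      exact good_equiv e.symm (good_tensor h2 hE P)
    intro k
    induction k with
    | zero => exact base
    | succ k ih =>
      rintro N (h | ⟨X, f, hX, hf, hk⟩)
      · exact ih N h
      · exact good_coker (LinearMap.ker f).subtype f Subtype.val_injective
          (LinearMap.exact_subtype_ker_map f) hf (ih _ hk) (base X hX)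
  have : {n : ℕ∞ | ∃ k : ℕ, (k : ℕ∞) = n ∧ ResDimLE R (fun N => IsCProjective R C N) k (ModuleCat.of R M)}.Nonempty := by
    by_contra h
    rw [Set.not_nonempty_iff_eq_empty] at h
    apply hfin
    unfold cProjDim ResDim
    rw [h, sInf_empty]
  obtain ⟨_, k, -, hk⟩ := this
  exact key k _ hk

open RingTheory.Sequence in
lemma depth_le (R : Type u) [CommRing R] [IsNoetherianRing R] [IsLocalRing R]
    (M : Type u) [AddCommGroup M] [Module R M] [Module.Finite R M] (rs : List R) (h : IsRegular M rs) :
    Module.supportDim R (M ⧸ (Ideal.ofList rs • ⊤ : Submodule R M)) + rs.length = moduleDim R M := by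
  rw [Module.supportDim_add_length_eq_supportDim_of_isRegular rs h,
    Module.supportDim_eq_ringKrullDim_quotient_annihilator]
  rfl

lemma pow_kill (R : Type u) [CommRing R] [IsNoetherianRing R] [IsLocalRing R]
    (M : Type u) [AddCommGroup M] [Module R M] [Module.Finite R M] [Nontrivial M]
    (h : Module.supportDim R M = 0) :
    ∃ T : ℕ, ∀ x ∈ maximalIdeal R ^ T, ∀ y : M, x • y = 0 := by
  rw [Module.supportDim_eq_ringKrullDim_quotient_annihilator] at h
  have hann : Nontrivial (R ⧸ Module.annihilator R M) := by
    refine Ideal.Quotient.nontrivial_iff.2 ?_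
    rw [Ne, Ideal.eq_top_iff_one, Module.mem_annihilator]
    intro h
    obtain ⟨y, hy⟩ := exists_ne (0 : M)
    exact hy (by simpa using h y)
  have hloc : IsLocalRing (R ⧸ Module.annihilator R M) :=
    IsLocalRing.of_surjective' (Ideal.Quotient.mk _) Ideal.Quotient.mk_surjective
  obtain ⟨y, -, T, hT⟩ := NIT.exists_sop_pow (A := R ⧸ Module.annihilator R M) 0 (by rw [h]; rfl)
  refine ⟨T, fun x hx z => ?_⟩
  have h1 : (maximalIdeal R).map (Ideal.Quotient.mk (Module.annihilator R M)) ≤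
      maximalIdeal (R ⧸ Module.annihilator R M) := by
    have hlh : IsLocalHom (Ideal.Quotient.mk (Module.annihilator R M)) :=
      IsLocalHom.of_surjective _ Ideal.Quotient.mk_surjective
    exact ((IsLocalRing.local_hom_TFAE (Ideal.Quotient.mk (Module.annihilator R M))).out 0 2).1 hlh
  have h2 := hT ((Ideal.pow_right_mono h1 T) (by
    rw [← Ideal.map_pow]; exact Ideal.mem_map_of_mem _ hx))
  rw [Set.range_eq_empty, Ideal.span_empty, Ideal.mem_bot, Ideal.Quotient.eq_zero_iff_mem] at h2
  exact Module.mem_annihilator.1 h2 z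

end NIT

/-- **Theorem 3.8.** Let `C` be a semidualizing module over a Noetherian local ring `R`.
If there exists a non-zero Cohen-Macaulay `R`-module `M` with finite `C`-projective
dimension, then `R` is Cohen-Macaulay. -/
theorem isCohenMacaulayRing_of_cProjDim_ne_top
    (R : Type u) [CommRing R] [IsNoetherianRing R] [IsLocalRing R]
    (C : Type u) [AddCommGroup C] [Module R C] (hC : IsSemidualizing R C)
    (M : Type u) [AddCommGroup M] [Module R M] [Module.Finite R M]
    (hM : Nontrivial M) (hCM : IsCohenMacaulayModule R M)
    (hfin : cProjDim R C M ≠ ⊤) :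
    IsCohenMacaulayRing R := by
  have hg := NIT.fin_aux R C hC M hfin
  have : Module.Finite R C := hC.1
  unfold IsCohenMacaulayModule at hCM
  -- finite dimension
  have hann : Nontrivial (R ⧸ Module.annihilator R M) := by
    refine Ideal.Quotient.nontrivial_iff.2 ?_
    rw [Ne, Ideal.eq_top_iff_one, Module.mem_annihilator]
    intro h
    obtain ⟨y, hy⟩ := exists_ne (0 : M)
    exact hy (by simpa using h y)
  have hloc : IsLocalRing (R ⧸ Module.annihilator R M) :=
    IsLocalRing.of_surjective' (Ideal.Quotient.mk _) Ideal.Quotient.mk_surjective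
  obtain ⟨d, hd⟩ := NIT.exists_dim_eq (A := R ⧸ Module.annihilator R M)
  have hdep : depth R M = d := by
    unfold moduleDim at hCM
    rw [hd] at hCM
    exact_mod_cast hCM
  have hatt : depth R M ∈ {n : ℕ∞ | ∃ rs : List R, (rs.length : ℕ∞) = n ∧ (∀ x ∈ rs, x ∈ maximalIdeal R) ∧
    RingTheory.Sequence.IsRegular M rs} :=
    @ENat.sSup_mem_of_nonempty_of_lt_top _
      ⟨⟨0, [], by simp, by simp, RingTheory.Sequence.IsRegular.nil R M⟩⟩
      (by change depth R M < ⊤; rw [hdep]; exact ENat.coe_lt_top d)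
  obtain ⟨rs, hlen, hrm, hreg⟩ := hatt
  have hg' := NIT.good_list rs hreg.1 hg
  have hsup := NIT.depth_le R M rs hreg
  have hlen' : rs.length = d := by rw [hdep] at hlen; exact_mod_cast hlen
  have hM' : Nontrivial (M ⧸ (Ideal.ofList rs • ⊤ : Submodule R M)) :=
    Submodule.Quotient.nontrivial_iff.2 hreg.2.symm
  have hs0 : Module.supportDim R (M ⧸ (Ideal.ofList rs • ⊤ : Submodule R M)) = 0 := by
    unfold moduleDim at hsup
    rw [hd, hlen'] at hsup
    have h1 : Module.supportDim R (M ⧸ (Ideal.ofList rs • ⊤ : Submodule R M)) + (d : WithBot ℕ∞)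
        = 0 + (d : WithBot ℕ∞) := by rw [hsup, zero_add]
    generalize Module.supportDim R (M ⧸ (Ideal.ofList rs • ⊤ : Submodule R M)) = a at h1
    induction a with
    | bot => exact absurd h1 (by rw [WithBot.bot_add]; simp)
    | coe a =>
      have h2 : a + (d : ℕ∞) = 0 + d := by exact_mod_cast h1
      have : a = 0 := by
        exact (ENat.add_left_injective_of_ne_top (ENat.coe_ne_top d)) h2
      rw [this]; rfl
  obtain ⟨T, hT⟩ := NIT.pow_kill R (M ⧸ (Ideal.ofList rs • ⊤ : Submodule R M)) hs0
  obtain ⟨n, hn⟩ := hg'.pd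
  have hN : Nontrivial (C →ₗ[R] (M ⧸ (Ideal.ofList rs • ⊤ : Submodule R M))) := by
    by_contra hcon
    rw [not_nontrivial_iff_subsingleton] at hcon
    have : Subsingleton (TensorProduct R C (C →ₗ[R] (M ⧸ (Ideal.ofList rs • ⊤ : Submodule R M)))) :=
      inferInstance
    have : Subsingleton (M ⧸ (Ideal.ofList rs • ⊤ : Submodule R M)) :=
      hg'.bij.2.subsingleton
    exact not_subsingleton _ this
  obtain ⟨xs, hx1, hx2, hx3⟩ := NIT.cm_of_finpd
    (C →ₗ[R] (M ⧸ (Ideal.ofList rs • ⊤ : Submodule R M))) T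
    (fun x hx y => by ext c; exact hT x hx (y c)) n hn
  unfold IsCohenMacaulayRing IsCohenMacaulayModule
  have hmd : moduleDim R R ≤ ringKrullDim R :=
    ringKrullDim_le_of_surjective (Ideal.Quotient.mk _) Ideal.Quotient.mk_surjective
  have hle : ∀ ys : List R, RingTheory.Sequence.IsRegular R ys →
      ((ys.length : ℕ∞) : WithBot ℕ∞) ≤ moduleDim R R := by
    intro ys hys
    have h := NIT.depth_le R R ys hys
    have : Nontrivial (R ⧸ (Ideal.ofList ys • ⊤ : Submodule R R)) :=
      Submodule.Quotient.nontrivial_iff.2 hys.2.symm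
    have h0 : 0 ≤ Module.supportDim R (R ⧸ (Ideal.ofList ys • ⊤ : Submodule R R)) := by
      have := Module.supportDim_ne_bot_of_nontrivial R (R ⧸ (Ideal.ofList ys • ⊤ : Submodule R R))
      generalize Module.supportDim R (R ⧸ (Ideal.ofList ys • ⊤ : Submodule R R)) = a at this
      induction a with
      | bot => exact absurd rfl this
      | coe a => exact WithBot.coe_le_coe.2 (zero_le : (0 : ℕ∞) ≤ a)
    rw [← h]
    exact le_add_of_nonneg_left h0
  have hupper : (depth R R : WithBot ℕ∞) ≤ moduleDim R R := by
    have h1 := hle xs hx2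
    generalize moduleDim R R = a at h1 hle
    induction a with
    | bot => exact absurd h1 (by simp)
    | coe a =>
      refine WithBot.coe_le_coe.2 (sSup_le ?_)
      rintro _ ⟨ys, rfl, -, hys⟩
      exact WithBot.coe_le_coe.1 (hle ys hys)
  refine le_antisymm hupper (hmd.trans (hx3.trans ?_))
  exact WithBot.coe_le_coe.2 (le_sSup ⟨xs, rfl, hx1, hx2⟩)
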